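/- arXiv:1810.03881 — 3 statements merged into one kernel-verified Lean document; each statement's English description precedes it below -/
import Mathlib

section
/- Let p ≠ q be odd primes, let k ≥ 1, and let B be a p^k-form of rank n ≥ 1. Let s be the largest integer such that q^s divides p^{2[q|p]} − 1, fix an integer r ≥ 1, and set r̃ = max(r − s, 0). Then there exists an isometry A of B whose order (as an element of the group O(B)) is exactly q^r if and only if n ≥ 2[q|p]·q^{r̃} + 1, or n = 2[q|p]·q^{r̃} and ε(B) = η(q). -/
open Matrix

/-- `minExp p q` is the least positive integer `a` such that `q ∣ p^a - 1` or `q ∣ p^a + 1`.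
(This is denoted `[q|p]` in the paper.) -/
noncomputable def minExp (p q : ℕ) : ℕ :=
  sInf {a : ℕ | 0 < a ∧ (q ∣ p ^ a - 1 ∨ q ∣ p ^ a + 1)}

/-- `eta p q` is `1` if `q ∣ p^[q|p] - 1` and `-1` otherwise. -/
noncomputable def eta (p q : ℕ) : ℤ :=
  if q ∣ p ^ minExp p q - 1 then 1 else -1

open Classical in
/-- The index `ε(B)` of a symmetric bilinear form `B` over `ℤ/p^kℤ`:
`ε₁ · ε₂`, where `ε₁ = 1` iff `det B` is a square, and
`ε₂ = -1` iff `p ≡ 3 (mod 4)` and the rank is `≡ 2 (mod 4)`. -/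
noncomputable def epsilon (p : ℕ) {ι : Type*} [Fintype ι] [DecidableEq ι] {R : Type*}
    [CommRing R] (B : Matrix ι ι R) : ℤ :=
  (if IsSquare B.det then 1 else -1) *
    (if p % 4 = 3 ∧ Fintype.card ι % 4 = 2 then -1 else 1)

set_option linter.style.haveILetI false
set_option linter.unusedVariables false

section NT

lemma nt_dvd_iff (p q a : ℕ) (hp : p.Prime) : q ∣ p ^ (2 * a) - 1 ↔ ((p : ZMod q) ^ 2) ^ a = 1 := by
  rw [← ZMod.natCast_eq_zero_iff, Nat.cast_sub (Nat.one_le_pow _ _ hp.pos), sub_eq_zero, pow_mul]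
  push_cast
  rfl

lemma nt_minExp (p q : ℕ) (hp : p.Prime) (hq : q.Prime) (hpq : p ≠ q) :
    0 < minExp p q ∧ ∀ a, q ∣ p ^ (2 * a) - 1 ↔ minExp p q ∣ a := by
  haveI := Fact.mk hq
  have key : ∀ a, (q ∣ p ^ a - 1 ∨ q ∣ p ^ a + 1) ↔ q ∣ p ^ (2 * a) - 1 := by
    intro a
    rw [← hq.dvd_mul]
    have : (p ^ a - 1) * (p ^ a + 1) = p ^ (2 * a) - 1 := by
      have h := Nat.sq_sub_sq (p ^ a) 1
      rw [mul_comm, ← h, mul_comm 2 a, pow_mul, one_pow]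
    rw [this]
  have hx : ((p : ZMod q) ^ 2) ≠ 0 := by
    apply pow_ne_zero
    intro h
    rw [ZMod.natCast_eq_zero_iff] at h
    exact hpq ((Nat.prime_dvd_prime_iff_eq hq hp).1 h).symm
  have hpos : 0 < orderOf ((p : ZMod q) ^ 2) := by
    rw [orderOf_pos_iff]
    exact isOfFinOrder_iff_isUnit.2 hx.isUnit
  have hm : minExp p q = orderOf ((p : ZMod q) ^ 2) := by
    have hmem : orderOf ((p : ZMod q) ^ 2) ∈ {a : ℕ | 0 < a ∧ (q ∣ p ^ a - 1 ∨ q ∣ p ^ a + 1)} := by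
      refine ⟨hpos, ?_⟩
      rw [key, nt_dvd_iff p q _ hp, pow_orderOf_eq_one]
    apply le_antisymm
    · exact Nat.sInf_le hmem
    · have := Nat.sInf_mem ⟨_, hmem⟩
      exact orderOf_le_of_pow_eq_one this.1 ((nt_dvd_iff p q _ hp).1 ((key _).1 this.2))
  rw [hm]
  refine ⟨hpos, fun a => ?_⟩
  rw [nt_dvd_iff p q a hp, orderOf_dvd_iff_pow_eq_one]

lemma nt_main (p q : ℕ) (hp : p.Prime) (hq : q.Prime) (hp2 : p ≠ 2) (hq2 : q ≠ 2)
    (hpq : p ≠ q) (s : ℕ) (hs : q ^ s ∣ p ^ (2 * minExp p q) - 1)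
    (hs' : ¬ q ^ (s + 1) ∣ p ^ (2 * minExp p q) - 1)
    (r : ℕ) (hr : 1 ≤ r) (a : ℕ) :
    q ^ r ∣ p ^ (2 * a) - 1 ↔ minExp p q * q ^ (r - s) ∣ a := by
  haveI := Fact.mk hq
  obtain ⟨hm0, hm⟩ := nt_minExp p q hp hq hpq
  set m := minExp p q with hmdef
  by_cases hma : m ∣ a
  · obtain ⟨b, rfl⟩ := hma
    rw [Nat.mul_dvd_mul_iff_left hm0]
    rcases Nat.eq_zero_or_pos b with rfl | hb
    · simp
    have hP1 : 1 < p ^ (2 * m) := Nat.one_lt_pow (by omega) hp.one_lt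
    have hqP : q ∣ p ^ (2 * m) - 1 := (hm m).2 dvd_rfl
    have hnq : ¬ q ∣ p ^ (2 * m) := by
      intro h
      exact hpq ((Nat.prime_dvd_prime_iff_eq hq hp).1 (hq.dvd_of_dvd_pow h)).symm
    have hv := padicValNat.pow_sub_pow (p := q) (hq.odd_of_ne_two hq2) hP1 hqP hnq (n := b) hb.ne'
    have hP0 : p ^ (2 * m) - 1 ≠ 0 := by omega
    have hvs : padicValNat q (p ^ (2 * m) - 1) = s := by
      rw [padicValNat_dvd_iff_le hP0] at hs hs'
      omega
    have hPb0 : p ^ (2 * (m * b)) - 1 ≠ 0 := by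
      have : 1 < p ^ (2 * (m * b)) := Nat.one_lt_pow (by positivity) hp.one_lt
      omega
    rw [padicValNat_dvd_iff_le hPb0, padicValNat_dvd_iff_le hb.ne']
    rw [one_pow, hvs, ← pow_mul, mul_assoc] at hv
    rw [hv]
    omega
  · constructor
    · intro h
      exact absurd ((hm a).1 ((dvd_pow_self q (by omega)).trans h)) hma
    · intro h
      exact absurd ((Dvd.intro _ rfl).trans h) hma

/-- sign of `p^e` modulo `q^r` -/
lemma nt_sign (p q : ℕ) (hp : p.Prime) (hq : q.Prime) (hp2 : p ≠ 2) (hq2 : q ≠ 2)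
    (hpq : p ≠ q) (s : ℕ) (hs : q ^ s ∣ p ^ (2 * minExp p q) - 1)
    (hs' : ¬ q ^ (s + 1) ∣ p ^ (2 * minExp p q) - 1)
    (r : ℕ) (hr : 1 ≤ r) :
    (eta p q = 1 ∧ q ^ r ∣ p ^ (minExp p q * q ^ (r - s)) - 1) ∨
    (eta p q = -1 ∧ q ^ r ∣ p ^ (minExp p q * q ^ (r - s)) + 1) := by
  haveI := Fact.mk hq
  obtain ⟨hm0, hm⟩ := nt_minExp p q hp hq hpq
  have h1 := (nt_main p q hp hq hp2 hq2 hpq s hs hs' r hr (minExp p q * q ^ (r - s))).2 dvd_rfl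
  have hqm : q ∣ p ^ (2 * minExp p q) - 1 := (hm _).2 dvd_rfl
  set m := minExp p q with hmdef
  set e := m * q ^ (r - s) with he
  have fac : ∀ a, (p ^ a - 1) * (p ^ a + 1) = p ^ (2 * a) - 1 := by
    intro a
    have h := Nat.sq_sub_sq (p ^ a) 1
    rw [mul_comm, ← h, mul_comm 2 a, pow_mul, one_pow]
  have hq3 : 2 < q := lt_of_le_of_ne hq.two_le (Ne.symm hq2)
  have excl : ∀ a, q ∣ p ^ a - 1 → q ∣ p ^ a + 1 → False := by
    intro a h1 h2
    have h3 := Nat.dvd_sub h2 h1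
    have : 1 ≤ p ^ a := Nat.one_le_pow _ _ hp.pos
    have h4 : p ^ a + 1 - (p ^ a - 1) = 2 := by omega
    rw [h4] at h3
    exact absurd (Nat.le_of_dvd (by norm_num) h3) (by omega)
  rw [← fac] at h1
  have hodd : Odd (q ^ (r - s)) := (hq.odd_of_ne_two hq2).pow
  by_cases hc : q ∣ p ^ m - 1
  · left
    refine ⟨by simp [eta, ← hmdef, hc], ?_⟩
    have h2 : q ∣ p ^ e - 1 := by
      refine hc.trans ?_
      rw [he, pow_mul]
      simpa using Nat.sub_dvd_pow_sub_pow (p ^ m) 1 (q ^ (r - s))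
    have h3 : Nat.Coprime (q ^ r) (p ^ e + 1) :=
      Nat.Coprime.pow_left _ ((Nat.Prime.coprime_iff_not_dvd hq).2 fun h => excl e h2 h)
    exact h3.dvd_of_dvd_mul_right h1
  · right
    refine ⟨by simp [eta, ← hmdef, hc], ?_⟩
    have hc' : q ∣ p ^ m + 1 := by
      rw [← fac, hq.dvd_mul] at hqm
      tauto
    have h2 : q ∣ p ^ e + 1 := by
      refine hc'.trans ?_
      rw [he, pow_mul]
      simpa using hodd.nat_add_dvd_pow_add_pow (p ^ m) 1
    have h3 : Nat.Coprime (q ^ r) (p ^ e - 1) :=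
      Nat.Coprime.pow_left _ ((Nat.Prime.coprime_iff_not_dvd hq).2 fun h => excl e h h2)
    exact h3.dvd_of_dvd_mul_left h1

end NT

section Alt

/-- the determinant of an alternating matrix over a field is a square -/
lemma alt_det_isSquare {F : Type*} [Field F] : ∀ (N : ℕ) {ι : Type} [Fintype ι] [DecidableEq ι]
    (M : Matrix ι ι F), Fintype.card ι = N → Mᵀ = -M → (∀ i, M i i = 0) → IsSquare M.det := by
  intro N
  induction N using Nat.strong_induction_on with
  | _ N ih =>
  intro ι _ _ M hN hM hd
  by_cases h0 : ∀ i j, M i j = 0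
  · have hM0 : M = 0 := by ext i j; exact h0 i j
    subst hM0
    rcases isEmpty_or_nonempty ι with h | h
    · simp
    · rw [Matrix.det_zero]
      exact ⟨0, by simp⟩
  · push Not at h0
    obtain ⟨i, j, hij⟩ := h0
    have hne : i ≠ j := by
      rintro rfl
      exact hij (hd i)
    have hanti : ∀ a b, M b a = - M a b := by
      intro a b
      have := congrFun (congrFun hM a) b
      simpa using this
    let S : ι → Prop := fun x => x = i ∨ x = j
    haveI : DecidablePred S := fun x => inferInstanceAs (Decidable (x = i ∨ x = j))
    let κ := {x // ¬ S x}
    let f : Fin 2 ≃ {x // S x} :=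
      { toFun := fun t => if t = 0 then ⟨i, Or.inl rfl⟩ else ⟨j, Or.inr rfl⟩
        invFun := fun x => if x.1 = i then 0 else 1
        left_inv := by
          intro t
          fin_cases t <;> simp [hne.symm]
        right_inv := by
          rintro ⟨x, hx⟩
          rcases hx with rfl | rfl
          · simp
          · simp [hne.symm] }
    let g : Fin 2 ⊕ κ ≃ ι := (Equiv.sumCongr f (Equiv.refl κ)).trans (Equiv.sumCompl S)
    have hdet : M.det = (M.submatrix g g).det := (Matrix.det_submatrix_equiv_self g M).symm
    have hcard : Fintype.card κ + 2 = N := by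
      have := Fintype.card_congr g
      rw [Fintype.card_sum, Fintype.card_fin] at this
      omega
    set M' := M.submatrix g g with hM'
    have hanti' : ∀ a b, M' b a = - M' a b := fun a b => hanti _ _
    have hd' : ∀ a, M' a a = 0 := fun a => hd _
    set a := M i j with ha
    have h01 : M' (Sum.inl 0) (Sum.inl 1) = a := by
      rfl
    have hA : M'.toBlocks₁₁ = !![0, a; -a, 0] := by
      ext x y
      fin_cases x <;> fin_cases y
      · exact hd' _
      · exact h01
      · exact (hanti' (Sum.inl 0) (Sum.inl 1)).trans (congrArg Neg.neg h01)
      · exact hd' _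
    let Ai : Matrix (Fin 2) (Fin 2) F := !![0, -a⁻¹; a⁻¹, 0]
    haveI : Invertible M'.toBlocks₁₁ := by
      have h1 : Ai * M'.toBlocks₁₁ = 1 := by
        rw [hA]
        ext x y
        fin_cases x <;> fin_cases y <;> simp [Ai, hij]
      exact ⟨Ai, h1, mul_eq_one_comm.1 h1⟩
    have hinv : ⅟ M'.toBlocks₁₁ = Ai := by
      apply invOf_eq_left_inv
      rw [hA]
      ext x y
      fin_cases x <;> fin_cases y <;> simp [Ai, hij]
    rw [hdet, ← Matrix.fromBlocks_toBlocks M', Matrix.det_fromBlocks₁₁]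
    refine IsSquare.mul ⟨a, ?_⟩ ?_
    · rw [hA]; simp [Matrix.det_fin_two]
    · rw [hinv]
      refine ih (Fintype.card κ) (by omega) _ rfl ?_ ?_
      · ext x y
        simp [Matrix.mul_apply, Fin.sum_univ_two, Ai, Matrix.toBlocks₁₂, Matrix.toBlocks₂₁, Matrix.toBlocks₂₂]
        rw [hanti' (Sum.inr x) (Sum.inr y), hanti' (Sum.inr x) (Sum.inl 0), hanti' (Sum.inr x) (Sum.inl 1),
          hanti' (Sum.inr y) (Sum.inl 0), hanti' (Sum.inr y) (Sum.inl 1)]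
        ring
      · intro x
        simp [Matrix.mul_apply, Fin.sum_univ_two, Ai, Matrix.toBlocks₁₂, Matrix.toBlocks₂₁, Matrix.toBlocks₂₂]
        rw [hd' (Sum.inr x), hanti' (Sum.inr x) (Sum.inl 0), hanti' (Sum.inr x) (Sum.inl 1)]
        ring

end Alt

section Lift

variable {R F : Type*} [CommRing R] [Field F] (f : R →+* F) (ϖ : R)

lemma lift_isUnit (hf : Function.Surjective f) (hker : ∀ x, f x = 0 → ∃ y, x = ϖ * y)
    {k : ℕ} (hnil : ϖ ^ k = 0) {x : R} (hx : f x ≠ 0) : IsUnit x := by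
  obtain ⟨y, hy⟩ := hf (f x)⁻¹
  obtain ⟨z, hz⟩ := hker (x * y - 1) (by rw [map_sub, map_mul, hy, mul_inv_cancel₀ hx, map_one, sub_self])
  have h1 : IsUnit (x * y) := by
    have : x * y = ϖ * z + 1 := by rw [← hz]; ring
    rw [this]
    apply IsNilpotent.isUnit_add_one
    exact ⟨k, by rw [mul_pow, hnil, zero_mul]⟩
  exact isUnit_of_mul_isUnit_left h1

lemma lift_isom (hf : Function.Surjective f) (hker : ∀ x, f x = 0 → ∃ y, x = ϖ * y)
    {k : ℕ} (hk : 1 ≤ k) (hnil : ϖ ^ k = 0) (hϖ : f ϖ = 0) (h2 : (2 : F) ≠ 0)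
    {ι : Type*} [Fintype ι] [DecidableEq ι] (B B' : Matrix ι ι R) (hB : Bᵀ = B) (hB' : B'ᵀ = B')
    (hBu : IsUnit B.det) (hBu' : IsUnit B'.det)
    (A : Matrix ι ι F) (hA : Aᵀ * B.map f * A = B'.map f) :
    ∃ A' : Matrix ι ι R, A'.map f = A ∧ A'ᵀ * B * A' = B' := by
  have h2u : IsUnit (2 : R) := lift_isUnit f ϖ hf hker hnil (by rwa [map_ofNat])
  obtain ⟨half, hhalf⟩ := h2u.exists_right_inv
  have hdetmap : ∀ M : Matrix ι ι R, (M.map f).det = f M.det := fun M => (RingHom.map_det f M).symm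
  have hAdet : A.det ≠ 0 := by
    intro h
    have := congrArg Matrix.det hA
    rw [Matrix.det_mul, h, mul_zero, hdetmap] at this
    exact (hBu'.map f).ne_zero this.symm
  have step : ∀ j : ℕ, ∃ A' E : Matrix ι ι R, A'.map f = A ∧ A'ᵀ * B * A' - B' = ϖ ^ (j + 1) • E := by
    intro j
    induction j with
    | zero =>
      choose g hg using hf
      refine ⟨A.map g, ?_⟩
      have h1 : (A.map g).map f = A := by ext i j; simp [hg]
      have h3 : ∀ i j, ∃ y, ((A.map g)ᵀ * B * (A.map g) - B') i j = ϖ * y := by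
        intro i j
        apply hker
        have : (((A.map g)ᵀ * B * (A.map g) - B').map f) = 0 := by
          rw [Matrix.map_sub _ (map_sub f), Matrix.map_mul, Matrix.map_mul, Matrix.transpose_map, h1, hA, sub_self]
        exact congrFun (congrFun this i) j
      choose E hE using h3
      exact ⟨Matrix.of E, h1, by ext i j; simp only [hE]; simp⟩
    | succ j ih =>
      obtain ⟨A', E, h1, h3⟩ := ih
      set D := A'ᵀ * B * A' - B' with hD
      have hDs : Dᵀ = D := by
        rw [hD, Matrix.transpose_sub, Matrix.transpose_mul, Matrix.transpose_mul, Matrix.transpose_transpose, hB, hB', Matrix.mul_assoc]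
      have hu : IsUnit (A'ᵀ * B).det := by
        rw [Matrix.det_mul, Matrix.det_transpose]
        refine IsUnit.mul ?_ hBu
        apply lift_isUnit f ϖ hf hker hnil
        rw [← hdetmap, h1]; exact hAdet
      obtain ⟨V, hV⟩ : ∃ V : Matrix ι ι R, A'ᵀ * B * V = 1 := ⟨_, Matrix.mul_nonsing_inv _ hu⟩
      set Y' : Matrix ι ι R := (-half) • (V * E) with hY'
      set Y := ϖ ^ (j + 1) • Y' with hY
      have e1 : A'ᵀ * B * Y = (-half) • D := by
        rw [hY, hY', h3, Matrix.mul_smul, Matrix.mul_smul, ← Matrix.mul_assoc, hV, Matrix.one_mul, smul_comm]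
      have e2 : Yᵀ * B * A' = (-half) • D := by
        have := congrArg Matrix.transpose e1
        rw [Matrix.transpose_mul, Matrix.transpose_mul, Matrix.transpose_transpose, hB, Matrix.transpose_smul (-half) D, hDs] at this
        rw [← this, Matrix.mul_assoc]
      refine ⟨A' + Y, ϖ ^ j • (Y'ᵀ * B * Y'), ?_, ?_⟩
      · ext a b
        have : f (Y a b) = 0 := by
          rw [hY]; simp [hϖ]
        rw [← h1]
        simp [this]
      · have e3 : (A' + Y)ᵀ * B * (A' + Y) - B' = D + A'ᵀ * B * Y + Yᵀ * B * A' + Yᵀ * B * Y := by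
          rw [hD, Matrix.transpose_add]; noncomm_ring
        rw [e3, e1, e2]
        have e4 : D + -half • D + -half • D = 0 := by
          have : D + -half • D + -half • D = (1 - 2 * half) • D := by
            rw [sub_smul, one_smul, two_mul, add_smul, neg_smul]; abel
          rw [this, hhalf, sub_self, zero_smul]
        rw [e4, zero_add, hY, Matrix.transpose_smul, Matrix.smul_mul, Matrix.smul_mul, Matrix.mul_smul, smul_smul, smul_smul]
        congr 1
        ring
  obtain ⟨A', E, h1, h3⟩ := step (k - 1)
  refine ⟨A', h1, ?_⟩
  rw [Nat.sub_add_cancel hk, hnil, zero_smul, sub_eq_zero] at h3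
  exact h3

lemma lift_isSquare (hf : Function.Surjective f) (hker : ∀ x, f x = 0 → ∃ y, x = ϖ * y)
    {k : ℕ} (hk : 1 ≤ k) (hnil : ϖ ^ k = 0) (hϖ : f ϖ = 0) (h2 : (2 : F) ≠ 0) (u : R) (hu : IsUnit u) :
    IsSquare (f u) ↔ IsSquare u := by
  constructor
  · rintro ⟨v, hv⟩
    obtain ⟨A', -, h⟩ := lift_isom f ϖ hf hker hk hnil hϖ h2 (ι := Fin 1) (Matrix.of fun _ _ => 1) (Matrix.of fun _ _ => u)
      (by ext; simp) (by ext; simp) (by simp) (by simpa using hu) (Matrix.of fun _ _ => v) (by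
        ext i j; simp [Matrix.mul_apply, hv])
    refine ⟨A' 0 0, ?_⟩
    have := congrFun (congrFun h 0) 0
    simp [Matrix.mul_apply] at this
    exact this.symm
  · exact fun h => h.map f

end Lift

section Classif

open Module LinearMap LinearMap.BilinForm

variable {F : Type*} [Field F] [Fintype F]

lemma exists_quad_one (hF : Fintype.card F % 2 = 1) (a b : F) (ha : a ≠ 0) (hb : b ≠ 0) :
    ∃ x y : F, a * x ^ 2 + b * y ^ 2 = 1 := by
  open Polynomial in
  obtain ⟨x, y, h⟩ := FiniteField.exists_root_sum_quadratic (R := F) (f := C a * X ^ 2) (g := C b * X ^ 2 - 1)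
    (by rw [degree_C_mul_X_pow _ ha]; rfl)
    (by
      rw [degree_sub_eq_left_of_degree_lt]
      · rw [degree_C_mul_X_pow _ hb]; rfl
      · rw [degree_C_mul_X_pow _ hb, degree_one]; norm_num) hF
  refine ⟨x, y, ?_⟩
  simp at h
  linear_combination h

lemma exists_rep_one (hF : Fintype.card F % 2 = 1) (h2 : (2 : F) ≠ 0) {V : Type*} [AddCommGroup V] [Module F V]
    [FiniteDimensional F V] (b : LinearMap.BilinForm F V) (hs : b.IsSymm) (hn : b.Nondegenerate)
    (hd : 2 ≤ finrank F V) : ∃ v, b v v = 1 := by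
  haveI : Invertible (2 : F) := invertibleOfNonzero h2
  obtain ⟨v, hv⟩ := LinearMap.BilinForm.exists_orthogonal_basis (LinearMap.BilinForm.isSymm_iff.1 hs)
  have hne := fun i => hv.not_isOrtho_basis_self_of_separatingLeft hn.1 i
  let i : Fin (finrank F V) := ⟨0, by omega⟩
  let j : Fin (finrank F V) := ⟨1, by omega⟩
  have hij : i ≠ j := by simp [i, j]
  obtain ⟨x, y, h⟩ := exists_quad_one hF _ _ (hne i) (hne j)
  refine ⟨x • v i + y • v j, ?_⟩
  have h1 : b (v i) (v j) = 0 := hv hij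
  have h3 : b (v j) (v i) = 0 := hv hij.symm
  simp [h1, h3]
  linear_combination h

lemma exists_normal_basis (hF : Fintype.card F % 2 = 1) (h2 : (2 : F) ≠ 0) : ∀ (d : ℕ) {V : Type _} [AddCommGroup V] [Module F V]
    [FiniteDimensional F V] (b : LinearMap.BilinForm F V) (hs : b.IsSymm) (hn : b.Nondegenerate)
    (hd : finrank F V = d + 1), ∃ (v : Basis (Fin (d + 1)) F V) (u : F), ∀ i j, b (v i) (v j) =
      if i = j then (if i = Fin.last d then u else 1) else 0 := by
  intro d
  induction d with
  | zero =>
    intro V _ _ _ b hs hn hd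
    let v : Basis (Fin 1) F V := finBasisOfFinrankEq F V hd
    refine ⟨v, b (v 0) (v 0), ?_⟩
    intro i j
    fin_cases i; fin_cases j
    simp
  | succ d ih =>
    intro V _ _ _ b hs hn hd
    obtain ⟨x, hx1⟩ := exists_rep_one hF h2 b hs hn (by omega)
    have hx : b x x ≠ 0 := by rw [hx1]; exact one_ne_zero
    have hc := LinearMap.BilinForm.isCompl_span_singleton_orthogonal hx
    have hx0 : x ≠ 0 := by rintro rfl; simp at hx
    rw [← Submodule.finrank_add_eq_of_isCompl hc.symm, finrank_span_singleton hx0] at hd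
    have hn' := restrict_nondegenerate_orthogonal_spanSingleton b hn hs.isRefl hx
    obtain ⟨v', u, hv'⟩ := ih (b.restrict (b.orthogonal (F ∙ x))) (hs.restrict _) hn' (by omega)
    have hmem : ∀ y : V, y ∈ b.orthogonal (F ∙ x) ↔ b x y = 0 := by
      intro y
      rw [LinearMap.BilinForm.mem_orthogonal_iff]
      constructor
      · intro h
        exact h x (Submodule.mem_span_singleton_self x)
      · intro h z hz
        obtain ⟨c, rfl⟩ := Submodule.mem_span_singleton.1 hz
        simp [h]
    let B : Basis (Fin (d + 2)) F V :=
      Basis.mkFinCons x v'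
        (by
          rintro c y hy hc
          rw [hmem] at hy
          have := congrArg (b x) hc
          simpa [hy, hx1] using this)
        (by
          intro y
          refine ⟨- b x y, ?_⟩
          rw [hmem]
          simp [hx1])
    have hBz : B 0 = x := by simp [B]
    have hBs : ∀ i : Fin (d + 1), B i.succ = (v' i : V) := by intro i; simp [B]
    have hxv : ∀ i, b x (v' i) = 0 := fun i => (hmem _).1 (v' i).2
    refine ⟨B, u, ?_⟩
    intro i j
    refine Fin.cases ?_ (fun i => ?_) i <;> refine Fin.cases ?_ (fun j => ?_) j
    · rw [hBz, hx1]; simp [Fin.ext_iff]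
    · rw [hBz, hBs, hxv]; simp [(Fin.succ_ne_zero j).symm]
    · rw [hBz, hBs, hs.eq, hxv]; simp
    · rw [hBs, hBs]
      have := hv' i j
      rw [LinearMap.BilinForm.restrict_apply] at this
      simp only [LinearMap.domRestrict_apply] at this
      rw [this]
      simp [Fin.ext_iff]

lemma matrix_normal (hF : Fintype.card F % 2 = 1) (h2 : (2 : F) ≠ 0) (d : ℕ) {ι : Type _} [Fintype ι] [DecidableEq ι]
    (B : Matrix ι ι F) (hB : Bᵀ = B) (hdet : B.det ≠ 0) (hc : Fintype.card ι = d + 1) :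
    ∃ (P : Matrix ι (Fin (d + 1)) F) (P' : Matrix (Fin (d + 1)) ι F) (u : F), P * P' = 1 ∧ P' * P = 1 ∧
      Pᵀ * B * P = diagonal (fun i => if i = Fin.last d then u else 1) := by
  have hn : (Matrix.toBilin' B).Nondegenerate := by
    rw [LinearMap.BilinForm.nondegenerate_toBilin'_iff_det_ne_zero]
    exact hdet
  have hs : (Matrix.toBilin' B).IsSymm := by
    rw [← LinearMap.BilinForm.isSymm_toMatrix'_iff_isSymm, BilinForm.toMatrix'_toBilin']
    exact hB
  obtain ⟨v, u, hv⟩ := exists_normal_basis hF h2 d (Matrix.toBilin' B) hs hn (by simpa using hc)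
  let e := Pi.basisFun F ι
  refine ⟨e.toMatrix v, v.toMatrix e, u, Basis.toMatrix_mul_toMatrix_flip _ _, Basis.toMatrix_mul_toMatrix_flip _ _, ?_⟩
  have h1 := LinearMap.BilinForm.toMatrix_mul_basis_toMatrix e v (Matrix.toBilin' B)
  have h3 : LinearMap.BilinForm.toMatrix e (Matrix.toBilin' B) = B := by
    rw [LinearMap.BilinForm.toMatrix_basisFun, BilinForm.toMatrix'_toBilin']
  rw [h3] at h1
  rw [h1]
  ext i j
  rw [LinearMap.BilinForm.toMatrix_apply, hv, diagonal_apply]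

lemma classif (hF : Fintype.card F % 2 = 1) (h2 : (2 : F) ≠ 0) {ι : Type _} [Fintype ι] [DecidableEq ι]
    (B B' : Matrix ι ι F) (hB : Bᵀ = B) (hB' : B'ᵀ = B') (hdet : B.det ≠ 0) (hdet' : B'.det ≠ 0)
    (hsq : IsSquare (B.det * B'.det)) :
    ∃ P P' : Matrix ι ι F, P * P' = 1 ∧ P' * P = 1 ∧ Pᵀ * B * P = B' := by
  rcases hc : Fintype.card ι with _ | d
  · haveI := Fintype.card_eq_zero_iff.1 hc
    exact ⟨1, 1, by simp, by simp, Subsingleton.elim _ _⟩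
  obtain ⟨P, Q, u, hPQ, hQP, hP⟩ := matrix_normal hF h2 d B hB hdet hc
  obtain ⟨P', Q', u', hPQ', hQP', hP'⟩ := matrix_normal hF h2 d B' hB' hdet' hc
  have key : ∀ (B : Matrix ι ι F) (P : Matrix ι (Fin (d+1)) F) (Q : Matrix (Fin (d+1)) ι F) (u : F),
      B.det ≠ 0 → P * Q = 1 → Q * P = 1 → Pᵀ * B * P = diagonal (fun i => if i = Fin.last d then u else 1) →
      ∃ c : F, c ≠ 0 ∧ u = B.det * c ^ 2 := by
    intro B P Q u hB hPQ hQP h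
    let g : Fin (d + 1) ≃ ι := (Fintype.equivFinOfCardEq hc).symm
    let S : Matrix ι ι F := P.submatrix _root_.id g.symm
    let T : Matrix ι ι F := Q.submatrix g.symm _root_.id
    have hST : S * T = 1 := by
      simp only [S, T]
      rw [Matrix.submatrix_mul_equiv, hPQ]
      simp
    have h1 : Sᵀ * B * S = (diagonal (fun i => if i = Fin.last d then u else 1)).submatrix g.symm g.symm := by
      rw [← h]
      ext i j
      simp [S, Matrix.mul_apply]
    have h3 := congrArg Matrix.det h1
    rw [Matrix.det_submatrix_equiv_self, Matrix.det_diagonal, Matrix.det_mul, Matrix.det_mul, Matrix.det_transpose] at h3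
    refine ⟨S.det, ?_, ?_⟩
    · intro h0
      have := congrArg Matrix.det hST
      rw [Matrix.det_mul, h0] at this
      simp at this
    · rw [Finset.prod_ite_eq' Finset.univ (Fin.last d)] at h3
      simp at h3
      rw [← h3]; ring
  obtain ⟨c, hc0, hcu⟩ := key B P Q u hdet hPQ hQP hP
  obtain ⟨c', hc0', hcu'⟩ := key B' P' Q' u' hdet' hPQ' hQP' hP'
  obtain ⟨t, ht⟩ := hsq
  have ht0 : t ≠ 0 := by
    rintro rfl
    simp [hdet, hdet'] at ht
  obtain ⟨z, hz0, hz⟩ : ∃ z : F, z ≠ 0 ∧ u' = z * u * z := by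
    refine ⟨t * c' / (B.det * c), by positivity, ?_⟩
    rw [hcu, hcu']
    field_simp
    linear_combination ht
  let D : Matrix (Fin (d+1)) (Fin (d+1)) F := diagonal (fun i => if i = Fin.last d then z else 1)
  let D' : Matrix (Fin (d+1)) (Fin (d+1)) F := diagonal (fun i => if i = Fin.last d then z⁻¹ else 1)
  have hDD : D * D' = 1 := by
    simp only [D, D', diagonal_mul_diagonal, ← diagonal_one]
    congr 1
    ext i
    split_ifs <;> simp [hz0]
  have hDD' : D' * D = 1 := mul_eq_one_comm.1 hDD
  refine ⟨P * D * Q', P' * D' * Q, ?_, ?_, ?_⟩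
  · calc P * D * Q' * (P' * D' * Q) = P * (D * (Q' * P') * D') * Q := by simp only [Matrix.mul_assoc]
      _ = 1 := by rw [hQP', Matrix.mul_one, hDD, Matrix.mul_one, hPQ]
  · calc P' * D' * Q * (P * D * Q') = P' * (D' * (Q * P) * D) * Q' := by simp only [Matrix.mul_assoc]
      _ = 1 := by rw [hQP, Matrix.mul_one, hDD', Matrix.mul_one, hPQ']
  · have h1 : Dᵀ * (Pᵀ * B * P) * D = P'ᵀ * B' * P' := by
      rw [hP, hP']
      simp only [D, diagonal_transpose, diagonal_mul_diagonal]
      congr 1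
      ext i
      split_ifs <;> simp [hz]
    calc (P * D * Q')ᵀ * B * (P * D * Q') = Q'ᵀ * (Dᵀ * (Pᵀ * B * P) * D) * Q' := by
          simp only [Matrix.transpose_mul, Matrix.mul_assoc]
      _ = (P' * Q')ᵀ * B' * (P' * Q') := by rw [h1]; simp only [Matrix.transpose_mul, Matrix.mul_assoc]
      _ = B' := by rw [hPQ']; simp

end Classif

section Nec

open Polynomial

lemma exists_prim_root {p q r : ℕ} [Fact p.Prime] (hq : q.Prime) (hpq : p ≠ q) (hr : 1 ≤ r)
    {K : Type*} [Field K] [IsAlgClosed K] [Algebra (ZMod p) K] {ι : Type*} [Fintype ι] [DecidableEq ι]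
    (A : Matrix ι ι K) (hA : orderOf A = q ^ r) :
    ∃ μ : K, IsPrimitiveRoot μ (q ^ r) ∧ A.charpoly.IsRoot μ := by
  haveI := Fact.mk hq
  haveI : CharP K p := charP_of_injective_algebraMap (algebraMap (ZMod p) K).injective p
  haveI : NeZero ((q ^ r : ℕ) : K) := by
    constructor
    rw [Ne, CharP.cast_eq_zero_iff K p]
    intro h
    exact hpq ((Nat.prime_dvd_prime_iff_eq Fact.out hq).1 ((Fact.out : p.Prime).dvd_of_dvd_pow h))
  obtain ⟨r, rfl⟩ : ∃ r', r = r' + 1 := ⟨r - 1, by omega⟩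
  have h1 : aeval A (cyclotomic (q ^ (r + 1)) K) * (A ^ (q ^ r) - 1) = 0 := by
    have h := congrArg (aeval A) (cyclotomic_prime_pow_mul_X_pow_sub_one K q r)
    simp only [map_mul, map_sub, map_pow, aeval_X, map_one] at h
    rw [h, ← hA, pow_orderOf_eq_one, sub_self]
  have h2 : ¬ IsUnit (aeval A (cyclotomic (q ^ (r + 1)) K)) := by
    intro hu
    have := (hu.mul_right_eq_zero).1 h1
    rw [sub_eq_zero] at this
    have h3 := orderOf_dvd_of_pow_eq_one this
    rw [hA, Nat.pow_dvd_pow_iff_le_right hq.one_lt] at h3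
    omega
  have h3 : (0 : K) ∈ spectrum K (aeval A (cyclotomic (q ^ (r + 1)) K)) := by
    rw [spectrum.zero_mem_iff]; exact h2
  rw [spectrum.map_polynomial_aeval_of_degree_pos _ _ (degree_cyclotomic_pos _ _ (by positivity [hq.pos]))] at h3
  obtain ⟨μ, hμ, h0⟩ := h3
  refine ⟨μ, ?_, ?_⟩
  · exact isRoot_cyclotomic_iff.1 h0
  · exact Matrix.mem_spectrum_iff_isRoot_charpoly.1 hμ

lemma root_frob {p : ℕ} [Fact p.Prime] {K : Type*} [Field K] [Algebra (ZMod p) K] {ι : Type*} [Fintype ι] [DecidableEq ι]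
    (A : Matrix ι ι (ZMod p)) (μ : K) (h : (A.map (algebraMap (ZMod p) K)).charpoly.IsRoot μ) :
    (A.map (algebraMap (ZMod p) K)).charpoly.IsRoot (μ ^ p) := by
  have e : (A.map (algebraMap (ZMod p) K)).charpoly = A.charpoly.map (algebraMap (ZMod p) K) := by
    rw [Matrix.charpoly_map]
  rw [e] at h ⊢
  rw [IsRoot.def, eval_map_algebraMap] at h ⊢
  rw [← expand_aeval, ZMod.expand_card, map_pow, h, zero_pow (Fact.out : p.Prime).ne_zero]

lemma root_inv {K : Type*} [Field K] {ι : Type*} [Fintype ι] [DecidableEq ι]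
    (A B : Matrix ι ι K) (hB : B.det ≠ 0) (hA : Aᵀ * B * A = B) (μ : K) (hμ : μ ≠ 0) (h : A.charpoly.IsRoot μ) :
    A.charpoly.IsRoot μ⁻¹ := by
  rw [IsRoot.def, Matrix.eval_charpoly] at h ⊢
  have hAdet : A.det ≠ 0 := by
    intro h0
    have := congrArg Matrix.det hA
    rw [Matrix.det_mul, h0, mul_zero] at this
    exact hB this.symm
  have h1 : Aᵀ * B * (Matrix.scalar ι μ⁻¹ - A) = (-μ⁻¹) • ((Matrix.scalar ι μ - A)ᵀ * B) := by
    rw [Matrix.mul_sub, hA, Matrix.transpose_sub, Matrix.sub_mul, Matrix.scalar_apply, Matrix.scalar_apply, ← Matrix.smul_one_eq_diagonal,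
      ← Matrix.smul_one_eq_diagonal, Matrix.transpose_smul, Matrix.transpose_one, Matrix.mul_smul, Matrix.mul_one,
      Matrix.smul_mul, Matrix.one_mul, smul_sub, smul_smul]
    rw [neg_mul, inv_mul_cancel₀ hμ]
    simp only [neg_smul, one_smul]
    abel
  have h2 := congrArg Matrix.det h1
  rw [Matrix.det_smul, Matrix.det_mul (Matrix.transpose _), Matrix.det_transpose, h, zero_mul, mul_zero, Matrix.det_mul, Matrix.det_mul, Matrix.det_transpose] at h2
  simpa [hAdet, hB] using h2

lemma nec_main {p q r e : ℕ} [Fact p.Prime] (hp2 : p ≠ 2) (hq : q.Prime) (hq2 : q ≠ 2) (hpq : p ≠ q) (hr : 1 ≤ r)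
    (he : 0 < e) (H1 : ∀ a, q ^ r ∣ p ^ (2 * a) - 1 ↔ e ∣ a)
    {ι : Type} [Fintype ι] [DecidableEq ι]
    (A B : Matrix ι ι (ZMod p)) (hB : Bᵀ = B) (hBd : B.det ≠ 0) (hA : Aᵀ * B * A = B)
    (hord : orderOf A = q ^ r) :
    2 * e ≤ Fintype.card ι ∧ (Fintype.card ι = 2 * e →
      ((q ^ r ∣ p ^ e - 1 → IsSquare ((-1) ^ e * B.det)) ∧
        (q ^ r ∣ p ^ e + 1 → ¬ IsSquare ((-1) ^ e * B.det)))) := by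
  have hp : p.Prime := Fact.out
  let K := AlgebraicClosure (ZMod p)
  haveI : CharP K p := charP_of_injective_algebraMap (algebraMap (ZMod p) K).injective p
  let φ := algebraMap (ZMod p) K
  have hφ : Function.Injective φ := φ.injective
  set A' := A.map φ with hA'
  set B' := B.map φ with hB'
  have hordA' : orderOf A' = q ^ r := by
    rw [← hord]
    exact orderOf_injective (RingHom.mapMatrix φ).toMonoidHom (by
      intro X Y h
      ext i j
      have := congrFun (congrFun h i) j
      exact hφ this) A
  have hiso : A'ᵀ * B' * A' = B' := by
    rw [hA', hB', ← Matrix.transpose_map, ← Matrix.map_mul, ← Matrix.map_mul, hA]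
  have hdetmap : ∀ M : Matrix ι ι (ZMod p), (M.map φ).det = φ M.det := fun M => (RingHom.map_det φ M).symm
  have hB'd : B'.det ≠ 0 := by
    rw [hB', hdetmap]
    simpa using hBd
  obtain ⟨μ, hμ, hroot⟩ := exists_prim_root hq hpq hr A' hordA'
  have hμ0 : μ ≠ 0 := hμ.ne_zero (by positivity [hq.pos])
  let a : ℕ → K := fun i => μ ^ (p ^ i)
  have ha0 : ∀ i, a i ≠ 0 := fun i => pow_ne_zero _ hμ0
  have hasucc : ∀ i, a (i + 1) = a i ^ p := by
    intro i
    simp only [a]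
    rw [pow_succ, pow_mul]
  have haroot : ∀ i, A'.charpoly.IsRoot (a i) := by
    intro i
    induction i with
    | zero => simpa [a] using hroot
    | succ i ih => rw [hasucc]; exact root_frob A _ ih
  have hairoot : ∀ i, A'.charpoly.IsRoot (a i)⁻¹ := fun i => root_inv A' B' hB'd hiso _ (ha0 i) (haroot i)
  have hq3 : 2 < q := lt_of_le_of_ne hq.two_le (Ne.symm hq2)
  have hcopq : Nat.Coprime p (q ^ r) := ((Nat.coprime_primes hp hq).2 hpq).pow_right _
  have haprim : ∀ i, IsPrimitiveRoot (a i) (q ^ r) := fun i => hμ.pow_of_coprime _ (hcopq.pow_left i)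
  have hqr : 2 < q ^ r := lt_of_lt_of_le hq3 (Nat.le_self_pow (by omega) q)
  have hne : ∀ i, a i ≠ (a i)⁻¹ := by
    intro i h
    have h1 : a i ^ 2 = 1 := by
      rw [sq]; nth_rewrite 2 [h]; exact mul_inv_cancel₀ (ha0 i)
    have := Nat.le_of_dvd (by norm_num) ((haprim i).dvd_of_pow_eq_one _ h1)
    omega
  have hsqinj : ∀ i j, i < j → j < e → a i ^ (p ^ i) ≠ a j ^ (p ^ j) := by
    intro i j hij hj h
    simp only [a] at h
    rw [← pow_mul, ← pow_mul, ← pow_add, ← pow_add] at h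
    have h1 : μ ^ (p ^ (i + i) * (p ^ (2 * (j - i)) - 1)) = 1 := by
      rw [Nat.mul_sub, mul_one, ← pow_add]
      have hle : p ^ (i + i) ≤ p ^ (i + i + 2 * (j - i)) := Nat.pow_le_pow_right hp.pos (by omega)
      rw [pow_sub₀ _ hμ0 hle, h, show i + i + 2 * (j - i) = j + j by omega]
      exact mul_inv_cancel₀ (pow_ne_zero _ hμ0)
    have h2 := hμ.dvd_of_pow_eq_one _ h1
    have h3 := (H1 _).1 ((hcopq.symm.pow_right _).dvd_of_dvd_mul_left h2)
    have := Nat.le_of_dvd (by omega) h3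
    omega
  have hsq2 : ∀ i j, i < e → j < e → (a i = a j ∨ a i = (a j)⁻¹) → i = j := by
    have hw : ∀ i j, i < j → j < e → (a i = a j ∨ a i = (a j)⁻¹) → False := by
      intro i j hij hj h
      apply hsqinj i j hij hj
      have e1 : a j = a i ^ (p ^ (j - i)) := by
        simp only [a]; rw [← pow_mul, ← pow_add, Nat.add_sub_cancel' hij.le]
      have e2 : a j ^ p ^ j = ((a j) ^ (p ^ (j - i))) ^ (p ^ i) := by
        rw [← pow_mul (a j), ← pow_add, Nat.sub_add_cancel hij.le]
      rw [e2]
      congr 1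
      rcases h with h | h
      · rw [← h, ← e1, h]
      · have h' : a j = (a i)⁻¹ := by rw [h, inv_inv]
        rw [h', inv_pow, ← e1, h', inv_inv]
    intro i j hi hj h
    rcases lt_trichotomy i j with h1 | h1 | h1
    · exact (hw i j h1 hj h).elim
    · exact h1
    · refine (hw j i h1 hi ?_).elim
      rcases h with h | h
      · exact Or.inl h.symm
      · right; rw [h, inv_inv]
  let ρ : Fin e ⊕ Fin e → K := Sum.elim (fun i => a i) (fun i => (a i)⁻¹)
  have hρinj : Function.Injective ρ := by
    rintro (i | i) (j | j) h
    · simp only [ρ, Sum.elim_inl] at h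
      rw [Fin.ext (hsq2 i j i.2 j.2 (Or.inl h))]
    · simp only [ρ, Sum.elim_inl, Sum.elim_inr] at h
      have := hsq2 i j i.2 j.2 (Or.inr h)
      rw [← this] at h
      exact (hne _ h).elim
    · simp only [ρ, Sum.elim_inl, Sum.elim_inr] at h
      have := hsq2 j i j.2 i.2 (Or.inr h.symm)
      rw [← this] at h
      exact (hne _ h.symm).elim
    · simp only [ρ, Sum.elim_inr] at h
      rw [Fin.ext (hsq2 i j i.2 j.2 (Or.inl (inv_injective h)))]
  have hρroot : ∀ x, A'.charpoly.IsRoot (ρ x) := by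
    rintro (i | i)
    · exact haroot i
    · exact hairoot i
  let f : K[X] := ∏ x, (X - C (ρ x))
  have hfmon : f.Monic := monic_prod_of_monic _ _ fun x _ => monic_X_sub_C _
  have hfdeg : f.natDegree = 2 * e := by
    simp only [f]
    rw [natDegree_prod_of_monic _ _ fun x _ => monic_X_sub_C _]
    simp; ring
  have hdvd : f ∣ A'.charpoly := by
    apply Finset.prod_dvd_of_coprime
    · intro x _ y _ hxy
      exact pairwise_coprime_X_sub_C hρinj hxy
    · intro x _
      exact dvd_iff_isRoot.2 (hρroot x)
  have hcdeg : A'.charpoly.natDegree = Fintype.card ι := Matrix.charpoly_natDegree_eq_dim A'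
  have hcmon : A'.charpoly.Monic := Matrix.charpoly_monic A'
  refine ⟨?_, ?_⟩
  · rw [← hfdeg, ← hcdeg]
    exact natDegree_le_of_dvd hdvd hcmon.ne_zero
  intro hcard
  have hfeq : A'.charpoly = f :=
    (eq_of_monic_of_dvd_of_natDegree_le hfmon hcmon hdvd (by rw [hfdeg, hcdeg, hcard])).symm ▸ rfl
  have hev : ∀ t : K, (Matrix.scalar ι t - A').det = ∏ i ∈ Finset.range e, ((t - a i) * (t - (a i)⁻¹)) := by
    intro t
    rw [← Matrix.eval_charpoly, hfeq]
    simp only [f]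
    rw [eval_prod, Fintype.prod_sum_type, ← Fin.prod_univ_eq_prod_range (fun i => (t - a i) * (t - (a i)⁻¹)), ← Finset.prod_mul_distrib]
    simp [ρ]
  let h : ℕ → K := fun i => a i - (a i)⁻¹
  let δ : K := ∏ i ∈ Finset.range e, h i
  have hδ0 : δ ≠ 0 := Finset.prod_ne_zero_iff.2 fun i _ => sub_ne_zero.2 (hne i)
  have hdetA' : A'.det = 1 := by
    have h0 := hev 0
    have : Matrix.scalar ι (0 : K) - A' = -A' := by simp
    rw [this, Matrix.det_neg, hcard, pow_mul] at h0
    simp only [even_two, Even.neg_pow, one_pow, one_mul] at h0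
    rw [h0]
    apply Finset.prod_eq_one
    intro i _
    have := mul_inv_cancel₀ (ha0 i)
    linear_combination this
  have hdetA : A.det = 1 := by
    apply hφ
    rw [map_one, ← hdetA', hA', hdetmap]
  let M := B * A - Aᵀ * B
  have hMalt : Mᵀ = -M := by
    simp only [M, Matrix.transpose_sub, Matrix.transpose_mul, Matrix.transpose_transpose, hB]
    abel
  have h2 : (2 : ZMod p) ≠ 0 := by
    intro h
    have h' : ((2 : ℕ) : ZMod p) = 0 := by exact_mod_cast h
    rw [ZMod.natCast_eq_zero_iff] at h'
    exact hp2 ((Nat.prime_dvd_prime_iff_eq hp Nat.prime_two).1 h')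
  have hMd : ∀ i, M i i = 0 := by
    intro i
    have := congrFun (congrFun hMalt i) i
    simp only [Matrix.transpose_apply, Matrix.neg_apply] at this
    have h3 : 2 * M i i = 0 := by linear_combination this
    simpa [h2] using h3
  obtain ⟨t, ht⟩ := alt_det_isSquare (Fintype.card ι) M rfl hMalt hMd
  have hMA : M * A = B * ((1 - A) * (-1 - A)) := by
    simp only [M]
    rw [Matrix.sub_mul, hA]
    noncomm_ring
  have hMdet : M.det = B.det * ((1 - A).det * (-1 - A).det) := by
    have := congrArg Matrix.det hMA
    rw [Matrix.det_mul, hdetA, mul_one, Matrix.det_mul, Matrix.det_mul] at this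
    exact this
  have e1 : φ (1 - A).det = ∏ i ∈ Finset.range e, ((1 - a i) * (1 - (a i)⁻¹)) := by
    rw [← hev 1, ← hdetmap]
    congr 1
    ext i j
    simp [hA', Matrix.one_apply, apply_ite φ]
  have e2 : φ (-1 - A).det = ∏ i ∈ Finset.range e, ((-1 - a i) * (-1 - (a i)⁻¹)) := by
    rw [← hev (-1), ← hdetmap]
    congr 1
    ext i j
    by_cases hij : i = j <;> simp [hA', Matrix.diagonal_apply, hij]
  have hfin : φ ((-1) ^ e * B.det) * δ ^ 2 = φ t ^ 2 := by
    have h3 := congrArg φ (ht.symm.trans hMdet)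
    rw [map_mul, map_mul, map_mul, e1, e2, ← Finset.prod_mul_distrib] at h3
    rw [sq (φ t), h3, map_mul, map_pow, map_neg, map_one, mul_comm ((-1) ^ e), mul_assoc]
    congr 1
    simp only [δ]
    rw [← Finset.prod_pow]
    have : ((-1 : K)) ^ e = ∏ i ∈ Finset.range e, (-1 : K) := by simp
    rw [this, ← Finset.prod_mul_distrib]
    apply Finset.prod_congr rfl
    intro i _
    have := mul_inv_cancel₀ (ha0 i)
    simp only [h]
    linear_combination (1 - a i * (a i)⁻¹) * this
  set c := (-1) ^ e * B.det with hc
  have hc0 : c ≠ 0 := mul_ne_zero (pow_ne_zero _ (by simp)) hBd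
  have ht0 : t ≠ 0 := by
    rintro rfl
    rw [map_zero, zero_pow two_ne_zero] at hfin
    have : φ c ≠ 0 := by simpa using hc0
    exact (mul_ne_zero this (pow_ne_zero 2 hδ0)) hfin
  have heul : φ (c ^ (p / 2)) * δ ^ (p - 1) = 1 := by
    have h3 : p - 1 = 2 * (p / 2) := by
      have := Nat.Prime.eq_two_or_odd hp
      omega
    have h4 := congrArg (fun x => x ^ (p / 2)) hfin
    simp only [mul_pow] at h4
    rw [← pow_mul, ← pow_mul, ← h3, ← map_pow, ← map_pow, ZMod.pow_card_sub_one_eq_one ht0, map_one] at h4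
    exact h4
  have hδp : δ ^ p * h 0 = δ * h e := by
    have h3 : δ ^ p = ∏ i ∈ Finset.range e, h (i + 1) := by
      simp only [δ]
      rw [← Finset.prod_pow]
      apply Finset.prod_congr rfl
      intro i _
      simp only [h]
      rw [sub_pow_char, inv_pow, ← hasucc]
    rw [h3, ← Finset.prod_range_succ', Finset.prod_range_succ]
  have hh0 : h 0 ≠ 0 := sub_ne_zero.2 (hne 0)
  have hpp : δ ^ p = δ ^ (p - 1) * δ := by
    rw [← pow_succ, Nat.sub_add_cancel hp.one_le]
  have ha0' : a 0 = μ := by simp [a]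
  constructor
  · intro hd
    have hae : a e = a 0 := by
      obtain ⟨w, hw⟩ := hd
      have : p ^ e = q ^ r * w + 1 := by
        have := Nat.one_le_pow e p hp.pos
        omega
      rw [ha0']
      simp only [a]
      rw [this, pow_succ, pow_mul, hμ.pow_eq_one, one_pow, one_mul]
    have hhe : h e = h 0 := by simp only [h]; rw [hae]
    have h3 : δ ^ (p - 1) = 1 := by
      rw [hhe] at hδp
      have := mul_right_cancel₀ hh0 hδp
      rw [hpp] at this
      exact mul_right_cancel₀ hδ0 (by rw [this, one_mul])
    rw [h3, mul_one] at heul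
    rw [ZMod.euler_criterion p hc0]
    exact hφ (by rw [heul, map_one])
  · intro hd
    have hae : a e = (a 0)⁻¹ := by
      obtain ⟨w, hw⟩ := hd
      rw [ha0']
      apply eq_inv_of_mul_eq_one_left
      simp only [a]
      rw [← pow_succ, hw, pow_mul, hμ.pow_eq_one, one_pow]
    have hhe : h e = - h 0 := by simp only [h]; rw [hae, inv_inv]; ring
    have h3 : δ ^ (p - 1) = -1 := by
      rw [hhe] at hδp
      have : δ ^ p = - δ := mul_right_cancel₀ hh0 (by rw [hδp]; ring)
      rw [hpp] at this
      exact mul_right_cancel₀ hδ0 (by rw [this, neg_one_mul])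
    rw [ZMod.euler_criterion p hc0]
    intro h4
    rw [h4, h3, map_one, one_mul] at heul
    have h5 : φ 2 = 0 := by
      rw [map_ofNat]
      linear_combination -heul
    exact h2 (hφ (by rw [h5, map_zero]))

end Nec

section Constr

open Module

lemma exists_elem_order (L : Type*) [Field L] [Finite L] (N : ℕ) (h : N ∣ Nat.card L - 1) :
    ∃ ζ : L, orderOf ζ = N ∧ ζ ≠ 0 := by
  obtain ⟨g, hg⟩ := IsCyclic.exists_ofOrder_eq_natCard (α := Lˣ)
  rw [Nat.card_units] at hg
  have h0 : orderOf g ≠ 0 := (orderOf_pos g).ne'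
  have h1 := orderOf_pow_orderOf_div (x := g) h0 (hg ▸ h)
  refine ⟨((g ^ (orderOf g / N) : Lˣ) : L), ?_, Units.ne_zero _⟩
  rw [orderOf_units, h1]

lemma constr_pos {p N e : ℕ} [Fact p.Prime] (he : 0 < e) (h : N ∣ p ^ e - 1) :
    ∃ (B C : Matrix (Fin e ⊕ Fin e) (Fin e ⊕ Fin e) (ZMod p)), Bᵀ = B ∧ B.det ≠ 0 ∧ Cᵀ * B * C = B ∧ orderOf C = N := by
  let L := GaloisField p e
  have hcard : Nat.card L = p ^ e := GaloisField.card p e he.ne'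
  obtain ⟨ζ, hζ, hζ0⟩ := exists_elem_order L N (by rw [hcard]; exact h)
  let b : Basis (Fin e) (ZMod p) L := finBasisOfFinrankEq _ _ (GaloisField.finrank p he.ne')
  let M := Algebra.leftMulMatrix b ζ
  let M' := Algebra.leftMulMatrix b ζ⁻¹
  have hMM : M' * M = 1 := by
    simp only [M, M']; rw [← map_mul, inv_mul_cancel₀ hζ0, map_one]
  have hMM' : M * M' = 1 := mul_eq_one_comm.1 hMM
  have hM : orderOf M = N := by
    rw [← hζ]
    exact orderOf_injective (Algebra.leftMulMatrix b).toRingHom.toMonoidHom (Algebra.leftMulMatrix_injective b) ζ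
  refine ⟨Matrix.fromBlocks 0 1 1 0, Matrix.fromBlocks M 0 0 M'ᵀ, ?_, ?_, ?_, ?_⟩
  · rw [Matrix.fromBlocks_transpose]; simp
  · have : (Matrix.fromBlocks 0 1 1 0 : Matrix (Fin e ⊕ Fin e) (Fin e ⊕ Fin e) (ZMod p)) * Matrix.fromBlocks 0 1 1 0 = 1 := by
      rw [Matrix.fromBlocks_multiply]; simp
    intro h0
    have := congrArg Matrix.det this
    rw [Matrix.det_mul, h0] at this
    simp at this
  · rw [Matrix.fromBlocks_transpose, Matrix.fromBlocks_multiply, Matrix.fromBlocks_multiply]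
    simp [hMM, ← Matrix.transpose_mul]
  · rw [← hM, orderOf_eq_orderOf_iff]
    intro j
    rw [Matrix.fromBlocks_diagonal_pow, ← Matrix.fromBlocks_one, Matrix.fromBlocks_inj]
    constructor
    · exact fun h => h.1
    · intro h
      refine ⟨h, rfl, rfl, ?_⟩
      rw [← Matrix.transpose_pow, Matrix.transpose_eq_one]
      have hc : Commute M' M := by rw [Commute, SemiconjBy, hMM, hMM']
      have := hc.mul_pow j
      rw [hMM, one_pow, h, mul_one] at this
      exact this.symm

lemma constr_neg {p N e : ℕ} [Fact p.Prime] (he : 0 < e) (h : N ∣ p ^ e + 1) :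
    ∃ (B C : Matrix (Fin (2 * e)) (Fin (2 * e)) (ZMod p)), Bᵀ = B ∧ B.det ≠ 0 ∧ Cᵀ * B * C = B ∧ orderOf C = N := by
  have he2 : 2 * e ≠ 0 := by omega
  let L := GaloisField p (2 * e)
  have hcard : Nat.card L = p ^ (2 * e) := GaloisField.card p (2 * e) he2
  have hdvd : N ∣ Nat.card L - 1 := by
    rw [hcard]
    have h1 := Nat.sq_sub_sq (p ^ e) 1
    rw [← pow_mul, one_pow, mul_comm e 2] at h1
    rw [h1]
    exact h.mul_right _
  obtain ⟨ζ, hζ, hζ0⟩ := exists_elem_order L N hdvd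
  have hζN : ζ ^ (p ^ e + 1) = 1 := by
    rw [← orderOf_dvd_iff_pow_eq_one, hζ]; exact h
  let b : Basis (Fin (2 * e)) (ZMod p) L := finBasisOfFinrankEq _ _ (GaloisField.finrank p he2)
  haveI : Fintype L := Fintype.ofFinite L
  let σ : L →ₐ[ZMod p] L :=
    { iterateFrobenius L p e with
      commutes' := by
        intro x
        change (iterateFrobenius L p e) (algebraMap (ZMod p) L x) = _
        rw [iterateFrobenius_def, ← map_pow, ZMod.pow_card_pow] }
  have hσ : ∀ x, σ x = x ^ (p ^ e) := fun x => iterateFrobenius_def (R := L) p e x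
  have hσσ : ∀ x, σ (σ x) = x := by
    intro x
    rw [hσ, hσ, ← pow_mul, ← pow_add, ← two_mul, ← hcard, Nat.card_eq_fintype_card, FiniteField.pow_card]
  let σe : L ≃ₐ[ZMod p] L := AlgEquiv.ofBijective σ (Function.Involutive.bijective hσσ)
  have htr : ∀ x : L, Algebra.trace (ZMod p) L (σ x) = Algebra.trace (ZMod p) L x :=
    fun x => Algebra.trace_eq_of_algEquiv σe x
  let β : LinearMap.BilinForm (ZMod p) L := (Algebra.traceForm (ZMod p) L).compRight σ.toLinearMap
  have hβ : ∀ x y, β x y = Algebra.trace (ZMod p) L (x * σ y) := by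
    intro x y
    rfl
  have hβs : ∀ x y, β x y = β y x := by
    intro x y
    rw [hβ, hβ, ← htr, map_mul, hσσ, mul_comm (σ x) y]
  let m : L →ₗ[ZMod p] L := LinearMap.mulLeft (ZMod p) ζ
  have hβm : β.comp m m = β := by
    ext x y
    change β (ζ * x) (ζ * y) = β x y
    rw [hβ, hβ]
    congr 1
    rw [map_mul, hσ ζ]
    rw [pow_succ] at hζN
    linear_combination (x * σ y) * hζN
  refine ⟨LinearMap.BilinForm.toMatrix b β, Algebra.leftMulMatrix b ζ, ?_, ?_, ?_, ?_⟩
  · ext i j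
    rw [Matrix.transpose_apply, LinearMap.BilinForm.toMatrix_apply, LinearMap.BilinForm.toMatrix_apply, hβs]
  · have hnd := traceForm_nondegenerate (ZMod p) L
    refine (LinearMap.BilinForm.nondegenerate_iff_det_ne_zero b).1 ?_
    have hl : β.SeparatingLeft := by
      intro x hx
      apply hnd.1 x
      intro y
      have := hx (σ y)
      rw [hβ, hσσ] at this
      exact this
    refine ⟨hl, ?_⟩
    intro y hy
    apply hl
    intro x
    rw [hβs]; exact hy x
  · have h1 := LinearMap.BilinForm.toMatrix_comp b b β m m
    rw [hβm] at h1
    exact h1.symm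
  · rw [← hζ]
    exact orderOf_injective (Algebra.leftMulMatrix b).toRingHom.toMonoidHom (Algebra.leftMulMatrix_injective b) ζ

variable {F : Type*} [Field F] [Fintype F]

lemma transfer (hF : Fintype.card F % 2 = 1) (h2 : (2 : F) ≠ 0) {n N : ℕ} {κ : Type} [Fintype κ] [DecidableEq κ]
    (hκ : Fintype.card κ = n) (B : Matrix (Fin n) (Fin n) F) (hB : Bᵀ = B) (hBd : B.det ≠ 0)
    (B0 C0 : Matrix κ κ F) (hB0 : B0ᵀ = B0) (hB0d : B0.det ≠ 0) (hC : C0ᵀ * B0 * C0 = B0) (ho : orderOf C0 = N)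
    (hsq : IsSquare (B0.det * B.det)) :
    ∃ A : Matrix (Fin n) (Fin n) F, Aᵀ * B * A = B ∧ orderOf A = N := by
  let g : κ ≃ Fin n := Fintype.equivFinOfCardEq hκ
  let ψ := Matrix.reindexAlgEquiv F F g
  have hψt : ∀ X, (ψ X)ᵀ = ψ Xᵀ := fun X => rfl
  have hψd : ∀ X, (ψ X).det = X.det := fun X => Matrix.det_reindexAlgEquiv F F g X
  obtain ⟨P, P', hPP', hP'P, hP⟩ := classif hF h2 (ψ B0) B (by rw [hψt, hB0]) hB (by rw [hψd]; exact hB0d) hBd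
    (by rw [hψd]; exact hsq)
  have hC' : (ψ C0)ᵀ * ψ B0 * ψ C0 = ψ B0 := by rw [hψt, ← map_mul, ← map_mul, hC]
  have hP2 : P'ᵀ * B * P' = ψ B0 := by
    rw [← hP]
    calc P'ᵀ * (Pᵀ * ψ B0 * P) * P' = (P * P')ᵀ * ψ B0 * (P * P') := by
          simp only [Matrix.transpose_mul, Matrix.mul_assoc]
      _ = ψ B0 := by rw [hPP']; simp
  refine ⟨P' * ψ C0 * P, ?_, ?_⟩
  · calc (P' * ψ C0 * P)ᵀ * B * (P' * ψ C0 * P) = Pᵀ * ((ψ C0)ᵀ * (P'ᵀ * B * P') * ψ C0) * P := by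
          simp only [Matrix.transpose_mul, Matrix.mul_assoc]
      _ = B := by rw [hP2, hC', hP]
  · rw [← ho, orderOf_eq_orderOf_iff]
    intro j
    have hpow : (P' * ψ C0 * P) ^ j = P' * ψ (C0 ^ j) * P := by
      induction j with
      | zero => simp [hP'P]
      | succ j ih =>
        rw [pow_succ, ih, pow_succ, map_mul]
        calc P' * ψ (C0 ^ j) * P * (P' * ψ C0 * P) = P' * (ψ (C0 ^ j) * (P * P') * ψ C0) * P := by
              simp only [Matrix.mul_assoc]
          _ = _ := by rw [hPP', Matrix.mul_one]
    rw [hpow]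
    constructor
    · intro h
      apply ψ.injective
      rw [map_one]
      calc ψ (C0 ^ j) = (P * P') * ψ (C0 ^ j) * (P * P') := by rw [hPP']; simp
        _ = P * (P' * ψ (C0 ^ j) * P) * P' := by simp only [Matrix.mul_assoc]
        _ = 1 := by rw [h, Matrix.mul_one, hPP']
    · intro h
      rw [h, map_one, Matrix.mul_one, hP'P]

lemma transfer_lt (hF : Fintype.card F % 2 = 1) (h2 : (2 : F) ≠ 0) {n N : ℕ} {κ : Type} [Fintype κ] [DecidableEq κ]
    (hκ : Fintype.card κ < n) (B : Matrix (Fin n) (Fin n) F) (hB : Bᵀ = B) (hBd : B.det ≠ 0)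
    (B0 C0 : Matrix κ κ F) (hB0 : B0ᵀ = B0) (hB0d : B0.det ≠ 0) (hC : C0ᵀ * B0 * C0 = B0) (ho : orderOf C0 = N) :
    ∃ A : Matrix (Fin n) (Fin n) F, Aᵀ * B * A = B ∧ orderOf A = N := by
  obtain ⟨m, rfl⟩ : ∃ m, n = Fintype.card κ + (m + 1) := ⟨n - Fintype.card κ - 1, by omega⟩
  let D : Matrix (Fin (m + 1)) (Fin (m + 1)) F := diagonal (fun i => if i = 0 then B0.det * B.det else 1)
  have hD : D.det = B0.det * B.det := by
    simp only [D]
    rw [Matrix.det_diagonal, Finset.prod_ite_eq' Finset.univ (0 : Fin (m + 1))]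
    simp
  refine transfer hF h2 (κ := κ ⊕ Fin (m + 1)) (by simp) B hB hBd (Matrix.fromBlocks B0 0 0 D) (Matrix.fromBlocks C0 0 0 1) ?_ ?_ ?_ ?_ ?_
  · rw [Matrix.fromBlocks_transpose, hB0]; simp [D]
  · rw [Matrix.det_fromBlocks_zero₂₁, hD]
    exact mul_ne_zero hB0d (mul_ne_zero hB0d hBd)
  · rw [Matrix.fromBlocks_transpose, Matrix.fromBlocks_multiply, Matrix.fromBlocks_multiply]
    simp [hC]
  · rw [← ho, orderOf_eq_orderOf_iff]
    intro j
    rw [Matrix.fromBlocks_diagonal_pow, ← Matrix.fromBlocks_one, Matrix.fromBlocks_inj]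
    simp
  · rw [Matrix.det_fromBlocks_zero₂₁, hD]
    exact ⟨B0.det * B.det, by ring⟩

end Constr

section Final

lemma fin_sq_mul {p : ℕ} [Fact p.Prime] {a b : ZMod p} (ha : a ≠ 0) (hb : b ≠ 0) :
    IsSquare (a * b) ↔ (IsSquare a ↔ IsSquare b) := by
  rw [← quadraticChar_one_iff_isSquare ha, ← quadraticChar_one_iff_isSquare hb,
    ← quadraticChar_one_iff_isSquare (mul_ne_zero ha hb), map_mul]
  rcases quadraticChar_dichotomy ha with h | h <;> rcases quadraticChar_dichotomy hb with h' | h' <;>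
    rw [h, h'] <;> norm_num

lemma fin_prop {a b c : Prop} (h : (a ↔ b) ↔ (a ↔ c)) : b ↔ c := by
  tauto

lemma fin_neg_one {p : ℕ} [Fact p.Prime] (e : ℕ) :
    IsSquare ((-1 : ZMod p) ^ e) ↔ ¬ (p % 4 = 3 ∧ (2 * e) % 4 = 2) := by
  have h1 : IsSquare (-1 : ZMod p) ↔ p % 4 ≠ 3 := ZMod.exists_sq_eq_neg_one_iff
  rcases Nat.even_or_odd e with h | h
  · have h3 : (-1 : ZMod p) ^ e = 1 := h.neg_one_pow
    obtain ⟨t, ht⟩ := h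
    rw [h3]
    constructor
    · intro _ h4
      omega
    · intro _
      exact ⟨1, by simp⟩
  · have h3 : (-1 : ZMod p) ^ e = -1 := h.neg_one_pow
    obtain ⟨t, ht⟩ := h
    rw [h3, h1]
    have : (2 * e) % 4 = 2 := by omega
    tauto

lemma fin_eps {p : ℕ} [Fact p.Prime] {R : Type*} [CommRing R] (f : R →+* ZMod p) {n e : ℕ} (hn : n = 2 * e)
    (B : Matrix (Fin n) (Fin n) R) (hd : f B.det ≠ 0) (hsq : IsSquare (f B.det) ↔ IsSquare B.det) :
    (epsilon p B = 1 ∧ IsSquare ((-1) ^ e * (B.map f).det)) ∨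
      (epsilon p B = -1 ∧ ¬ IsSquare ((-1) ^ e * (B.map f).det)) := by
  have hdet : (B.map f).det = f B.det := by
    rw [RingHom.map_det]; rfl
  have h1 : ((-1 : ZMod p) ^ e) ≠ 0 := pow_ne_zero _ (neg_ne_zero.2 one_ne_zero)
  rw [hdet, fin_sq_mul h1 hd, hsq, fin_neg_one, ← hn]
  unfold epsilon
  rw [Fintype.card_fin]
  by_cases ha : IsSquare B.det <;> by_cases hb : p % 4 = 3 ∧ n % 4 = 2 <;> simp [ha, hb]

lemma fin_pow_isom {R : Type*} [CommRing R] {n : ℕ} (A B : Matrix (Fin n) (Fin n) R)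
    (h : Aᵀ * B * A = B) (m : ℕ) : (A ^ m)ᵀ * B * A ^ m = B := by
  induction m with
  | zero => simp
  | succ m ih =>
    have : (A ^ (m + 1))ᵀ * B * A ^ (m + 1) = Aᵀ * ((A ^ m)ᵀ * B * A ^ m) * A := by
      rw [Matrix.transpose_pow, Matrix.transpose_pow, pow_succ' Aᵀ, pow_succ A]
      simp only [Matrix.mul_assoc]
    rw [this, ih, h]

lemma fin_reduce {p q r : ℕ} [Fact p.Prime] (hq : q.Prime) (hpq : p ≠ q) (hr : 1 ≤ r)
    {R : Type*} [CommRing R] (f : R →+* ZMod p) (ϖ : R) (hf : Function.Surjective f)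
    (hker : ∀ x, f x = 0 → ∃ y, x = ϖ * y) {k : ℕ} (hnil : ϖ ^ k = 0) {n : ℕ}
    (A : Matrix (Fin n) (Fin n) R) (ho : orderOf A = q ^ r) : orderOf (A.map f) = q ^ r := by
  haveI : Fact q.Prime := ⟨hq⟩
  obtain ⟨t, rfl⟩ : ∃ t, r = t + 1 := ⟨r - 1, by omega⟩
  have hmap : ∀ m, (A.map f) ^ m = (A ^ m).map f := by
    intro m
    have := map_pow f.mapMatrix A m
    simpa using this.symm
  apply orderOf_eq_prime_pow
  · intro h
    rw [hmap] at h
    set C := A ^ q ^ t with hC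
    have hCq : C ^ q = 1 := by
      rw [hC, ← pow_mul, ← pow_succ, ← ho, pow_orderOf_eq_one]
    have hgeom : (C - 1) * ∑ i ∈ Finset.range q, C ^ i = 0 := by
      rw [mul_geom_sum, hCq, sub_self]
    have hS : (∑ i ∈ Finset.range q, C ^ i).map f = ((q : ZMod p)) • (1 : Matrix (Fin n) (Fin n) (ZMod p)) := by
      have h' : f.mapMatrix C = 1 := h
      have : f.mapMatrix (∑ i ∈ Finset.range q, C ^ i) = ((q : ZMod p)) • (1 : Matrix (Fin n) (Fin n) (ZMod p)) := by
        rw [map_sum]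
        simp only [map_pow, h', one_pow]
        rw [Finset.sum_const, Finset.card_range, Nat.cast_smul_eq_nsmul]
      exact this
    have hu : IsUnit (∑ i ∈ Finset.range q, C ^ i).det := by
      apply lift_isUnit f ϖ hf hker hnil
      have h5 : f (∑ i ∈ Finset.range q, C ^ i).det = ((∑ i ∈ Finset.range q, C ^ i).map f).det := by
        rw [RingHom.map_det]; rfl
      rw [h5, hS, Matrix.det_smul, Matrix.det_one, mul_one]
      apply pow_ne_zero
      intro h6
      rw [ZMod.natCast_eq_zero_iff] at h6
      exact hpq ((Nat.prime_dvd_prime_iff_eq Fact.out hq).1 h6)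
    have hu' := (Matrix.isUnit_iff_isUnit_det _).2 hu
    have h7 : C - 1 = 0 := by
      rwa [hu'.mul_left_eq_zero] at hgeom
    have h8 : C = 1 := sub_eq_zero.1 h7
    have h9 : q ^ (t + 1) ∣ q ^ t := by
      rw [← ho]; exact orderOf_dvd_of_pow_eq_one h8
    have := (Nat.pow_dvd_pow_iff_le_right hq.one_lt).1 h9
    omega
  · rw [hmap, ← ho, pow_orderOf_eq_one]
    exact Matrix.map_one f (map_zero f) (map_one f)

end Final

theorem stmt0 (p q : ℕ) (hp : p.Prime) (hq : q.Prime) (hp2 : p ≠ 2) (hq2 : q ≠ 2)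
    (hpq : p ≠ q) (k : ℕ) (hk : 1 ≤ k) (n : ℕ) (hn : 1 ≤ n)
    (B : Matrix (Fin n) (Fin n) (ZMod (p ^ k))) (hsymm : B.IsSymm) (hdet : IsUnit B.det)
    (s : ℕ) (hs : q ^ s ∣ p ^ (2 * minExp p q) - 1)
    (hs' : ¬ q ^ (s + 1) ∣ p ^ (2 * minExp p q) - 1)
    (r : ℕ) (hr : 1 ≤ r) :
    (∃ A : Matrix (Fin n) (Fin n) (ZMod (p ^ k)), Aᵀ * B * A = B ∧ orderOf A = q ^ r) ↔
      (2 * minExp p q * q ^ (r - s) + 1 ≤ n ∨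
        (n = 2 * minExp p q * q ^ (r - s) ∧ epsilon p B = eta p q)) := by
  haveI : Fact p.Prime := ⟨hp⟩
  have H1 := nt_main p q hp hq hp2 hq2 hpq s hs hs' r hr
  have H2 := nt_sign p q hp hq hp2 hq2 hpq s hs hs' r hr
  have he : 0 < minExp p q * q ^ (r - s) :=
    Nat.mul_pos (nt_minExp p q hp hq hpq).1 (pow_pos hq.pos _)
  rw [mul_assoc]
  generalize minExp p q * q ^ (r - s) = e at H1 H2 he ⊢
  have hp3 : p % 2 = 1 := (hp.eq_two_or_odd).resolve_left hp2
  have h2 : (2 : ZMod p) ≠ 0 := by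
    intro h
    have h' : ((2 : ℕ) : ZMod p) = 0 := by exact_mod_cast h
    rw [ZMod.natCast_eq_zero_iff] at h'
    exact hp2 ((Nat.prime_dvd_prime_iff_eq hp Nat.prime_two).1 h')
  have hF : Fintype.card (ZMod p) % 2 = 1 := by rw [ZMod.card]; exact hp3
  haveI : NeZero (p ^ k) := ⟨pow_ne_zero _ hp.ne_zero⟩
  let f : ZMod (p ^ k) →+* ZMod p := ZMod.castHom (dvd_pow_self p (by omega)) (ZMod p)
  have hf : Function.Surjective f := ZMod.ringHom_surjective f
  have hϖ : f (p : ZMod (p ^ k)) = 0 := by rw [map_natCast]; exact ZMod.natCast_self p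
  have hnil : (p : ZMod (p ^ k)) ^ k = 0 := by
    rw [← Nat.cast_pow]; exact ZMod.natCast_self _
  have hker : ∀ x, f x = 0 → ∃ y, x = (p : ZMod (p ^ k)) * y := by
    intro x hx
    rw [← ZMod.natCast_zmod_val x, map_natCast, ZMod.natCast_eq_zero_iff] at hx
    obtain ⟨y, hy⟩ := hx
    refine ⟨(y : ZMod (p ^ k)), ?_⟩
    rw [← Nat.cast_mul, ← hy, ZMod.natCast_zmod_val]
  have hB : Bᵀ = B := hsymm
  have hBf : (B.map f)ᵀ = B.map f := by rw [← Matrix.transpose_map, hB]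
  have hd : f B.det ≠ 0 := (hdet.map f).ne_zero
  have hdd : (B.map f).det = f B.det := by
    rw [RingHom.map_det]; rfl
  have hBd : (B.map f).det ≠ 0 := by rw [hdd]; exact hd
  have hsq := lift_isSquare f _ hf hker hk hnil hϖ h2 B.det hdet
  constructor
  · rintro ⟨A, hA, ho⟩
    have ho' := fin_reduce hq hpq hr f _ hf hker hnil A ho
    have hA' : (A.map f)ᵀ * B.map f * A.map f = B.map f := by
      rw [← Matrix.transpose_map, ← Matrix.map_mul, ← Matrix.map_mul, hA]
    obtain ⟨h1, h3⟩ := nec_main hp2 hq hq2 hpq hr he H1 (A.map f) (B.map f) hBf hBd hA' ho'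
    rw [Fintype.card_fin] at h1 h3
    rcases h1.lt_or_eq with h | h
    · left; omega
    · right
      refine ⟨h.symm, ?_⟩
      obtain ⟨h4, h5⟩ := h3 h.symm
      rcases H2 with ⟨H2, H3⟩ | ⟨H2, H3⟩ <;>
        rcases fin_eps f h.symm B hd hsq with ⟨h6, h7⟩ | ⟨h6, h7⟩
      · rw [H2, h6]
      · exact absurd (h4 H3) h7
      · exact absurd h7 (h5 H3)
      · rw [H2, h6]
  · intro h
    obtain ⟨κ, _, _, hκ, B0, C0, hB0, hB0d, hC0, ho0⟩ : ∃ (κ : Type) (_ : Fintype κ) (_ : DecidableEq κ)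
        (_ : Fintype.card κ = 2 * e) (B0 C0 : Matrix κ κ (ZMod p)), B0ᵀ = B0 ∧ B0.det ≠ 0 ∧
          C0ᵀ * B0 * C0 = B0 ∧ orderOf C0 = q ^ r := by
      rcases H2 with ⟨_, H3⟩ | ⟨_, H3⟩
      · obtain ⟨B0, C0, h0⟩ := constr_pos he H3
        exact ⟨Fin e ⊕ Fin e, inferInstance, inferInstance, by simp; ring, B0, C0, h0⟩
      · obtain ⟨B0, C0, h0⟩ := constr_neg he H3
        exact ⟨Fin (2 * e), inferInstance, inferInstance, by simp, B0, C0, h0⟩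
    obtain ⟨A, hA, ho⟩ : ∃ A : Matrix (Fin n) (Fin n) (ZMod p),
        Aᵀ * B.map f * A = B.map f ∧ orderOf A = q ^ r := by
      rcases h with h | ⟨h, hε⟩
      · exact transfer_lt hF h2 (by omega) (B.map f) hBf hBd B0 C0 hB0 hB0d hC0 ho0
      · refine transfer hF h2 (by omega) (B.map f) hBf hBd B0 C0 hB0 hB0d hC0 ho0 ?_
        obtain ⟨_, h3⟩ := nec_main hp2 hq hq2 hpq hr he H1 C0 B0 hB0 hB0d hC0 ho0
        obtain ⟨h4, h5⟩ := h3 hκ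
        have hne : ((-1 : ZMod p) ^ e) ≠ 0 := pow_ne_zero _ (neg_ne_zero.2 one_ne_zero)
        rw [fin_sq_mul hB0d hBd]
        have key : IsSquare ((-1) ^ e * B0.det) ↔ IsSquare ((-1) ^ e * (B.map f).det) := by
          rcases H2 with ⟨H2, H3⟩ | ⟨H2, H3⟩ <;>
            rcases fin_eps f h B hd hsq with ⟨h6, h7⟩ | ⟨h6, h7⟩
          · exact iff_of_true (h4 H3) h7
          · rw [hε, H2] at h6; norm_num at h6
          · rw [hε, H2] at h6; norm_num at h6
          · exact iff_of_false (h5 H3) h7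
        rw [fin_sq_mul hne hB0d, fin_sq_mul hne hBd] at key
        exact fin_prop key
    obtain ⟨A', hA', hiso⟩ := lift_isom f _ hf hker hk hnil hϖ h2 B B hB hB hdet hdet A hA
    have hunit : IsUnit A' := by
      rw [Matrix.isUnit_iff_isUnit_det]
      have h3 := congrArg Matrix.det hiso
      rw [Matrix.det_mul] at h3
      exact isUnit_of_mul_isUnit_right (h3 ▸ hdet)
    have hfin : IsOfFinOrder A' := by
      obtain ⟨u, rfl⟩ := hunit
      exact MonoidHom.isOfFinOrder (Units.coeHom _) (isOfFinOrder_of_finite u)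
    have hdvd : q ^ r ∣ orderOf A' := by
      have h4 := orderOf_map_dvd (f.mapMatrix (m := Fin n)).toMonoidHom A'
      have h5 : (f.mapMatrix (m := Fin n)).toMonoidHom A' = A := hA'
      rw [h5, ho] at h4
      exact h4
    refine ⟨A' ^ (orderOf A' / q ^ r), fin_pow_isom A' B hiso _, ?_⟩
    exact orderOf_pow_orderOf_div hfin.orderOf_pos.ne' hdvd
end

section
/- Let p ≠ q be odd primes, let k ≥ 1, and let B be a p^k-form of rank n ≥ 1. Let s be the largest integer such that q^s divides p^{2[q|p]} − 1, fix an integer r ≥ 1, and set r̃ = max(r − s, 0). Then there exists an isometry A of B of order exactly q^r with no non-zero fixed points if and only if there exists an integer d ≥ q^{r̃} with n = 2[q|p]·d and ε(B) = η(q)^d. -/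
open Matrix

lemma minExp_spec {p q : ℕ} (hp : p.Prime) (hq : q.Prime) (hpq : p ≠ q) :
    0 < minExp p q ∧ (q ∣ p ^ minExp p q - 1 ∨ q ∣ p ^ minExp p q + 1) := by
  have hne : {a : ℕ | 0 < a ∧ (q ∣ p ^ a - 1 ∨ q ∣ p ^ a + 1)}.Nonempty := by
    refine ⟨Nat.totient q, Nat.totient_pos.2 hq.pos, Or.inl ?_⟩
    have h := Nat.ModEq.pow_totient ((Nat.coprime_primes hp hq).2 hpq)
    exact (Nat.modEq_iff_dvd' (Nat.one_le_pow _ _ hp.pos)).1 h.symm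
  exact Nat.sInf_mem hne

lemma eta_eq (p q : ℕ) : eta p q = 1 ∨ eta p q = -1 := by
  unfold eta; split_ifs <;> simp

lemma cast_pow_sub_one {p : ℕ} (hp : p.Prime) (e : ℕ) : ((p ^ e - 1 : ℕ) : ℤ) = (p : ℤ) ^ e - 1 := by
  rw [Nat.cast_sub (Nat.one_le_pow _ _ hp.pos)]; push_cast; rfl

lemma eta_spec {p q : ℕ} (hp : p.Prime) (hq : q.Prime) (hpq : p ≠ q) :
    (q : ℤ) ∣ (p : ℤ) ^ minExp p q - eta p q := by
  unfold eta
  split_ifs with h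
  · rw [← cast_pow_sub_one hp]; exact_mod_cast h
  · have := (minExp_spec hp hq hpq).2.resolve_left h
    have h2 : ((q : ℕ) : ℤ) ∣ ((p ^ minExp p q + 1 : ℕ) : ℤ) := by exact_mod_cast this
    push_cast at h2
    simpa using h2

lemma eta_pow_odd (p q : ℕ) {t : ℕ} (ht : Odd t) : eta p q ^ t = eta p q := by
  rcases eta_eq p q with h | h <;> rw [h]
  · simp
  · exact ht.neg_one_pow

lemma minExp_dvd {p q : ℕ} (hp : p.Prime) (hq : q.Prime) (hpq : p ≠ q) {e : ℕ}
    (he : (q : ℤ) ∣ (p : ℤ) ^ (2 * e) - 1) : minExp p q ∣ e := by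
  set a := minExp p q with ha
  have ha0 := (minExp_spec hp hq hpq).1
  have hqp : Prime (q : ℤ) := Nat.prime_iff_prime_int.1 hq
  have := Fact.mk hq
  by_contra hne
  have hb : 0 < e % a := Nat.pos_of_ne_zero fun h => hne (Nat.dvd_of_mod_eq_zero h)
  have hba : e % a < a := Nat.mod_lt _ ha0
  have h1 : ((p : ZMod q)) ^ (2 * e) = 1 := by
    have := (ZMod.intCast_zmod_eq_zero_iff_dvd _ q).2 he
    push_cast at this
    exact sub_eq_zero.1 this
  have h2 : ((p : ZMod q)) ^ a = ((eta p q : ℤ) : ZMod q) := by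
    have := (ZMod.intCast_zmod_eq_zero_iff_dvd _ q).2 (eta_spec hp hq hpq)
    push_cast at this
    exact sub_eq_zero.1 this
  have h3 : ((p : ZMod q)) ^ (2 * a) = 1 := by
    rw [mul_comm, pow_mul, h2]
    rcases eta_eq p q with h | h <;> rw [h] <;> simp
  have h4 : ((p : ZMod q)) ^ (e % a) * (p : ZMod q) ^ (e % a) = 1 := by
    rw [← pow_add, ← two_mul]
    have h5 : 2 * e = 2 * a * (e / a) + 2 * (e % a) := by
      conv_lhs => rw [← Nat.div_add_mod e a]
      ring
    rw [h5, pow_add, pow_mul, h3, one_pow, one_mul] at h1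
    exact h1
  have h6 : e % a ∈ {a : ℕ | 0 < a ∧ (q ∣ p ^ a - 1 ∨ q ∣ p ^ a + 1)} := by
    refine ⟨hb, ?_⟩
    rcases mul_self_eq_one_iff.1 h4 with h | h
    · left
      rw [← Int.natCast_dvd_natCast, cast_pow_sub_one hp, ← ZMod.intCast_zmod_eq_zero_iff_dvd]
      push_cast; rw [h]; simp
    · right
      rw [← Int.natCast_dvd_natCast, ← ZMod.intCast_zmod_eq_zero_iff_dvd]
      push_cast; rw [h]; simp
  have := Nat.sInf_le h6
  change a ≤ _ at this
  omega

lemma q_dvd_two {p q : ℕ} (hp : p.Prime) (hq : q.Prime) (hpq : p ≠ q) : (q : ℤ) ∣ (p : ℤ) ^ (2 * minExp p q) - 1 := by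
  have h := eta_spec hp hq hpq
  have : (p : ℤ) ^ (2 * minExp p q) - 1 =
      ((p : ℤ) ^ minExp p q - eta p q) * ((p : ℤ) ^ minExp p q + eta p q) := by
    rcases eta_eq p q with h | h <;> rw [h] <;> ring
  rw [this]; exact h.mul_right _

lemma s_pos {p q s : ℕ} (hp : p.Prime) (hq : q.Prime) (hpq : p ≠ q)
    (hs' : ¬ q ^ (s + 1) ∣ p ^ (2 * minExp p q) - 1) : 1 ≤ s := by
  by_contra h
  have h0 : s = 0 := by omega
  subst h0
  apply hs'
  have := q_dvd_two hp hq hpq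
  rw [← cast_pow_sub_one hp] at this
  simpa using Int.natCast_dvd_natCast.1 this

lemma mult_pow {p q s : ℕ} (hp : p.Prime) (hq : q.Prime) (hq2 : q ≠ 2) (hpq : p ≠ q)
    (hs : q ^ s ∣ p ^ (2 * minExp p q) - 1)
    (hs' : ¬ q ^ (s + 1) ∣ p ^ (2 * minExp p q) - 1)
    (t : ℕ) : emultiplicity (q : ℤ) ((p : ℤ) ^ (2 * (minExp p q * t)) - 1) =
    s + emultiplicity q t := by
  have h1 : (q : ℤ) ∣ (p : ℤ) ^ (2 * minExp p q) - 1 := q_dvd_two hp hq hpq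
  have hqp : Prime (q : ℤ) := Nat.prime_iff_prime_int.1 hq
  have h2 : ¬ (q : ℤ) ∣ (p : ℤ) ^ (2 * minExp p q) := by
    intro h
    have := hqp.dvd_of_dvd_pow h
    exact hpq ((Nat.prime_dvd_prime_iff_eq hq hp).1 (Int.natCast_dvd_natCast.1 this)).symm
  have := Fact.mk hq
  have h3 := Int.emultiplicity_pow_sub_pow hq (hq.odd_of_ne_two hq2) (x := (p : ℤ) ^ (2 * minExp p q))
    (y := 1) h1 h2 t
  rw [one_pow, ← pow_mul, mul_assoc] at h3
  rw [h3]
  congr 1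
  rw [emultiplicity_eq_coe, ← cast_pow_sub_one hp]
  exact ⟨by exact_mod_cast hs, by exact_mod_cast hs'⟩

lemma orbit_dvd {p q s : ℕ} (hp : p.Prime) (hq : q.Prime) (hq2 : q ≠ 2) (hpq : p ≠ q)
    (hs : q ^ s ∣ p ^ (2 * minExp p q) - 1)
    (hs' : ¬ q ^ (s + 1) ∣ p ^ (2 * minExp p q) - 1)
    {i e : ℕ} (hi : 1 ≤ i) (he : (q : ℤ) ^ i ∣ (p : ℤ) ^ (2 * e) - 1) :
    minExp p q * q ^ (i - s) ∣ e := by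
  have h1 : minExp p q ∣ e := minExp_dvd hp hq hpq ((dvd_pow_self _ (by omega)).trans he)
  obtain ⟨t, rfl⟩ := h1
  apply mul_dvd_mul_left
  rw [pow_dvd_iff_le_emultiplicity, mult_pow hp hq hq2 hpq hs hs'] at he
  rw [pow_dvd_iff_le_emultiplicity]
  by_cases ht : emultiplicity q t = ⊤
  · rw [ht]; exact le_top
  · lift emultiplicity q t to ℕ using ht with m
    norm_cast at he ⊢
    omega

lemma pow_dvd_orbit {p q s : ℕ} (hp : p.Prime) (hq : q.Prime) (hq2 : q ≠ 2) (hpq : p ≠ q)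
    (hs : q ^ s ∣ p ^ (2 * minExp p q) - 1)
    (hs' : ¬ q ^ (s + 1) ∣ p ^ (2 * minExp p q) - 1)
    (i : ℕ) :
    (q : ℤ) ^ i ∣ (p : ℤ) ^ (minExp p q * q ^ (i - s)) - eta p q := by
  have hqp : Prime (q : ℤ) := Nat.prime_iff_prime_int.1 hq
  have hodd : Odd (q ^ (i - s)) := (hq.odd_of_ne_two hq2).pow
  have h1 : (q : ℤ) ∣ (p : ℤ) ^ (minExp p q * q ^ (i - s)) - eta p q := by
    rw [← eta_pow_odd p q hodd, pow_mul]
    exact (eta_spec hp hq hpq).trans (sub_dvd_pow_sub_pow _ _ _)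
  have h2 : (q : ℤ) ^ i ∣ (p : ℤ) ^ (2 * (minExp p q * q ^ (i - s))) - 1 := by
    rw [pow_dvd_iff_le_emultiplicity, mult_pow hp hq hq2 hpq hs hs']
    have h3 := (pow_dvd_iff_le_emultiplicity (a := q) (b := q ^ (i - s)) (k := i - s)).1 dvd_rfl
    calc (i : ℕ∞) ≤ s + (i - s : ℕ) := by norm_cast; omega
      _ ≤ _ := by gcongr
  have h4 : (p : ℤ) ^ (2 * (minExp p q * q ^ (i - s))) - 1 =
      ((p : ℤ) ^ (minExp p q * q ^ (i - s)) - eta p q) *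
        ((p : ℤ) ^ (minExp p q * q ^ (i - s)) + eta p q) := by
    rcases eta_eq p q with h | h <;> rw [h] <;> ring
  rw [h4] at h2
  refine (IsCoprime.pow_left ?_).dvd_of_dvd_mul_right h2
  rw [hqp.coprime_iff_not_dvd]
  intro h5
  have h6 := dvd_sub h5 h1
  have h7 : (q : ℤ) ∣ 2 := by
    have e1 : (p : ℤ) ^ (minExp p q * q ^ (i - s)) + eta p q -
        ((p : ℤ) ^ (minExp p q * q ^ (i - s)) - eta p q) = 2 * eta p q := by ring
    rw [e1] at h6
    rcases eta_eq p q with h | h <;> rw [h] at h6 <;> simpa using h6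
  have h8 : q ∣ 2 := by exact_mod_cast h7
  exact hq2 ((Nat.prime_dvd_prime_iff_eq hq Nat.prime_two).1 h8)

section Orbits

lemma zpow_eq_one_iff_dvd {K : Type*} [Field K] {l : K} (hl : l ≠ 0) (z : ℤ) :
    l ^ z = 1 ↔ (orderOf l : ℤ) ∣ z := by
  have h : orderOf (Units.mk0 l hl) = orderOf l := by
    rw [← orderOf_units, Units.val_mk0]
  rw [← h, orderOf_dvd_iff_zpow_eq_one, ← Units.val_inj]
  simp

/-- The orbit of `l` under Frobenius and inversion, as a multiset. -/
def orb {K : Type*} [Field K] (p m : ℕ) (l : K) : Multiset K :=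
  (Multiset.range m).map (fun e => l ^ p ^ e) + (Multiset.range m).map (fun e => (l ^ p ^ e)⁻¹)

lemma orb_card {K : Type*} [Field K] (p m : ℕ) (l : K) : (orb p m l).card = 2 * m := by
  simp [orb]; ring

lemma orb_inv {K : Type*} [Field K] (p m : ℕ) (l : K) :
    (orb p m l).map (fun x => x⁻¹) = orb p m l := by
  simp only [orb, Multiset.map_add, Multiset.map_map, Function.comp_def, inv_inv]
  rw [add_comm]

lemma orb_frob {K : Type*} [Field K] (p m : ℕ) (l : K)
    (h : l ^ p ^ m = l ∨ l ^ p ^ m = l⁻¹) :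
    (orb p m l).map (fun x => x ^ p) = orb p m l := by
  have key : ∀ f : ℕ → K, f 0 ::ₘ (Multiset.range m).map (fun e => f (e + 1)) =
      f m ::ₘ (Multiset.range m).map f := by
    intro f
    rw [← Multiset.map_cons f m, ← Multiset.range_succ]
    clear h
    induction m with
    | zero => simp
    | succ m ih =>
      rw [Multiset.range_succ, Multiset.map_cons, Multiset.cons_swap, ih,
        Multiset.range_succ (m + 1), Multiset.map_cons]
  have k1 := key (fun e => l ^ p ^ e)
  have k2 := key (fun e => (l ^ p ^ e)⁻¹)
  simp only [pow_zero, pow_one] at k1 k2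
  have h3 : l ::ₘ l⁻¹ ::ₘ (orb p m l).map (fun x => x ^ p) = l ::ₘ l⁻¹ ::ₘ orb p m l := by
    have e1 : (orb p m l).map (fun x => x ^ p) = (Multiset.range m).map (fun e => l ^ p ^ (e + 1))
        + (Multiset.range m).map (fun e => (l ^ p ^ (e + 1))⁻¹) := by
      simp only [orb, Multiset.map_add, Multiset.map_map, Function.comp_def, inv_pow, ← pow_mul,
        pow_succ]
    have e2 : ∀ (x y : K) (S T : Multiset K), x ::ₘ y ::ₘ (S + T) = (x ::ₘ S) + (y ::ₘ T) := by
      intro x y S T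
      rw [Multiset.cons_add, Multiset.add_cons]
    rw [e1, e2, k1, k2, ← e2, orb]
    rcases h with h | h
    · rw [h]
    · rw [h, inv_inv, Multiset.cons_swap]
  simpa using h3

variable {K : Type*} [Field K] {p q s : ℕ} [CharP K p]

lemma orb_key (hp : p.Prime) (hq : q.Prime) (hq2 : q ≠ 2) (hpq : p ≠ q)
    (hs : q ^ s ∣ p ^ (2 * minExp p q) - 1)
    (hs' : ¬ q ^ (s + 1) ∣ p ^ (2 * minExp p q) - 1)
    {l : K} {i : ℕ} (hi : 1 ≤ i) (hl : orderOf l = q ^ i) :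
    (l ^ p ^ (minExp p q * q ^ (i - s)) = l ^ (eta p q)) ∧ l - l⁻¹ ≠ 0 ∧
    (orb p (minExp p q * q ^ (i - s)) l).Nodup := by
  have := Fact.mk hp
  have : ExpChar K p := ExpChar.prime hp
  set m := minExp p q * q ^ (i - s) with hm
  have hl0 : l ≠ 0 := by
    rintro rfl
    have h0 : (0 : K) ^ (q ^ i) = 1 := by rw [← hl]; exact pow_orderOf_eq_one _
    rw [zero_pow (pow_pos hq.pos i).ne'] at h0
    exact zero_ne_one h0
  have h2 : l ≠ l⁻¹ := by
    intro h
    have h3 : l ^ 2 = 1 := by rw [sq]; nth_rw 2 [h]; exact mul_inv_cancel₀ hl0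
    have h4 := orderOf_dvd_of_pow_eq_one h3
    rw [hl] at h4
    have h5 := (dvd_pow_self q (by omega : i ≠ 0)).trans h4
    exact hq2 ((Nat.prime_dvd_prime_iff_eq hq Nat.prime_two).1 h5)
  have h1 : l ^ p ^ m = l ^ (eta p q) := by
    have h3 := pow_dvd_orbit hp hq hq2 hpq hs hs' i
    rw [← hm] at h3
    have h4 := (zpow_eq_one_iff_dvd hl0 ((p : ℤ) ^ m - eta p q)).2 (by rw [hl]; exact_mod_cast h3)
    rw [zpow_sub₀ hl0, div_eq_one_iff_eq (zpow_ne_zero _ hl0)] at h4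
    rw [← h4]; exact_mod_cast rfl
  have h3 : ∀ f, f < m → (l ^ p ^ f = l ∨ l ^ p ^ f = l⁻¹) → f = 0 := by
    intro f hf h
    have h4 : l ^ p ^ (2 * f) = l := by
      rw [two_mul, pow_add, pow_mul]
      rcases h with h | h
      · rw [h, h]
      · rw [h, inv_pow, h, inv_inv]
    have h5 := (zpow_eq_one_iff_dvd hl0 ((p : ℤ) ^ (2 * f) - 1)).1 (by
      rw [zpow_sub₀ hl0, div_eq_one_iff_eq (zpow_ne_zero _ hl0), zpow_one]
      exact_mod_cast h4)
    rw [hl] at h5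
    have h6 := orbit_dvd hp hq hq2 hpq hs hs' hi (e := f) (by exact_mod_cast h5)
    exact Nat.eq_zero_of_dvd_of_lt h6 hf
  have hinj : ∀ e, Function.Injective (fun x : K => x ^ p ^ e) := by
    intro e x y hxy
    exact (iterateFrobenius_inj K p e) (by simpa [iterateFrobenius_def] using hxy)
  have h4' : ∀ e f, e + f < m →
      (l ^ p ^ (e + f) = l ^ p ^ e ∨ l ^ p ^ (e + f) = (l ^ p ^ e)⁻¹) → f = 0 := by
    intro e f hef h
    apply h3 f (by omega)
    rw [add_comm, pow_add, pow_mul, ← inv_pow] at h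
    exact h.imp (fun h => hinj e h) (fun h => hinj e h)
  have h4 : ∀ e e', e < m → e' < m →
      (l ^ p ^ e' = l ^ p ^ e ∨ l ^ p ^ e' = (l ^ p ^ e)⁻¹) → e = e' := by
    intro e e' he he' h
    rcases le_total e e' with hle | hle
    · obtain ⟨f, rfl⟩ := Nat.exists_eq_add_of_le hle
      rw [h4' e f he' h]; rfl
    · obtain ⟨f, rfl⟩ := Nat.exists_eq_add_of_le hle
      rw [h4' e' f he (h.imp (fun h => h.symm) (fun h => by rw [h, inv_inv]))]; rfl
  refine ⟨h1, sub_ne_zero.2 h2, ?_⟩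
  rw [orb, Multiset.nodup_add]
  refine ⟨?_, ?_, ?_⟩
  · refine (Multiset.nodup_map_iff_inj_on (Multiset.nodup_range m)).2 ?_
    intro x hx y hy h
    exact h4 x y (Multiset.mem_range.1 hx) (Multiset.mem_range.1 hy) (Or.inl h.symm)
  · refine (Multiset.nodup_map_iff_inj_on (Multiset.nodup_range m)).2 ?_
    intro x hx y hy h
    exact h4 x y (Multiset.mem_range.1 hx) (Multiset.mem_range.1 hy) (Or.inl (inv_injective h.symm))
  · rw [Multiset.disjoint_left]
    intro x hx hx'
    obtain ⟨e, he, rfl⟩ := Multiset.mem_map.1 hx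
    obtain ⟨e', he', h⟩ := Multiset.mem_map.1 hx'
    have h5 := h4 e' e (Multiset.mem_range.1 he') (Multiset.mem_range.1 he) (Or.inr h.symm)
    subst h5
    rw [← inv_pow] at h
    exact h2 (hinj _ h).symm

/-- Discriminant datum of a multiset. -/
def discP (S : Multiset K) : K := (S.map (fun x => x - x⁻¹)).prod

lemma orb_disc (hp : p.Prime) (hq : q.Prime) (hq2 : q ≠ 2) (hpq : p ≠ q)
    (hs : q ^ s ∣ p ^ (2 * minExp p q) - 1)
    (hs' : ¬ q ^ (s + 1) ∣ p ^ (2 * minExp p q) - 1)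
    {l : K} {i : ℕ} (hi : 1 ≤ i) (hl : orderOf l = q ^ i) :
    ∃ c : K, c ≠ 0 ∧ c ^ p = ((eta p q : ℤ) : K) ^ (q ^ (i - s)) * c ∧
      discP (orb p (minExp p q * q ^ (i - s)) l) = (-1) ^ (minExp p q * q ^ (i - s)) * c ^ 2 := by
  have := Fact.mk hp
  have : ExpChar K p := ExpChar.prime hp
  obtain ⟨h1, h2, -⟩ := orb_key hp hq hq2 hpq hs hs' hi hl
  set m := minExp p q * q ^ (i - s) with hm
  have hodd : Odd (q ^ (i - s)) := (hq.odd_of_ne_two hq2).pow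
  let x : ℕ → K := fun e => l ^ p ^ e - (l ^ p ^ e)⁻¹
  have hx : ∀ e, x e ^ p = x (e + 1) := by
    intro e
    simp only [x]
    rw [sub_pow_expChar, inv_pow, ← pow_mul, ← pow_succ]
  have hx0 : ∀ e, x e ≠ 0 := by
    intro e
    induction e with
    | zero => simpa [x] using h2
    | succ e ih => rw [← hx]; exact pow_ne_zero _ ih
  have hxm : x m = ((eta p q : ℤ) : K) * x 0 := by
    simp only [x]
    rw [h1]
    rcases eta_eq p q with h | h <;> rw [h] <;> simp
  refine ⟨∏ e ∈ Finset.range m, x e, Finset.prod_ne_zero_iff.2 fun e _ => hx0 e, ?_, ?_⟩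
  · rw [← Int.cast_pow, eta_pow_odd p q hodd, ← Finset.prod_pow]
    simp_rw [hx]
    apply mul_right_cancel₀ (hx0 0)
    rw [← Finset.prod_range_succ', Finset.prod_range_succ, hxm]
    ring
  · rw [discP, orb, Multiset.map_add, Multiset.prod_add, Multiset.map_map, Multiset.map_map]
    have e1 : (Multiset.map ((fun x => x - x⁻¹) ∘ fun e => l ^ p ^ e) (Multiset.range m)).prod =
        ∏ e ∈ Finset.range m, x e := rfl
    have e2 : (Multiset.map ((fun x => x - x⁻¹) ∘ fun e => (l ^ p ^ e)⁻¹) (Multiset.range m)).prod =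
        ∏ e ∈ Finset.range m, (-1 * x e) := by
      rw [Finset.prod]
      simp [x]
    rw [e1, e2, Finset.prod_mul_distrib]
    simp
    ring

lemma order_form (hq : q.Prime) {r : ℕ} {l : K} (h : l ^ q ^ r = 1) (h1 : l ≠ 1) :
    ∃ i, 1 ≤ i ∧ orderOf l = q ^ i := by
  obtain ⟨i, -, hi⟩ := (Nat.dvd_prime_pow hq).1 (orderOf_dvd_of_pow_eq_one h)
  refine ⟨i, ?_, hi⟩
  by_contra h0
  have : i = 0 := by omega
  rw [this, pow_zero, orderOf_eq_one_iff] at hi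
  exact h1 hi

lemma orb_le (hp : p.Prime) (hq : q.Prime) (hq2 : q ≠ 2) (hpq : p ≠ q)
    (hs : q ^ s ∣ p ^ (2 * minExp p q) - 1)
    (hs' : ¬ q ^ (s + 1) ∣ p ^ (2 * minExp p q) - 1)
    {l : K} {i : ℕ} (hi : 1 ≤ i) (hl : orderOf l = q ^ i) (S : Multiset K)
    (hF : S.map (fun x => x ^ p) = S) (hI : S.map (fun x => x⁻¹) = S) (hlS : l ∈ S) :
    ∃ S' : Multiset K, S = orb p (minExp p q * q ^ (i - s)) l + S' ∧
      S'.map (fun x => x ^ p) = S' ∧ S'.map (fun x => x⁻¹) = S' := by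
  obtain ⟨h1, h2, h3⟩ := orb_key hp hq hq2 hpq hs hs' hi hl
  have hF' : ∀ x ∈ S, x ^ p ∈ S := fun x hx => by
    rw [← hF]; exact Multiset.mem_map_of_mem _ hx
  have hI' : ∀ x ∈ S, x⁻¹ ∈ S := fun x hx => by
    rw [← hI]; exact Multiset.mem_map_of_mem (fun x => x⁻¹) hx
  have hFe : ∀ e, l ^ p ^ e ∈ S := by
    intro e
    induction e with
    | zero => simpa using hlS
    | succ e ih => rw [pow_succ, pow_mul]; exact hF' _ ih
  have hle : orb p (minExp p q * q ^ (i - s)) l ≤ S := by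
    rw [Multiset.le_iff_subset h3]
    intro x hx
    rw [orb, Multiset.mem_add, Multiset.mem_map, Multiset.mem_map] at hx
    rcases hx with ⟨e, -, rfl⟩ | ⟨e, -, rfl⟩
    · exact hFe e
    · exact hI' _ (hFe e)
  obtain ⟨S', rfl⟩ := Multiset.le_iff_exists_add.1 hle
  refine ⟨S', rfl, ?_, ?_⟩
  · rw [Multiset.map_add, orb_frob] at hF
    · exact add_left_cancel hF
    · rw [h1]; rcases eta_eq p q with h | h <;> rw [h] <;> simp
  · rw [Multiset.map_add, orb_inv] at hI
    exact add_left_cancel hI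

lemma orbits_main (hp : p.Prime) (hq : q.Prime) (hq2 : q ≠ 2) (hpq : p ≠ q)
    (hs : q ^ s ∣ p ^ (2 * minExp p q) - 1)
    (hs' : ¬ q ^ (s + 1) ∣ p ^ (2 * minExp p q) - 1) (r : ℕ) (N : ℕ) :
    ∀ (S : Multiset K), S.card ≤ N →
    S.map (fun x => x ^ p) = S → S.map (fun x => x⁻¹) = S →
    (∀ x ∈ S, x ^ q ^ r = 1 ∧ x ≠ 1) →
    ∃ (d : ℕ) (c : K), c ≠ 0 ∧ S.card = 2 * minExp p q * d ∧
      c ^ p = ((eta p q : ℤ) : K) ^ d * c ∧ discP S = (-1) ^ (minExp p q * d) * c ^ 2 ∧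
      ∀ l ∈ S, ∀ i, 1 ≤ i → orderOf l = q ^ i → q ^ (i - s) ≤ d := by
  have ha := (minExp_spec hp hq hpq).1
  induction N with
  | zero =>
    intro S hS _ _ _
    have : S = 0 := by simpa using hS
    subst this
    exact ⟨0, 1, by simp [discP]⟩
  | succ N ih =>
    intro S hS hF hI hr
    rcases S.empty_or_exists_mem with rfl | ⟨l, hl⟩
    · exact ⟨0, 1, by simp [discP]⟩
    obtain ⟨i, hi, hli⟩ := order_form hq (hr l hl).1 (hr l hl).2
    obtain ⟨S', rfl, hF', hI'⟩ := orb_le hp hq hq2 hpq hs hs' hi hli S hF hI hl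
    have hm : 0 < minExp p q * q ^ (i - s) := Nat.mul_pos ha (pow_pos hq.pos _)
    obtain ⟨d, c, hc0, hcard, hcp, hdisc, -⟩ := ih S' (by
      rw [Multiset.card_add, orb_card] at hS; omega) hF' hI'
      (fun x hx => hr x (Multiset.mem_add.2 (Or.inr hx)))
    obtain ⟨c', hc0', hcp', hdisc'⟩ := orb_disc hp hq hq2 hpq hs hs' hi hli
    have hcd : (orb p (minExp p q * q ^ (i - s)) l + S').card =
        2 * minExp p q * (q ^ (i - s) + d) := by
      rw [Multiset.card_add, orb_card, hcard]; ring
    refine ⟨q ^ (i - s) + d, c' * c, mul_ne_zero hc0' hc0, hcd, ?_, ?_, ?_⟩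
    · rw [mul_pow, hcp, hcp']; ring
    · have : ∀ S T : Multiset K, discP (S + T) = discP S * discP T := by
        intro S T; simp [discP]
      rw [this, hdisc, hdisc']; ring
    · intro l' hl' i' hi' hli'
      obtain ⟨S'', h, -, -⟩ := orb_le hp hq hq2 hpq hs hs' hi' hli' _ hF hI hl'
      have h5 : 2 * (minExp p q * q ^ (i' - s)) ≤ 2 * minExp p q * (q ^ (i - s) + d) := by
        rw [← hcd, h, Multiset.card_add, orb_card]; omega
      rw [← mul_assoc] at h5
      exact Nat.le_of_mul_le_mul_left h5 (by omega)

end Orbits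

section Skew

lemma det_skew_isSquare {F : Type*} [Field F] (h2 : (2 : F) ≠ 0) (N : ℕ) :
    ∀ (ι : Type) [Fintype ι] [DecidableEq ι], Fintype.card ι ≤ N →
    ∀ J : Matrix ι ι F, Jᵀ = -J → IsSquare J.det := by
  induction N with
  | zero =>
    intro ι _ _ h J _
    have : IsEmpty ι := Fintype.card_eq_zero_iff.1 (by omega)
    rw [Matrix.det_isEmpty]
    exact IsSquare.one
  | succ N ih =>
    intro ι _ _ hN J hJ
    have hsk : ∀ i j, J j i = - J i j := fun i j => by
      have := congrFun (congrFun hJ i) j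
      simpa using this
    have hdiag : ∀ i, J i i = 0 := fun i => by
      have h := hsk i i
      have h3 : 2 * J i i = 0 := by linear_combination h
      exact (mul_eq_zero.1 h3).resolve_left h2
    by_cases hJ0 : J = 0
    · subst hJ0
      rcases isEmpty_or_nonempty ι with h | h
      · rw [Matrix.det_isEmpty]; exact IsSquare.one
      · rw [Matrix.det_zero]; exact IsSquare.zero
    have hex : ∃ i j, J i j ≠ 0 := by
      by_contra h
      push Not at h
      exact hJ0 (by ext i j; simp [h])
    obtain ⟨i, j, hij⟩ := hex
    have hne : i ≠ j := by rintro rfl; exact hij (hdiag i)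
    let f : Fin 2 → ι := ![i, j]
    have hf : Function.Injective f := by
      intro x y hxy
      fin_cases x <;> fin_cases y <;> simp [f, hne, hne.symm] at hxy ⊢
    classical
    let e : Fin 2 ⊕ ((Set.range f)ᶜ : Set ι) ≃ ι :=
      (Equiv.sumCongr (Equiv.ofInjective f hf) (Equiv.refl _)).trans
        (Equiv.Set.sumCompl (Set.range f))
    have he : ∀ x, e (Sum.inl x) = f x := by intro x; simp [e]
    rw [← Matrix.det_submatrix_equiv_self e J]
    set J' := J.submatrix e e with hJ'
    have hJ't : J'ᵀ = -J' := by
      rw [hJ', Matrix.transpose_submatrix, hJ]; rfl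
    have h11 : J'.toBlocks₁₁ = !![0, J i j; -J i j, 0] := by
      ext x y
      fin_cases x <;> fin_cases y <;> simp [J', Matrix.toBlocks₁₁, he, f, hdiag, hsk i j]
    have hd11 : J'.toBlocks₁₁.det = J i j * J i j := by
      rw [h11, Matrix.det_fin_two_of]; ring
    have hu : IsUnit J'.toBlocks₁₁ := by
      rw [Matrix.isUnit_iff_isUnit_det, hd11]
      exact (mul_ne_zero hij hij).isUnit
    have : Invertible J'.toBlocks₁₁ := hu.invertible
    rw [← Matrix.fromBlocks_toBlocks J', Matrix.det_fromBlocks₁₁, hd11]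
    refine IsSquare.mul ⟨_, rfl⟩ (ih _ ?_ _ ?_)
    · have hc := Fintype.card_congr e
      rw [Fintype.card_sum, Fintype.card_fin] at hc
      omega
    · rw [← Matrix.fromBlocks_toBlocks J', Matrix.fromBlocks_transpose, Matrix.fromBlocks_neg,
        Matrix.fromBlocks_inj] at hJ't
      obtain ⟨t1, t2, t3, t4⟩ := hJ't
      have ti : (⅟J'.toBlocks₁₁)ᵀ = - ⅟J'.toBlocks₁₁ := by
        rw [Matrix.invOf_eq_nonsing_inv, Matrix.transpose_nonsing_inv, t1]
        refine Matrix.inv_eq_right_inv ?_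
        rw [neg_mul_neg, Matrix.mul_nonsing_inv _ ((Matrix.isUnit_iff_isUnit_det _).1 hu)]
      rw [Matrix.transpose_sub, Matrix.transpose_mul, Matrix.transpose_mul, t4, t2, t3, ti]
      simp only [Matrix.neg_mul, Matrix.mul_neg, neg_neg, Matrix.mul_assoc]
      abel

lemma det_isometry_isSquare {F : Type*} [Field F] (h2 : (2 : F) ≠ 0) {n : ℕ}
    {A B : Matrix (Fin n) (Fin n) F} (hB : B.IsSymm) (hA : Aᵀ * B * A = B) (hu : IsUnit A) :
    IsSquare (B.det * (A - A⁻¹).det) := by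
  rw [← Matrix.det_mul]
  have hd := (Matrix.isUnit_iff_isUnit_det _).1 hu
  refine det_skew_isSquare h2 n (Fin n) (by simp) _ ?_
  have h1 : Aᵀ * B = B * A⁻¹ := by
    calc Aᵀ * B = Aᵀ * B * A * A⁻¹ := by rw [Matrix.mul_assoc _ A, Matrix.mul_nonsing_inv _ hd,
          Matrix.mul_one]
      _ = _ := by rw [hA]
  have h3 : (A⁻¹)ᵀ * B = B * A := by
    have := congrArg Matrix.transpose h1
    rw [Matrix.transpose_mul, Matrix.transpose_mul, Matrix.transpose_transpose, hB] at this
    exact this.symm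
  rw [Matrix.transpose_mul, Matrix.transpose_sub, hB, Matrix.sub_mul, h1, h3, Matrix.mul_sub]
  abel

end Skew

section FieldLevel
open Polynomial

lemma mem_range_of_pow_card {U K : Type*} [Field U] [Fintype U] [Field K] (f : U →+* K) {x : K}
    (hx : x ^ Fintype.card U = x) : ∃ u, f u = x := by
  have h0 : (X ^ Fintype.card U - X : U[X]) ≠ 0 :=
    FiniteField.X_pow_card_sub_X_ne_zero U Fintype.one_lt_card
  have hsp : (X ^ Fintype.card U - X : U[X]).Splits := by
    rw [splits_iff_card_roots, FiniteField.roots_X_pow_card_sub_X,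
      FiniteField.X_pow_card_sub_X_natDegree_eq _ Fintype.one_lt_card]
    rfl
  obtain ⟨u, hu⟩ := hsp.mem_range_of_isRoot h0 (i := f) (x := x) (by
    simp [IsRoot, hx])
  exact ⟨u, hu⟩

variable {K : Type*} [Field K] [IsAlgClosed K] {n : ℕ}

lemma eval_roots (M : Matrix (Fin n) (Fin n) K) (t : K) :
    (M.charpoly.roots.map (fun x => t - x)).prod = (Matrix.scalar (Fin n) t - M).det := by
  rw [← Matrix.eval_charpoly, (IsAlgClosed.splits _).eval_eq_prod_roots_of_monic
    (Matrix.charpoly_monic M)]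

lemma card_roots_charpoly (M : Matrix (Fin n) (Fin n) K) : M.charpoly.roots.card = n := by
  rw [← (IsAlgClosed.splits M.charpoly).natDegree_eq_card_roots, Matrix.charpoly_natDegree_eq_dim]
  simp

lemma roots_ne_zero {M : Matrix (Fin n) (Fin n) K} (hM : IsUnit M) :
    ∀ x ∈ M.charpoly.roots, x ≠ 0 := by
  rintro x hx rfl
  have h := (mem_roots (Matrix.charpoly_monic M).ne_zero).1 hx
  rw [IsRoot, Matrix.eval_charpoly] at h
  have h2 := (Matrix.isUnit_iff_isUnit_det _).1 hM.neg
  rw [map_zero, zero_sub] at h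
  rw [h] at h2
  exact not_isUnit_zero h2

lemma roots_inv {M : Matrix (Fin n) (Fin n) K} (hM : IsUnit M)
    (hs : M⁻¹.charpoly = M.charpoly) :
    M.charpoly.roots.map (fun x => x⁻¹) = M.charpoly.roots := by
  set S := M.charpoly.roots with hS
  have hd := (Matrix.isUnit_iff_isUnit_det _).1 hM
  have h0 := roots_ne_zero hM
  have hdet : M.det = S.prod := Matrix.det_eq_prod_roots_charpoly M
  have key : ((S.map (fun x => x⁻¹)).map (fun x => X - C x)).prod = M.charpoly := by
    apply Polynomial.eq_of_infinite_eval_eq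
    apply Set.Infinite.mono (s := {0}ᶜ)
    swap
    · exact (Set.finite_singleton (0 : K)).infinite_compl
    intro t ht
    have ht : t ≠ 0 := ht
    change eval t _ = eval t _
    rw [← hs, Matrix.eval_charpoly]
    have e1 : M * (Matrix.scalar (Fin n) t - M⁻¹) =
        (-t) • (Matrix.scalar (Fin n) t⁻¹ - M) := by
      rw [mul_sub, Matrix.mul_nonsing_inv _ hd, smul_sub]
      ext i j
      by_cases hij : i = j
      · subst hij; simp [ht]; ring
      · simp [hij, Matrix.scalar_apply]; ring
    have e2 := congrArg Matrix.det e1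
    rw [Matrix.det_mul, Matrix.det_smul, ← eval_roots M t⁻¹, hdet] at e2
    apply mul_left_cancel₀ (a := S.prod) (by rw [← hdet]; exact hd.ne_zero)
    rw [e2, eval_multiset_prod, Multiset.map_map, Multiset.map_map]
    have e3 : (-t) ^ Fintype.card (Fin n) = (S.map (fun _ => -t)).prod := by
      rw [Multiset.map_const', Multiset.prod_replicate, hS, card_roots_charpoly]; simp
    rw [e3, ← Multiset.prod_map_mul]
    conv_lhs => rw [← Multiset.map_id S]
    rw [Multiset.map_map, ← Multiset.prod_map_mul]
    congr 1
    apply Multiset.map_congr rfl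
    intro x hx
    have := h0 x hx
    simp
    field_simp
    ring
  have := congrArg Polynomial.roots key
  rwa [roots_multiset_prod_X_sub_C] at this

lemma det_disc {M : Matrix (Fin n) (Fin n) K} (hM : IsUnit M) :
    (M - M⁻¹).det = discP M.charpoly.roots := by
  set S := M.charpoly.roots with hS
  have hd := (Matrix.isUnit_iff_isUnit_det _).1 hM
  have h0 := roots_ne_zero hM
  have hdet : M.det = S.prod := Matrix.det_eq_prod_roots_charpoly M
  have e1 : M * (M - M⁻¹) = (Matrix.scalar (Fin n) 1 - M) * (Matrix.scalar (Fin n) (-1) - M) := by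
    rw [mul_sub, Matrix.mul_nonsing_inv _ hd]
    have : Matrix.scalar (Fin n) (-1 : K) = -1 := by rw [map_neg, map_one]
    rw [this, map_one]
    noncomm_ring
  have e2 := congrArg Matrix.det e1
  rw [Matrix.det_mul, Matrix.det_mul, ← eval_roots, ← eval_roots, hdet] at e2
  apply mul_left_cancel₀ (a := S.prod) (by rw [← hdet]; exact hd.ne_zero)
  rw [e2, discP, ← Multiset.prod_map_mul]
  conv_rhs => rw [← Multiset.map_id S]
  rw [Multiset.map_map, ← Multiset.prod_map_mul]
  congr 1
  apply Multiset.map_congr rfl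
  intro x hx
  have := h0 x hx
  simp
  field_simp
  ring

lemma root_pow {M : Matrix (Fin n) (Fin n) K} {Q : ℕ} (hM : M ^ Q = 1) :
    ∀ x ∈ M.charpoly.roots, x ^ Q = 1 := by
  intro x hx
  have h := (mem_roots (Matrix.charpoly_monic M).ne_zero).1 hx
  rw [IsRoot, Matrix.eval_charpoly] at h
  obtain ⟨Y, hY⟩ := (show Commute (Matrix.scalar (Fin n) x) M from
    Matrix.scalar_commute x (fun _ => Commute.all _ _) M).sub_dvd_pow_sub_pow Q
  have h2 := congrArg Matrix.det hY
  rw [Matrix.det_mul, h, zero_mul, hM, ← map_pow, ← map_one (Matrix.scalar (Fin n)), ← map_sub]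
    at h2
  simp only [Matrix.scalar_apply, Matrix.det_diagonal, Finset.prod_const] at h2
  by_contra hne
  exact pow_ne_zero _ (sub_ne_zero.2 hne) h2

lemma nilp_of_roots {M : Matrix (Fin n) (Fin n) K} {Q : ℕ}
    (h : ∀ x ∈ M.charpoly.roots, x ^ Q = 1) : (M ^ Q - 1) ^ n = 0 := by
  have h1 : M.charpoly ∣ (X ^ Q - 1) ^ n := by
    rw [(IsAlgClosed.splits M.charpoly).eq_prod_roots_of_monic (Matrix.charpoly_monic M)]
    conv_rhs => rw [← card_roots_charpoly M, ← Multiset.prod_replicate, ← Multiset.map_const']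
    apply Multiset.prod_dvd_prod_of_dvd
    intro x hx
    rw [dvd_iff_isRoot]
    simp [h x hx]
  obtain ⟨g, hg⟩ := h1
  have := congrArg (aeval M) hg
  rw [map_mul, Matrix.aeval_self_charpoly, zero_mul] at this
  simpa using this
end FieldLevel

section Main1
open Polynomial

lemma epsilon_eq {p : ℕ} [Fact p.Prime] {n : ℕ} {B : Matrix (Fin n) (Fin n) (ZMod p)} (hB : B.det ≠ 0)
    {m : ℕ} (hn : n = 2 * m) :
    epsilon p B = quadraticChar (ZMod p) (B.det * (-1) ^ m) := by
  have h1 : (if IsSquare B.det then (1 : ℤ) else -1) = quadraticChar (ZMod p) B.det := by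
    split_ifs with h
    · exact ((quadraticChar_one_iff_isSquare hB).2 h).symm
    · exact (quadraticChar_neg_one_iff_not_isSquare.2 h).symm
  have h2 : (if p % 4 = 3 ∧ Fintype.card (Fin n) % 4 = 2 then (-1 : ℤ) else 1) =
      quadraticChar (ZMod p) (-1) ^ m := by
    rw [Fintype.card_fin]
    by_cases h3 : p % 4 = 3
    · have : quadraticChar (ZMod p) (-1) = -1 := by
        rw [quadraticChar_neg_one_iff_not_isSquare, ZMod.exists_sq_eq_neg_one_iff]
        simpa using h3
      rw [this]
      rcases Nat.even_or_odd m with hm | hm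
      · rw [hm.neg_one_pow, if_neg]
        obtain ⟨t, rfl⟩ := hm; omega
      · rw [hm.neg_one_pow, if_pos]
        obtain ⟨t, rfl⟩ := hm; omega
    · have : quadraticChar (ZMod p) (-1) = 1 := by
        rw [quadraticChar_one_iff_isSquare (by simp), ZMod.exists_sq_eq_neg_one_iff]
        exact h3
      rw [this, one_pow, if_neg]
      tauto
  rw [map_mul, map_pow, ← h1, ← h2]
  unfold epsilon
  congr

lemma field_main {p q s r : ℕ} [Fact p.Prime] (hp : p.Prime) (hq : q.Prime) (hp2 : p ≠ 2)
    (hq2 : q ≠ 2) (hpq : p ≠ q)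
    (hs : q ^ s ∣ p ^ (2 * minExp p q) - 1)
    (hs' : ¬ q ^ (s + 1) ∣ p ^ (2 * minExp p q) - 1)
    (hr : 1 ≤ r) {n : ℕ} {A B : Matrix (Fin n) (Fin n) (ZMod p)} (hB : B.IsSymm) (hBd : B.det ≠ 0)
    (hA : Aᵀ * B * A = B) (hAr : A ^ q ^ r = 1) (hA1 : (A - 1).det ≠ 0)
    (hnil : (A ^ q ^ (r - 1) - 1) ^ n ≠ 0) :
    ∃ d : ℕ, q ^ (r - s) ≤ d ∧ n = 2 * minExp p q * d ∧ epsilon p B = eta p q ^ d := by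
  let K := AlgebraicClosure (ZMod p)
  have : CharP K p := charP_of_injective_algebraMap (algebraMap (ZMod p) K).injective p
  have h2 : (2 : ZMod p) ≠ 0 := by
    intro h
    have h3 := (ZMod.natCast_eq_zero_iff 2 p).1 (by exact_mod_cast h)
    exact hp2 ((Nat.prime_dvd_prime_iff_eq hp Nat.prime_two).1 h3)
  have hchar : ringChar (ZMod p) ≠ 2 := by rwa [ZMod.ringChar_zmod_n]
  have hAu : IsUnit A := IsUnit.of_pow_eq_one hAr (pow_pos hq.pos r).ne'
  have hAd := (Matrix.isUnit_iff_isUnit_det _).1 hAu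
  have hBu := (Matrix.isUnit_iff_isUnit_det B).2 hBd.isUnit
  let φ := algebraMap (ZMod p) K
  let M : Matrix (Fin n) (Fin n) K := φ.mapMatrix A
  have hMc : M.charpoly = A.charpoly.map φ := Matrix.charpoly_map A φ
  have hMu : IsUnit M := hAu.map φ.mapMatrix
  have hMi : M⁻¹ = φ.mapMatrix A⁻¹ := by
    apply Matrix.inv_eq_right_inv
    rw [← map_mul, Matrix.mul_nonsing_inv _ hAd, map_one]
  have hinv : A⁻¹.charpoly = A.charpoly := by
    have h1 : A⁻¹ = B⁻¹ * (Aᵀ * B) := by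
      apply Matrix.inv_eq_left_inv
      rw [Matrix.mul_assoc, hA, Matrix.nonsing_inv_mul _ hBd.isUnit]
    rw [h1, Matrix.charpoly_mul_comm, Matrix.mul_assoc, Matrix.mul_nonsing_inv _ hBd.isUnit,
      Matrix.mul_one, Matrix.charpoly_transpose]
  have hMinv : M⁻¹.charpoly = M.charpoly := by
    rw [hMi, hMc, ← hinv]; exact Matrix.charpoly_map _ φ
  set S := M.charpoly.roots with hS
  have hF : S.map (fun x => x ^ p) = S := by
    have h1 := (IsAlgClosed.splits M.charpoly).roots_map (frobenius K p)
    rw [hMc, Polynomial.map_map] at h1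
    have h3 : (frobenius K p).comp φ = φ := Subsingleton.elim _ _
    rw [h3, ← hMc] at h1
    exact h1.symm
  have hI : S.map (fun x => x⁻¹) = S := roots_inv hMu hMinv
  have hMr : M ^ q ^ r = 1 := by rw [← map_pow, hAr, map_one]
  have hS1 : ∀ x ∈ S, x ^ q ^ r = 1 ∧ x ≠ 1 := by
    intro x hx
    refine ⟨root_pow hMr x hx, ?_⟩
    rintro rfl
    have h := (mem_roots (Matrix.charpoly_monic M).ne_zero).1 hx
    rw [IsRoot, Matrix.eval_charpoly, map_one] at h
    have h3 : (1 : Matrix (Fin n) (Fin n) K) - M = φ.mapMatrix (-(A - 1)) := by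
      rw [neg_sub, map_sub, map_one]
    rw [h3, ← RingHom.map_det, Matrix.det_neg, map_eq_zero] at h
    exact mul_ne_zero (pow_ne_zero _ (by simp)) hA1 h
  obtain ⟨d, c, hc0, hcard, hcp, hdisc, hbd⟩ :=
    orbits_main hp hq hq2 hpq hs hs' r _ S le_rfl hF hI hS1
  have hn : n = 2 * minExp p q * d := by rw [← hcard, hS, card_roots_charpoly]
  refine ⟨d, ?_, hn, ?_⟩
  · have hex : ∃ x ∈ S, x ^ q ^ (r - 1) ≠ 1 := by
      by_contra hcon
      push Not at hcon
      have h1 := nilp_of_roots hcon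
      apply hnil
      have h3 : φ.mapMatrix ((A ^ q ^ (r - 1) - 1) ^ n) = φ.mapMatrix 0 := by
        rw [map_pow, map_sub, map_pow, map_one, map_zero]; exact h1
      exact Matrix.map_injective φ.injective h3
    obtain ⟨x, hx, hx1⟩ := hex
    refine hbd x hx r hr ?_
    have := Fact.mk hq
    obtain ⟨r', rfl⟩ : ∃ r', r = r' + 1 := ⟨r - 1, by omega⟩
    exact orderOf_eq_prime_pow hx1 (hS1 x hx).1
  · rw [epsilon_eq hBd (m := minExp p q * d) (by rw [hn]; ring)]
    have hdd : φ (A - A⁻¹).det = (-1) ^ (minExp p q * d) * c ^ 2 := by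
      rw [← hdisc, ← det_disc hMu, hMi, ← map_sub, RingHom.map_det]
    set δ := (A - A⁻¹).det with hδ
    set m := minExp p q * d with hm
    have hδ0 : δ ≠ 0 := by
      intro h
      rw [h, map_zero] at hdd
      exact mul_ne_zero (pow_ne_zero _ (by simp)) (pow_ne_zero 2 hc0) hdd.symm
    have hsq : quadraticChar (ZMod p) (B.det * δ) = 1 :=
      (quadraticChar_one_iff_isSquare (mul_ne_zero hBd hδ0)).2 (det_isometry_isSquare h2 hB hA hAu)
    have hγ0 : δ * (-1) ^ m ≠ 0 := mul_ne_zero hδ0 (pow_ne_zero _ (by simp))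
    have hγ : φ (δ * (-1) ^ m) = c ^ 2 := by
      rw [map_mul, hdd, map_pow, map_neg, map_one]
      have : ((-1 : K) ^ m) * (-1) ^ m = 1 := by
        rw [← mul_pow, neg_mul_neg, one_mul, one_pow]
      linear_combination c ^ 2 * this
    have h5 : quadraticChar (ZMod p) (B.det * (-1) ^ m) =
        quadraticChar (ZMod p) (δ * (-1) ^ m) := by
      rw [map_mul] at hsq ⊢
      rw [map_mul]
      rcases quadraticChar_dichotomy hBd with h | h <;> rw [h] at hsq ⊢
      · rw [one_mul] at hsq; rw [hsq]
      · have : quadraticChar (ZMod p) δ = -1 := by linarith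
        rw [this]
    rw [h5]
    have h6 : eta p q ^ d = 1 ∨ eta p q ^ d = -1 := by
      rcases eta_eq p q with h | h <;> rw [h]
      · simp
      · exact neg_one_pow_eq_or ℤ d
    rw [← Int.cast_pow] at hcp
    rcases h6 with h6 | h6 <;> rw [h6] at hcp ⊢
    · rw [quadraticChar_one_iff_isSquare hγ0]
      obtain ⟨u, hu⟩ := mem_range_of_pow_card φ (x := c) (by rw [ZMod.card, hcp]; simp)
      refine ⟨u, φ.injective ?_⟩
      rw [hγ, map_mul, hu, sq]
    · rw [quadraticChar_neg_one_iff_not_isSquare]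
      rintro ⟨u, hu⟩
      rw [hu, map_mul, ← sq] at hγ
      have h7 : c ^ p = c := by
        have h8 : (φ u) ^ p = φ u := by rw [← map_pow, ZMod.pow_card]
        rcases sq_eq_sq_iff_eq_or_eq_neg.1 hγ with h | h
        · rw [← h]; exact h8
        · have : c = φ (-u) := by rw [map_neg, h, neg_neg]
          rw [this, ← map_pow, ZMod.pow_card]
      rw [h7] at hcp
      push_cast at hcp
      have h9 : φ 2 * c = 0 := by
        rw [map_ofNat]; linear_combination hcp
      rcases mul_eq_zero.1 h9 with h | h
      · exact h2 ((map_eq_zero φ).1 h)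
      · exact hc0 h
end Main1

section Lift
open Polynomial

/-- Reduction mod `p`. -/
def redH (p k : ℕ) (hk : 1 ≤ k) : ZMod (p ^ k) →+* ZMod p :=
  ZMod.castHom (dvd_pow_self p (by omega)) (ZMod p)

variable {p k : ℕ} (hk : 1 ≤ k)

lemma redH_surj : Function.Surjective (redH p k hk) := ZMod.ringHom_surjective _

lemma p_pow_zero (p k : ℕ) : ((p : ZMod (p ^ k))) ^ k = 0 := by
  have := ZMod.natCast_self (p ^ k)
  exact_mod_cast this

lemma redH_ker [NeZero p] {x : ZMod (p ^ k)} (hx : redH p k hk x = 0) :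
    ∃ y, x = (p : ZMod (p ^ k)) * y := by
  obtain ⟨m, rfl⟩ := ZMod.natCast_zmod_surjective x
  rw [map_natCast, ZMod.natCast_eq_zero_iff] at hx
  obtain ⟨y, rfl⟩ := hx
  exact ⟨y, by push_cast; rfl⟩

lemma redH_mat_ker [NeZero p] {n : ℕ} {X : Matrix (Fin n) (Fin n) (ZMod (p ^ k))}
    (hX : (redH p k hk).mapMatrix X = 0) : ∃ Y, X = (p : Matrix (Fin n) (Fin n) (ZMod (p ^ k))) * Y := by
  have h : ∀ i j, ∃ y, X i j = (p : ZMod (p ^ k)) * y := by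
    intro i j
    apply redH_ker hk
    have := congrFun (congrFun hX i) j
    simpa using this
  choose Y hY using h
  refine ⟨Matrix.of Y, ?_⟩
  rw [← nsmul_eq_mul]
  ext i j
  rw [hY, Matrix.smul_apply, nsmul_eq_mul, Matrix.of_apply]

lemma mat_p_pow_zero (p k n : ℕ) : ((p : Matrix (Fin n) (Fin n) (ZMod (p ^ k)))) ^ k = 0 := by
  have h := congrArg (algebraMap (ZMod (p ^ k)) (Matrix (Fin n) (Fin n) (ZMod (p ^ k))))
    (p_pow_zero p k)
  rw [map_pow, map_natCast, map_zero] at h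
  exact h

lemma redH_mat_nilp [NeZero p] {n : ℕ} {X : Matrix (Fin n) (Fin n) (ZMod (p ^ k))}
    (hX : (redH p k hk).mapMatrix X = 0) : IsNilpotent X := by
  obtain ⟨Y, rfl⟩ := redH_mat_ker hk hX
  refine ⟨k, ?_⟩
  rw [(Nat.cast_commute p Y).mul_pow, mat_p_pow_zero, zero_mul]

lemma redH_unit [Fact p.Prime] {x : ZMod (p ^ k)} (hx : redH p k hk x ≠ 0) : IsUnit x := by
  obtain ⟨y, hy⟩ := redH_surj hk (redH p k hk x)⁻¹
  have h1 : redH p k hk (x * y - 1) = 0 := by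
    rw [map_sub, map_mul, hy, mul_inv_cancel₀ hx, map_one, sub_self]
  obtain ⟨z, hz⟩ := redH_ker hk h1
  have h2 : IsNilpotent (x * y - 1) := ⟨k, by rw [hz, mul_pow, p_pow_zero, zero_mul]⟩
  have h3 : IsUnit (x * y) := by
    have := h2.isUnit_one_add
    rwa [add_sub_cancel] at this
  exact isUnit_of_mul_isUnit_left h3

lemma redH_unit_iff [Fact p.Prime] {x : ZMod (p ^ k)} : IsUnit x ↔ redH p k hk x ≠ 0 :=
  ⟨fun h => (h.map (redH p k hk)).ne_zero, redH_unit hk⟩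

lemma redH_mat_pow [NeZero p] {n : ℕ} {Z : Matrix (Fin n) (Fin n) (ZMod (p ^ k))}
    (hX : (redH p k hk).mapMatrix Z = 1) : Z ^ p ^ k = 1 := by
  obtain ⟨Y, hY⟩ := redH_mat_ker hk (X := Z - 1) (by rw [map_sub, hX, map_one, sub_self])
  have h1 : ((p : ℕ) : ℤ[X]) ∣ (1 + (p : ℤ[X]) * X) - 1 := ⟨X, by ring⟩
  obtain ⟨g, hg⟩ := dvd_sub_pow_of_dvd_sub h1 k
  have h2 := congrArg (aeval Y) hg
  simp only [map_sub, map_pow, map_add, map_one, map_mul, map_natCast, aeval_X, one_pow] at h2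
  rw [← hY, add_sub_cancel, pow_succ, mat_p_pow_zero, zero_mul, zero_mul] at h2
  exact sub_eq_zero.1 h2

lemma redH_elt_pow [NeZero p] {x : ZMod (p ^ k)}
    (hX : redH p k hk x = 1) : x ^ p ^ k = 1 := by
  obtain ⟨y, hy⟩ := redH_ker hk (x := x - 1) (by rw [map_sub, hX, map_one, sub_self])
  obtain ⟨g, hg⟩ := dvd_sub_pow_of_dvd_sub (a := x) (b := 1) ⟨y, hy⟩ k
  rw [pow_succ, p_pow_zero, zero_mul, zero_mul, one_pow] at hg
  exact sub_eq_zero.1 hg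

lemma redH_square [Fact p.Prime] (hp2 : p ≠ 2) {u : ZMod (p ^ k)} (hu : IsUnit u) :
    IsSquare u ↔ IsSquare (redH p k hk u) := by
  refine ⟨fun h => h.map _, ?_⟩
  rintro ⟨v, hv⟩
  have hu0 := (redH_unit_iff hk).1 hu
  obtain ⟨w, rfl⟩ := redH_surj hk v
  have hw : IsUnit w := by
    rw [redH_unit_iff hk]
    intro h
    rw [h, mul_zero] at hv
    exact hu0 hv
  obtain ⟨w, rfl⟩ := hw
  have h1 : redH p k hk (u * (↑w⁻¹ * ↑w⁻¹)) = 1 := by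
    rw [map_mul, hv, ← map_mul, ← map_mul]
    have : (w : ZMod (p ^ k)) * w * (↑w⁻¹ * ↑w⁻¹) = 1 := by
      rw [mul_mul_mul_comm, Units.mul_inv, one_mul]
    rw [this, map_one]
  have h2 := redH_elt_pow hk h1
  have hodd : Odd (p ^ k) := (Nat.Prime.odd_of_ne_two Fact.out hp2).pow
  obtain ⟨t, ht⟩ := hodd
  refine ⟨(u * (↑w⁻¹ * ↑w⁻¹)) ^ (t + 1) * w, ?_⟩
  have h3 : (u * (↑w⁻¹ * ↑w⁻¹)) ^ (t + 1) * (u * (↑w⁻¹ * ↑w⁻¹)) ^ (t + 1) =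
      u * (↑w⁻¹ * ↑w⁻¹) := by
    rw [← pow_add, show t + 1 + (t + 1) = 2 * t + 1 + 1 by ring, ← ht, pow_succ, h2, one_mul]
  rw [mul_mul_mul_comm, h3]
  have : (w : ZMod (p ^ k)) * w * (↑w⁻¹ * ↑w⁻¹) = 1 := by
    rw [mul_mul_mul_comm, Units.mul_inv, one_mul]
  linear_combination (-u) * this

lemma forms_congr [Fact p.Prime] (hp2 : p ≠ 2) {n : ℕ}
    {B₁ B₂ : Matrix (Fin n) (Fin n) (ZMod (p ^ k))}
    (h1 : B₁.IsSymm) (h2 : B₂.IsSymm) (hu : IsUnit B₁.det)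
    (hmod : (redH p k hk).mapMatrix B₁ = (redH p k hk).mapMatrix B₂) :
    ∃ C, Cᵀ * B₁ * C = B₂ ∧ (redH p k hk).mapMatrix C = 1 := by
  set U := B₁⁻¹ * B₂ with hU
  have hBU : B₁ * U = B₂ := by rw [hU, ← Matrix.mul_assoc, Matrix.mul_nonsing_inv _ hu, Matrix.one_mul]
  have hUB : Uᵀ * B₁ = B₁ * U := by
    rw [hU, Matrix.transpose_mul, Matrix.transpose_nonsing_inv, h1, h2, Matrix.mul_assoc,
      Matrix.nonsing_inv_mul _ hu, Matrix.mul_one, ← hU, hBU]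
  have hU1 : (redH p k hk).mapMatrix U = 1 := by
    rw [hU, map_mul, ← hmod, ← map_mul, Matrix.nonsing_inv_mul _ hu, map_one]
  have hUp := redH_mat_pow hk hU1
  have hpow : ∀ j, (U ^ j)ᵀ * B₁ = B₁ * U ^ j := by
    intro j
    induction j with
    | zero => simp
    | succ j ih =>
      rw [pow_succ, Matrix.transpose_mul, Matrix.mul_assoc, ih, ← Matrix.mul_assoc, hUB,
        Matrix.mul_assoc, ← pow_succ', ← pow_succ]
  have hodd : Odd (p ^ k) := (Nat.Prime.odd_of_ne_two Fact.out hp2).pow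
  obtain ⟨t, ht⟩ := hodd
  refine ⟨U ^ (t + 1), ?_, by rw [map_pow, hU1, one_pow]⟩
  rw [hpow, Matrix.mul_assoc, ← pow_add, show t + 1 + (t + 1) = 2 * t + 1 + 1 by ring, ← ht,
    pow_succ, hUp, one_mul, hBU]

lemma isom_pow {R : Type*} [CommRing R] {n : ℕ} {A B : Matrix (Fin n) (Fin n) R}
    (h : Aᵀ * B * A = B) (j : ℕ) : (A ^ j)ᵀ * B * A ^ j = B := by
  induction j with
  | zero => simp
  | succ j ih =>
    calc (A ^ (j + 1))ᵀ * B * A ^ (j + 1) = Aᵀ * ((A ^ j)ᵀ * B * A ^ j) * A := by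
          rw [pow_succ, Matrix.transpose_mul]; simp only [Matrix.mul_assoc]
      _ = B := by rw [ih, h]

lemma lift_isom_s1 [Fact p.Prime] (hp2 : p ≠ 2) {n Q : ℕ} (hQ : Nat.Coprime p Q)
    {B : Matrix (Fin n) (Fin n) (ZMod (p ^ k))}
    (h1 : B.IsSymm) (hu : IsUnit B.det) {A' : Matrix (Fin n) (Fin n) (ZMod p)}
    (hA' : A'ᵀ * (redH p k hk).mapMatrix B * A' = (redH p k hk).mapMatrix B)
    (hA'u : A'.det ≠ 0)
    (hA'r : A' ^ Q = 1) :
    ∃ A, Aᵀ * B * A = B ∧ (redH p k hk).mapMatrix A = A' ∧ A ^ Q = 1 := by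
  choose f hf using redH_surj (p := p) hk
  let A₀ : Matrix (Fin n) (Fin n) (ZMod (p ^ k)) := A'.map f
  have hA₀ : (redH p k hk).mapMatrix A₀ = A' := by ext i j; simp [A₀, hf]
  have hT : ∀ X : Matrix (Fin n) (Fin n) (ZMod (p ^ k)),
      (redH p k hk).mapMatrix Xᵀ = ((redH p k hk).mapMatrix X)ᵀ := fun X => by
    ext i j; simp
  have hA₀u : IsUnit A₀.det := by
    rw [redH_unit_iff hk, RingHom.map_det, hA₀]; exact hA'u
  obtain ⟨C, hC, hC1⟩ := forms_congr hk hp2 (B₁ := A₀ᵀ * B * A₀) (B₂ := B)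
    (by rw [Matrix.IsSymm, Matrix.transpose_mul, Matrix.transpose_mul, Matrix.transpose_transpose,
          h1, Matrix.mul_assoc]) h1
    (by rw [Matrix.det_mul, Matrix.det_mul, Matrix.det_transpose]; exact (hA₀u.mul hu).mul hA₀u)
    (by rw [map_mul, map_mul, hT, hA₀, hA'])
  have hA₁ : (A₀ * C)ᵀ * B * (A₀ * C) = B := by
    conv_rhs => rw [← hC]
    rw [Matrix.transpose_mul]; simp only [Matrix.mul_assoc]
  have hA₁r : (redH p k hk).mapMatrix (A₀ * C) = A' := by rw [map_mul, hA₀, hC1, mul_one]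
  have hX := redH_mat_pow hk (Z := (A₀ * C) ^ Q) (by rw [map_pow, hA₁r, hA'r])
  rcases Nat.eq_zero_or_pos Q with rfl | hQ0
  · exact ⟨_, hA₁, hA₁r, by simp⟩
  have hcop : Nat.Coprime (p ^ k) Q := hQ.pow_left k
  obtain ⟨t, ht⟩ := Nat.exists_mul_mod_eq_of_coprime 1 hcop hQ0.ne'
  refine ⟨(A₀ * C) ^ (p ^ k * t), isom_pow hA₁ _, ?_, ?_⟩
  · rw [map_pow, hA₁r, ← pow_mod_orderOf]
    have h5 : orderOf A' ∣ Q := orderOf_dvd_of_pow_eq_one hA'r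
    have h6 : p ^ k * t % orderOf A' = 1 % orderOf A' := by
      have : p ^ k * t ≡ 1 [MOD Q] := ht.2
      exact this.of_dvd h5
    rw [h6, pow_mod_orderOf, pow_one]
  · rw [← pow_mul, mul_comm, mul_comm (p ^ k), ← mul_assoc, mul_comm Q t, mul_assoc, mul_comm t, pow_mul,
      pow_mul, hX, one_pow]

lemma nilp_red [Fact p.Prime] {q : ℕ} (hq : q.Prime) (hpq : p ≠ q) {n : ℕ}
    {U : Matrix (Fin n) (Fin n) (ZMod (p ^ k))} (hU : U ^ q = 1) (hU1 : U ≠ 1) (j : ℕ) :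
    ((redH p k hk).mapMatrix U - 1) ^ j ≠ 0 := by
  intro h
  apply hU1
  have h1 : IsNilpotent (U - 1) := by
    have h2 := redH_mat_nilp hk (X := (U - 1) ^ j) (by rw [map_pow, map_sub, map_one, h])
    obtain ⟨m, hm⟩ := h2
    exact ⟨j * m, by rw [pow_mul, hm]⟩
  obtain ⟨g, hg⟩ := X_sub_C_dvd_sub_C_eval (p := ∑ i ∈ Finset.range q, (X : ℤ[X]) ^ i) (a := 1)
  have h3 := congrArg (aeval U) hg
  have h4 : (∑ i ∈ Finset.range q, U ^ i) = q + (U - 1) * aeval U g := by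
    simp [eval_finsetSum] at h3
    rw [← h3]; abel
  have hcomm : Commute (U - 1) (aeval U g) := by
    have := Commute.map (Commute.all (X - 1 : ℤ[X]) g) (aeval U)
    simpa using this
  have hqu : IsUnit (q : Matrix (Fin n) (Fin n) (ZMod (p ^ k))) := by
    have h5 : IsUnit (q : ZMod (p ^ k)) := by
      rw [ZMod.isUnit_iff_coprime]
      exact (((Nat.coprime_primes hq Fact.out).2 hpq.symm)).pow_right k
    have := h5.map (algebraMap (ZMod (p ^ k)) (Matrix (Fin n) (Fin n) (ZMod (p ^ k))))
    simpa using this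
  have h6 : IsUnit (∑ i ∈ Finset.range q, U ^ i) := by
    rw [h4]
    exact (hcomm.isNilpotent_mul_right h1).isUnit_add_left_of_commute hqu
      (Nat.cast_commute q _).symm
  have h7 := geom_sum_mul U q
  rw [hU, sub_self] at h7
  exact sub_eq_zero.1 (h6.mul_right_eq_zero.1 h7)
end Lift

section Classify

/-- Congruence of bilinear forms. -/
def Cong {F ι κ : Type*} [Field F] [Fintype ι] [Fintype κ] [DecidableEq ι] [DecidableEq κ]
    (B : Matrix ι ι F) (C : Matrix κ κ F) : Prop :=
  ∃ (P : Matrix ι κ F) (Q : Matrix κ ι F), P * Q = 1 ∧ Q * P = 1 ∧ Pᵀ * B * P = C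

section
variable {F ι κ μ ν : Type*} [Field F] [Fintype ι] [Fintype κ] [DecidableEq ι] [DecidableEq κ]
  [Fintype μ] [DecidableEq μ] [Fintype ν] [DecidableEq ν]

lemma Cong.refl (B : Matrix ι ι F) : Cong B B := ⟨1, 1, by simp, by simp, by simp⟩

lemma Cong.symm {B : Matrix ι ι F} {C : Matrix κ κ F} (h : Cong B C) : Cong C B := by
  obtain ⟨P, Q, h1, h2, rfl⟩ := h
  refine ⟨Q, P, h2, h1, ?_⟩
  calc Qᵀ * (Pᵀ * B * P) * Q = (P * Q)ᵀ * B * (P * Q) := by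
        rw [Matrix.transpose_mul]; simp only [Matrix.mul_assoc]
    _ = B := by rw [h1]; simp

lemma Cong.trans {B : Matrix ι ι F} {C : Matrix κ κ F} {D : Matrix μ μ F}
    (h : Cong B C) (h' : Cong C D) : Cong B D := by
  obtain ⟨P, Q, h1, h2, rfl⟩ := h
  obtain ⟨P', Q', h1', h2', rfl⟩ := h'
  refine ⟨P * P', Q' * Q, ?_, ?_, ?_⟩
  · rw [Matrix.mul_assoc, ← Matrix.mul_assoc P', h1', Matrix.one_mul, h1]
  · rw [Matrix.mul_assoc, ← Matrix.mul_assoc Q, h2, Matrix.one_mul, h2']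
  · rw [Matrix.transpose_mul]; simp only [Matrix.mul_assoc]

lemma Cong.sum {B : Matrix ι ι F} {C : Matrix κ κ F} {B' : Matrix μ μ F} {C' : Matrix ν ν F}
    (h : Cong B C) (h' : Cong B' C') :
    Cong (Matrix.fromBlocks B 0 0 B') (Matrix.fromBlocks C 0 0 C') := by
  obtain ⟨P, Q, h1, h2, rfl⟩ := h
  obtain ⟨P', Q', h1', h2', rfl⟩ := h'
  refine ⟨Matrix.fromBlocks P 0 0 P', Matrix.fromBlocks Q 0 0 Q', ?_, ?_, ?_⟩
  · simp [Matrix.fromBlocks_multiply, h1, h1']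
  · simp [Matrix.fromBlocks_multiply, h2, h2']
  · simp [Matrix.fromBlocks_multiply, Matrix.fromBlocks_transpose]

lemma Cong.reindex (B : Matrix ι ι F) (e : κ ≃ ι) : Cong B (B.submatrix e e) := by
  refine ⟨(1 : Matrix ι ι F).submatrix id e, (1 : Matrix ι ι F).submatrix e id, ?_, ?_, ?_⟩
  · rw [Matrix.submatrix_mul_equiv]; simp
  · have := Matrix.submatrix_mul_equiv (1 : Matrix ι ι F) (1 : Matrix ι ι F) e (Equiv.refl ι) e
    simp only [Equiv.coe_refl] at this
    rw [this]; simp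
  · rw [Matrix.transpose_submatrix, Matrix.transpose_one]
    ext i j
    simp [Matrix.mul_apply, Matrix.one_apply]

lemma Cong.diag_reindex (w : ι → F) (e : κ ≃ ι) :
    Cong (Matrix.diagonal w) (Matrix.diagonal (w ∘ e)) := by
  have := Cong.reindex (Matrix.diagonal w) e
  rwa [Matrix.submatrix_diagonal_equiv] at this

lemma Cong.diag_sum {w : ι → F} {w' : κ → F} {v : μ → F} {v' : ν → F}
    (h : Cong (Matrix.diagonal w) (Matrix.diagonal w'))
    (h' : Cong (Matrix.diagonal v) (Matrix.diagonal v')) :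
    Cong (Matrix.diagonal (Sum.elim w v)) (Matrix.diagonal (Sum.elim w' v')) := by
  have := Cong.sum h h'
  rwa [Matrix.fromBlocks_diagonal, Matrix.fromBlocks_diagonal] at this

lemma Cong.of_sq {B C : Matrix ι ι F} (P : Matrix ι ι F) (hC : C.det ≠ 0)
    (h : Pᵀ * B * P = C) : Cong B C := by
  have hP : IsUnit P.det := by
    rw [isUnit_iff_ne_zero]
    rintro h0
    apply hC
    rw [← h, Matrix.det_mul, h0, mul_zero]
  exact ⟨P, P⁻¹, Matrix.mul_nonsing_inv _ hP, Matrix.nonsing_inv_mul _ hP, h⟩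

end

/-- one plus m. -/
noncomputable def e1 (m : ℕ) : Fin 1 ⊕ Fin m ≃ Fin (m + 1) :=
  Equiv.ofBijective (Sum.elim (fun _ => 0) Fin.succ) (by
    constructor
    · rintro (i | i) (j | j) h
      · congr 1; exact Subsingleton.elim _ _
      · exact absurd h.symm (Fin.succ_ne_zero j)
      · exact absurd h (Fin.succ_ne_zero i)
      · congr 1; exact Fin.succ_injective _ h
    · intro i
      refine Fin.cases ⟨Sum.inl 0, rfl⟩ (fun j => ⟨Sum.inr j, rfl⟩) i)

/-- two plus m. -/
noncomputable def e2 (m : ℕ) : Fin 2 ⊕ Fin m ≃ Fin (m + 2) :=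
  Equiv.ofBijective (Sum.elim ![0, 1] (fun i => i.succ.succ)) (by
    rw [Fintype.bijective_iff_surjective_and_card]
    refine ⟨?_, by simp [add_comm]⟩
    intro i
    refine Fin.cases ⟨Sum.inl 0, rfl⟩ (fun j => ?_) i
    refine Fin.cases ⟨Sum.inl 1, rfl⟩ (fun j => ⟨Sum.inr j, rfl⟩) j)

lemma Cong.two {F : Type*} [Field F] [Fintype F] (h2 : ringChar F ≠ 2) {a b : F} (ha : a ≠ 0)
    (hb : b ≠ 0) : Cong (Matrix.diagonal ![a, b]) (Matrix.diagonal ![a * b, 1]) := by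
  classical
  obtain ⟨x, y, hxy⟩ : ∃ x y : F, a * x ^ 2 + b * y ^ 2 = 1 := by
    obtain ⟨x, y, h⟩ := FiniteField.exists_root_sum_quadratic (R := F)
      (f := Polynomial.C a * Polynomial.X ^ 2) (g := Polynomial.C b * Polynomial.X ^ 2
        - Polynomial.C 1)
      (by rw [Polynomial.degree_C_mul_X_pow _ ha]; rfl)
      (by
        rw [Polynomial.degree_sub_C]
        · rw [Polynomial.degree_C_mul_X_pow _ hb]; rfl
        · rw [Polynomial.degree_C_mul_X_pow _ hb]; norm_num)
      (FiniteField.odd_card_of_char_ne_two h2)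
    refine ⟨x, y, ?_⟩
    simp at h
    linear_combination h
  apply Cong.of_sq !![-b * y, x; a * x, y]
  · simp [ha, hb]
  · ext i j
    fin_cases i <;> fin_cases j <;> simp [Matrix.mul_apply, Fin.sum_univ_two, Matrix.diagonal]
    · linear_combination (a * b) * hxy
    · ring
    · ring
    · linear_combination hxy

lemma Cong.diag_norm {F : Type*} [Field F] [Fintype F] (h2 : ringChar F ≠ 2) (m : ℕ) :
    ∀ w : Fin (m + 1) → F, (∀ i, w i ≠ 0) →
      Cong (Matrix.diagonal w) (Matrix.diagonal (Fin.cons (∏ i, w i) 1 : Fin (m + 1) → F)) := by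
  induction m with
  | zero =>
    intro w hw
    have : w = (Fin.cons (∏ i, w i) 1 : Fin (0 + 1) → F) := by
      ext i
      fin_cases i
      simp
    rw [← this]
    exact Cong.refl _
  | succ m ih =>
    intro w hw
    set w' : Fin (m + 1) → F := fun i => w i.succ with hw'
    set δ := ∏ i, w' i with hδ
    have hδ0 : δ ≠ 0 := Finset.prod_ne_zero_iff.2 fun i _ => hw _
    have a1 := Cong.diag_reindex w (e1 (m + 1))
    have q1 : w ∘ (e1 (m + 1)) = Sum.elim (fun _ => w 0) w' := by
      ext (i | i) <;> rfl
    rw [q1] at a1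
    have a2 := Cong.diag_sum (Cong.refl (Matrix.diagonal (fun _ : Fin 1 => w 0)))
      (ih w' fun i => hw _)
    have a3 := Cong.diag_reindex (Fin.cons (w 0) (Fin.cons δ 1 : Fin (m + 1) → F) :
      Fin (m + 2) → F) (e1 (m + 1))
    have q3 : (Fin.cons (w 0) (Fin.cons δ 1 : Fin (m + 1) → F) :
      Fin (m + 2) → F) ∘ (e1 (m + 1)) = Sum.elim (fun _ => w 0) (Fin.cons δ 1) := by
      ext (i | i) <;> rfl
    rw [q3] at a3
    have a4 := Cong.diag_reindex (Fin.cons (w 0) (Fin.cons δ 1 : Fin (m + 1) → F) :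
      Fin (m + 2) → F) (e2 m)
    have q4 : (Fin.cons (w 0) (Fin.cons δ 1 : Fin (m + 1) → F) :
      Fin (m + 2) → F) ∘ (e2 m) = Sum.elim ![w 0, δ] 1 := by
      ext (i | i)
      · fin_cases i <;> rfl
      · rfl
    rw [q4] at a4
    have a5 := Cong.diag_sum (Cong.two h2 (hw 0) hδ0) (Cong.refl (Matrix.diagonal (1 : Fin m → F)))
    have a6 := Cong.diag_reindex (Fin.cons (w 0 * δ) (1 : Fin (m + 1) → F) : Fin (m + 2) → F) (e2 m)
    have q6 : (Fin.cons (w 0 * δ) (1 : Fin (m + 1) → F) :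
      Fin (m + 2) → F) ∘ (e2 m) = Sum.elim ![w 0 * δ, 1] 1 := by
      ext (i | i)
      · fin_cases i <;> rfl
      · rfl
    rw [q6] at a6
    rw [Fin.prod_univ_succ]
    exact a1.trans (a2.trans (a3.symm.trans (a4.trans (a5.trans a6.symm))))

lemma Cong.diagonalize {F : Type*} [Field F] [Fintype F] (h2 : ringChar F ≠ 2) {n : ℕ}
    {B : Matrix (Fin n) (Fin n) F} (hB : B.IsSymm) :
    ∃ w : Fin n → F, ∃ P : Matrix (Fin n) (Fin n) F, IsUnit P.det ∧
      Pᵀ * B * P = Matrix.diagonal w := by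
  have : Invertible (2 : F) := invertibleOfNonzero (Ring.two_ne_zero h2)
  obtain ⟨v, hv⟩ := LinearMap.BilinForm.exists_orthogonal_basis
    (B := Matrix.toBilin' B) (by
      constructor
      intro x y
      simp [Matrix.toBilin'_apply']
      rw [dotProduct_comm, Matrix.dotProduct_mulVec, ← Matrix.mulVec_transpose, hB.eq])
  have hfr : Module.finrank F (Fin n → F) = n := by simp
  set b := v.reindex (finCongr hfr) with hb
  refine ⟨fun i => Matrix.toBilin' B (b i) (b i), (Pi.basisFun F (Fin n)).toMatrix b, ?_, ?_⟩
  · rw [← Matrix.isUnit_iff_isUnit_det]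
    exact IsUnit.of_mul_eq_one _ ((Pi.basisFun F (Fin n)).toMatrix_mul_toMatrix_flip b)
  · have h3 := LinearMap.BilinForm.toMatrix_mul_basis_toMatrix (b := Pi.basisFun F (Fin n))
      b (Matrix.toBilin' B)
    rw [LinearMap.BilinForm.toMatrix_basisFun, LinearMap.BilinForm.toMatrix'_toBilin'] at h3
    rw [h3]
    ext i j
    rw [LinearMap.BilinForm.toMatrix_apply]
    by_cases hij : i = j
    · subst hij; rw [Matrix.diagonal_apply_eq]
    · rw [Matrix.diagonal_apply_ne _ hij, hb, Module.Basis.reindex_apply, Module.Basis.reindex_apply]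
      exact hv (fun h => hij ((finCongr hfr).symm.injective h))

lemma class_forms {F : Type*} [Field F] [Fintype F] (h2 : ringChar F ≠ 2) {n : ℕ}
    {B B' : Matrix (Fin n) (Fin n) F} (hB : B.IsSymm) (hB' : B'.IsSymm) (h0 : B.det ≠ 0)
    (h0' : B'.det ≠ 0) (hsq : IsSquare (B.det * B'.det)) : Cong B B' := by
  rcases n with _ | m
  · rw [Subsingleton.elim B B']; exact Cong.refl _
  have key : ∀ C : Matrix (Fin (m + 1)) (Fin (m + 1)) F, C.IsSymm → C.det ≠ 0 →
      ∃ c : F, c ≠ 0 ∧ Cong C (Matrix.diagonal (Fin.cons (C.det * c ^ 2) 1 : Fin (m + 1) → F)) := by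
    intro C hC hC0
    obtain ⟨w, P, hP, hw⟩ := Cong.diagonalize h2 hC
    have hd := congrArg Matrix.det hw
    rw [Matrix.det_mul, Matrix.det_mul, Matrix.det_transpose, Matrix.det_diagonal] at hd
    have hn0 : ∏ i, w i ≠ 0 := by
      rw [← hd]; exact mul_ne_zero (mul_ne_zero hP.ne_zero hC0) hP.ne_zero
    refine ⟨P.det, hP.ne_zero, ?_⟩
    have h1 : Cong C (Matrix.diagonal w) := Cong.of_sq P (by rwa [Matrix.det_diagonal]) hw
    have h3 := Cong.diag_norm h2 m w fun i hi =>
      hn0 (Finset.prod_eq_zero (Finset.mem_univ i) hi)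
    rw [show C.det * P.det ^ 2 = ∏ i, w i by rw [← hd]; ring]
    exact h1.trans h3
  obtain ⟨c, hc, h3⟩ := key B hB h0
  obtain ⟨c', hc', h4⟩ := key B' hB' h0'
  refine h3.trans (Cong.trans ?_ h4.symm)
  obtain ⟨t, ht⟩ := hsq
  apply Cong.of_sq (Matrix.diagonal (Fin.cons (t * c' / (B.det * c)) 1 : Fin (m + 1) → F))
  · simp [Matrix.det_diagonal, Fin.prod_univ_succ, h0', hc']
  · rw [Matrix.diagonal_transpose, Matrix.diagonal_mul_diagonal, Matrix.diagonal_mul_diagonal]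
    congr 1
    ext i
    refine Fin.cases ?_ (fun j => ?_) i
    · simp only [Fin.cons_zero]
      field_simp
      linear_combination (-1 : F) * ht
    · simp
end Classify

section Model

/-- A fixed point free isometry of a nondegenerate symmetric form. -/
def IsModel {F ι : Type*} [Field F] [Fintype ι] [DecidableEq ι] (A B : Matrix ι ι F) : Prop :=
  B.IsSymm ∧ IsUnit B ∧ Aᵀ * B * A = B ∧ IsUnit (A - 1)

lemma restrict_model {F U J : Type*} [Field F] [Field U] [Algebra F U] [FiniteDimensional F U]
    [Algebra.IsSeparable F U] [Fintype J] [DecidableEq J] {m : ℕ}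
    (hm : Module.finrank F U = m) {A B : Matrix J J U} (h : IsModel A B) :
    ∃ A' B' : Matrix (J × Fin m) (J × Fin m) F, IsModel A' B' ∧ orderOf A' = orderOf A := by
  classical
  let b : Module.Basis (Fin m) F U := Module.finBasisOfFinrankEq F U hm
  let L := Algebra.leftMulMatrix b
  let Z := Algebra.traceMatrix F b
  have hLZ : ∀ u, (L u)ᵀ * Z = Z * L u := by
    have h1 : ∀ u i j, (Z * L u) i j = Algebra.trace F U (b i * (u * b j)) := by
      intro u i j
      rw [Matrix.mul_apply]
      conv_rhs => rw [← b.sum_repr (u * b j), Finset.mul_sum, map_sum]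
      refine Finset.sum_congr rfl fun k _ => ?_
      simp only [Z, L]
      rw [Algebra.traceMatrix_apply, Algebra.traceForm_apply, Algebra.leftMulMatrix_eq_repr_mul,
        mul_smul_comm, map_smul, smul_eq_mul, mul_comm]
    intro u
    ext i j
    have hZ : Zᵀ = Z := by
      ext i j
      simp only [Z, Matrix.transpose_apply, Algebra.traceMatrix_apply, Algebra.traceForm_apply]
      rw [mul_comm]
    have : ((L u)ᵀ * Z) = (Z * L u)ᵀ := by rw [Matrix.transpose_mul, hZ]
    rw [this, Matrix.transpose_apply, h1, h1]
    congr 1; ring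
  have hZs : Zᵀ = Z := by
    ext i j
    simp only [Z, Matrix.transpose_apply, Algebra.traceMatrix_apply, Algebra.traceForm_apply]
    rw [mul_comm]
  have hZu : IsUnit Z.det := by
    rw [isUnit_iff_ne_zero]
    exact Algebra.discr_not_zero_of_basis F b
  let Φ : Matrix J J U →+* Matrix (J × Fin m) (J × Fin m) F :=
    ((Matrix.compRingEquiv J (Fin m) F).toRingHom).comp (L.toRingHom.mapMatrix)
  have hΦ : ∀ M a i c j, Φ M (a, i) (c, j) = L (M a c) i j := fun M a i c j => rfl
  let T : Matrix (J × Fin m) (J × Fin m) F :=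
    Matrix.compRingEquiv J (Fin m) F (Matrix.diagonal fun _ => Z)
  have hT : ∀ a i c j, T (a, i) (c, j) = if a = c then Z i j else 0 := by
    intro a i c j
    change (Matrix.diagonal (fun _ => Z) a c) i j = _
    rw [Matrix.diagonal_apply]
    split_ifs <;> rfl
  have hTu : IsUnit T := by
    apply IsUnit.map
    refine IsUnit.of_mul_eq_one (Matrix.diagonal fun _ => Z⁻¹) ?_
    rw [Matrix.diagonal_mul_diagonal, ← Matrix.diagonal_one]
    congr 1
    ext1 i
    rw [Matrix.mul_nonsing_inv _ hZu]
  have hTs : Tᵀ = T := by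
    ext ⟨a, i⟩ ⟨c, j⟩
    rw [Matrix.transpose_apply, hT, hT]
    have : Z j i = Z i j := congrFun (congrFun hZs i) j
    simp only [eq_comm, this]
  have hΦT : ∀ M, (Φ M)ᵀ * T = T * Φ Mᵀ := by
    intro M
    ext ⟨a, i⟩ ⟨c, j⟩
    have := congrFun (congrFun (hLZ (M c a)) i) j
    rw [Matrix.mul_apply, Matrix.mul_apply] at this
    rw [Matrix.mul_apply, Matrix.mul_apply, Fintype.sum_prod_type, Fintype.sum_prod_type]
    simp only [hT, hΦ, Matrix.transpose_apply, mul_ite, ite_mul, mul_zero, zero_mul]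
    rw [Finset.sum_eq_single c (by intro x _ hx; simp [hx]) (by simp),
      Finset.sum_eq_single a (by intro x _ hx; simp [hx.symm]) (by simp)]
    simpa using this
  have hinj : Function.Injective Φ := by
    intro M N hMN
    ext a c
    apply Algebra.leftMulMatrix_injective b
    ext i j
    have := congrFun (congrFun hMN (a, i)) (c, j)
    rwa [hΦ, hΦ] at this
  obtain ⟨hs, hu, hi, hf⟩ := h
  refine ⟨Φ A, T * Φ B, ⟨?_, hTu.mul (hu.map Φ), ?_, ?_⟩, ?_⟩
  · rw [Matrix.IsSymm, Matrix.transpose_mul, hTs, hΦT, hs.eq]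
  · rw [← Matrix.mul_assoc, hΦT, Matrix.mul_assoc, Matrix.mul_assoc, ← map_mul, ← map_mul,
      ← Matrix.mul_assoc, hi]
  · rw [← map_one Φ, ← map_sub]; exact hf.map Φ
  · exact orderOf_injective Φ.toMonoidHom hinj A

lemma model_sum {F ι κ : Type*} [Field F] [Fintype ι] [DecidableEq ι] [Fintype κ] [DecidableEq κ]
    {A B : Matrix ι ι F} {A' B' : Matrix κ κ F} (h : IsModel A B) (h' : IsModel A' B') :
    IsModel (Matrix.fromBlocks A 0 0 A') (Matrix.fromBlocks B 0 0 B') := by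
  obtain ⟨hs, hu, hi, hf⟩ := h
  obtain ⟨hs', hu', hi', hf'⟩ := h'
  refine ⟨?_, ?_, ?_, ?_⟩
  · rw [Matrix.IsSymm, Matrix.fromBlocks_transpose, hs.eq, hs'.eq]; simp
  · rw [Matrix.isUnit_fromBlocks_zero₁₂]; exact ⟨hu, hu'⟩
  · simp [Matrix.fromBlocks_multiply, Matrix.fromBlocks_transpose, hi, hi']
  · have h1 : Matrix.fromBlocks A 0 0 A' - 1 = Matrix.fromBlocks (A - 1) 0 0 (A' - 1) := by
      rw [← Matrix.fromBlocks_one]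
      ext (i | i) (j | j) <;> simp [Matrix.one_apply]
    rw [h1, Matrix.isUnit_fromBlocks_zero₁₂]; exact ⟨hf, hf'⟩

lemma fromBlocks_diag_pow {F ι κ : Type*} [Field F] [Fintype ι] [DecidableEq ι] [Fintype κ]
    [DecidableEq κ] (A : Matrix ι ι F) (A' : Matrix κ κ F) (j : ℕ) :
    (Matrix.fromBlocks A 0 0 A') ^ j = Matrix.fromBlocks (A ^ j) 0 0 (A' ^ j) := by
  induction j with
  | zero => simp
  | succ j ih => rw [pow_succ, ih, Matrix.fromBlocks_multiply]; simp [pow_succ]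

lemma model_copies {F ι : Type*} [Field F] [Fintype ι] [DecidableEq ι]
    {A B : Matrix ι ι F} (h : IsModel A B) (t : ℕ) :
    IsModel (Matrix.blockDiagonal fun _ : Fin t => A) (Matrix.blockDiagonal fun _ : Fin t => B) := by
  obtain ⟨hs, hu, hi, hf⟩ := h
  refine ⟨?_, ?_, ?_, ?_⟩
  · rw [Matrix.IsSymm, Matrix.blockDiagonal_transpose, hs.eq]
  · rw [Matrix.isUnit_iff_isUnit_det, Matrix.det_blockDiagonal]
    simp only [Finset.prod_const]
    exact ((Matrix.isUnit_iff_isUnit_det _).1 hu).pow _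
  · rw [Matrix.blockDiagonal_transpose, ← Matrix.blockDiagonal_mul, ← Matrix.blockDiagonal_mul]
    simp only [hi]
  · rw [← Matrix.blockDiagonal_one, ← Matrix.blockDiagonal_sub, Matrix.isUnit_iff_isUnit_det,
      Matrix.det_blockDiagonal]
    simp only [Pi.sub_apply, Pi.one_apply, Finset.prod_const]
    exact ((Matrix.isUnit_iff_isUnit_det _).1 hf).pow _

lemma model_reindex {F ι κ : Type*} [Field F] [Fintype ι] [DecidableEq ι] [Fintype κ]
    [DecidableEq κ] {A B : Matrix ι ι F} (h : IsModel A B) (e : ι ≃ κ) :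
    IsModel (Matrix.reindexAlgEquiv F F e A) (Matrix.reindexAlgEquiv F F e B) := by
  obtain ⟨hs, hu, hi, hf⟩ := h
  have hT : ∀ M : Matrix ι ι F,
    (Matrix.reindexAlgEquiv F F e M)ᵀ = Matrix.reindexAlgEquiv F F e Mᵀ := fun M => rfl
  refine ⟨?_, hu.map _, ?_, ?_⟩
  · rw [Matrix.IsSymm, hT, hs.eq]
  · rw [hT, ← map_mul, ← map_mul, hi]
  · rw [← map_one (Matrix.reindexAlgEquiv F F e), ← map_sub]; exact hf.map _

lemma rank_two {U K : Type*} [Field U] [Field K] (f : U →+* K) {l : K} (hl0 : l ≠ 0)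
    (hl : l - l⁻¹ ≠ 0) {μ : U} (hμ : f μ = l + l⁻¹) :
    ∃ A B : Matrix (Fin 2) (Fin 2) U, IsModel A B ∧ orderOf A = orderOf l := by
  have hinj : Function.Injective f := f.injective
  have hl1 : l ≠ 1 := by rintro rfl; simp at hl
  refine ⟨!![0, -1; 1, μ], !![2, μ; μ, 2], ⟨?_, ?_, ?_, ?_⟩, ?_⟩
  · ext i j; fin_cases i <;> fin_cases j <;> rfl
  · rw [Matrix.isUnit_iff_isUnit_det, Matrix.det_fin_two_of, isUnit_iff_ne_zero]
    intro h
    have h1 := congrArg f h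
    simp only [map_sub, map_mul, map_ofNat, hμ, map_zero] at h1
    have h2 : (l - l⁻¹) ^ 2 = 0 := by
      have : l * l⁻¹ = 1 := mul_inv_cancel₀ hl0
      linear_combination -h1 - 4 * this
    exact hl (pow_eq_zero_iff (by norm_num) |>.1 h2)
  · ext i j
    fin_cases i <;> fin_cases j <;> simp [Matrix.mul_apply, Fin.sum_univ_two] <;> ring
  · have : (!![0, -1; 1, μ] - 1 : Matrix (Fin 2) (Fin 2) U) = !![-1, -1; 1, μ - 1] := by
      ext i j
      fin_cases i <;> fin_cases j <;> simp
    rw [this, Matrix.isUnit_iff_isUnit_det, Matrix.det_fin_two_of, isUnit_iff_ne_zero]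
    intro h
    have h1 := congrArg f h
    simp only [map_sub, map_mul, map_neg, map_one, hμ, map_zero] at h1
    have h2 : (l - 1) ^ 2 = 0 := by
      have : l * l⁻¹ = 1 := mul_inv_cancel₀ hl0
      linear_combination -l * h1 - this
    exact hl1 (sub_eq_zero.1 (pow_eq_zero_iff (by norm_num) |>.1 h2))
  · rw [orderOf_eq_orderOf_iff]
    intro j
    have hAf : f.mapMatrix !![0, -1; 1, μ] = !![0, -1; 1, l + l⁻¹] := by
      ext i j
      fin_cases i <;> fin_cases j <;> simp [hμ]
    have hf2 : Function.Injective (f.mapMatrix (m := Fin 2)) := by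
      intro M N hMN
      ext a c
      exact hinj (congrFun (congrFun hMN a) c)
    have e1 : (!![0, -1; 1, μ] : Matrix (Fin 2) (Fin 2) U) ^ j = 1 ↔
        (!![0, -1; 1, l + l⁻¹] : Matrix (Fin 2) (Fin 2) K) ^ j = 1 := by
      rw [← hAf, ← hf2.eq_iff, map_pow, map_one]
    rw [e1]
    set V : Matrix (Fin 2) (Fin 2) K := !![1, 1; -l, -l⁻¹] with hV
    have hVu : IsUnit V := by
      rw [Matrix.isUnit_iff_isUnit_det, hV, Matrix.det_fin_two_of, isUnit_iff_ne_zero]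
      intro h; apply hl; linear_combination h
    have h1 : (!![0, -1; 1, l + l⁻¹] : Matrix (Fin 2) (Fin 2) K) * V =
        V * Matrix.diagonal ![l, l⁻¹] := by
      have : l * l⁻¹ = 1 := mul_inv_cancel₀ hl0
      ext i j
      fin_cases i <;> fin_cases j <;>
        simp [hV, Matrix.mul_apply, Fin.sum_univ_two, Matrix.diagonal]
      · linear_combination -this
      · linear_combination -this
    have h2 : ∀ j, (!![0, -1; 1, l + l⁻¹] : Matrix (Fin 2) (Fin 2) K) ^ j * V =
        V * Matrix.diagonal ![l, l⁻¹] ^ j := fun j =>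
      ((show SemiconjBy V (Matrix.diagonal ![l, l⁻¹]) _ from h1.symm).pow_right j).symm
    have h3 := h2 j
    rw [Matrix.diagonal_pow] at h3
    constructor
    · intro h
      rw [h, one_mul] at h3
      have h4 : Matrix.diagonal (![l, l⁻¹] ^ j) = (1 : Matrix (Fin 2) (Fin 2) K) :=
        hVu.mul_left_cancel (by rw [← h3, mul_one])
      have := congrFun (congrFun h4 0) 0
      simpa using this
    · intro h
      have h5 : Matrix.diagonal (![l, l⁻¹] ^ j) = (1 : Matrix (Fin 2) (Fin 2) K) := by
        ext a c
        fin_cases a <;> fin_cases c <;> simp [h]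
      rw [h5, mul_one] at h3
      exact hVu.mul_right_cancel (by rw [h3, one_mul])

lemma block_model {p q s : ℕ} [Fact p.Prime] (hp : p.Prime) (hq : q.Prime)
    (hq2 : q ≠ 2) (hpq : p ≠ q)
    (hs : q ^ s ∣ p ^ (2 * minExp p q) - 1)
    (hs' : ¬ q ^ (s + 1) ∣ p ^ (2 * minExp p q) - 1) {i : ℕ} (hi : 1 ≤ i) :
    ∃ A B : Matrix (Fin 2 × Fin (minExp p q * q ^ (i - s)))
      (Fin 2 × Fin (minExp p q * q ^ (i - s))) (ZMod p), IsModel A B ∧ orderOf A = q ^ i := by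
  let K := AlgebraicClosure (ZMod p)
  have : CharP K p := charP_of_injective_algebraMap (algebraMap (ZMod p) K).injective p
  have : ExpChar K p := ExpChar.prime hp
  have hqi : 0 < q ^ i := pow_pos hq.pos i
  have hq0 : NeZero ((q ^ i : ℕ) : K) := ⟨by
    rw [Ne, CharP.cast_eq_zero_iff K p]
    intro h
    exact hpq ((Nat.prime_dvd_prime_iff_eq hp hq).1 (hp.dvd_of_dvd_pow h))⟩
  obtain ⟨l, hl⟩ := IsAlgClosed.exists_root (Polynomial.cyclotomic (q ^ i) K)
    (Polynomial.degree_cyclotomic_pos _ _ hqi).ne'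
  have hlp := (Polynomial.isRoot_cyclotomic_iff).1 hl
  have hlo : orderOf l = q ^ i := hlp.eq_orderOf.symm
  obtain ⟨h1, h2, -⟩ := orb_key hp hq hq2 hpq hs hs' hi hlo
  set m := minExp p q * q ^ (i - s) with hm
  have hm0 : m ≠ 0 := (Nat.mul_pos (minExp_spec hp hq hpq).1 (pow_pos hq.pos _)).ne'
  have hl0 : l ≠ 0 := hlp.ne_zero hqi.ne'
  have hμ : (l + l⁻¹) ^ p ^ m = l + l⁻¹ := by
    rw [add_pow_char_pow, inv_pow, h1]
    rcases eta_eq p q with h | h <;> rw [h]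
    · simp
    · rw [_root_.zpow_neg_one, inv_inv, add_comm]
  let U := GaloisField p m
  have : Fintype U := Fintype.ofFinite U
  let f : U →+* K := (IsAlgClosed.lift : U →ₐ[ZMod p] K).toRingHom
  have hc : Fintype.card U = p ^ m := by
    rw [← Nat.card_eq_fintype_card]; exact GaloisField.card p m hm0
  obtain ⟨μ, hfμ⟩ := mem_range_of_pow_card f (x := l + l⁻¹) (by rw [hc, hμ])
  obtain ⟨A, B, hAB, hA⟩ := rank_two f hl0 h2 hfμ
  obtain ⟨A', B', hAB', hA'⟩ := restrict_model (F := ZMod p) (GaloisField.finrank p hm0) hAB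
  exact ⟨A', B', hAB', by rw [hA', hA, hlo]⟩

lemma full_model {p q s r : ℕ} [Fact p.Prime] (hp : p.Prime) (hq : q.Prime)
    (hq2 : q ≠ 2) (hpq : p ≠ q)
    (hs : q ^ s ∣ p ^ (2 * minExp p q) - 1)
    (hs' : ¬ q ^ (s + 1) ∣ p ^ (2 * minExp p q) - 1) (hr : 1 ≤ r) {n d : ℕ}
    (hd : q ^ (r - s) ≤ d) (hn : n = 2 * minExp p q * d) :
    ∃ A B : Matrix (Fin n) (Fin n) (ZMod p), IsModel A B ∧ orderOf A = q ^ r := by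
  obtain ⟨A₁, B₁, h1, ho1⟩ := block_model hp hq hq2 hpq hs hs' hr
  obtain ⟨A₂, B₂, h2, ho2⟩ := block_model hp hq hq2 hpq hs hs' le_rfl
  have h3 := model_sum h1 (model_copies h2 (d - q ^ (r - s)))
  set A := Matrix.fromBlocks A₁ 0 0 (Matrix.blockDiagonal fun _ : Fin (d - q ^ (r - s)) => A₂)
    with hA
  have hA2 : A₂ ^ q ^ r = 1 := by
    apply orderOf_dvd_iff_pow_eq_one.1
    rw [ho2]; exact pow_dvd_pow q hr
  have hpow : ∀ j, A ^ j = Matrix.fromBlocks (A₁ ^ j) 0 0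
      (Matrix.blockDiagonal fun _ : Fin (d - q ^ (r - s)) => A₂ ^ j) := by
    intro j
    rw [hA, fromBlocks_diag_pow, ← Matrix.blockDiagonal_pow]
    rfl
  have hord : orderOf A = q ^ r := by
    apply Nat.dvd_antisymm
    · apply orderOf_dvd_of_pow_eq_one
      rw [hpow, hA2, ← ho1, pow_orderOf_eq_one]
      have : (Matrix.blockDiagonal fun _ : Fin (d - q ^ (r - s)) => (1 : Matrix (Fin 2 × Fin (minExp p q * q ^ (1 - s)))
      (Fin 2 × Fin (minExp p q * q ^ (1 - s))) (ZMod p))) = 1 := Matrix.blockDiagonal_one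
      rw [this, Matrix.fromBlocks_one]
    · rw [← ho1]
      apply orderOf_dvd_of_pow_eq_one
      have h4 := pow_orderOf_eq_one A
      rw [hpow, ← Matrix.fromBlocks_one, Matrix.fromBlocks_inj] at h4
      exact h4.1
  have hcard : Fintype.card ((Fin 2 × Fin (minExp p q * q ^ (r - s))) ⊕
      ((Fin 2 × Fin (minExp p q * q ^ (1 - s))) × Fin (d - q ^ (r - s)))) = Fintype.card (Fin n) := by
    have : 1 - s = 0 := by have := s_pos hp hq hpq hs'; omega
    simp only [Fintype.card_sum, Fintype.card_prod, Fintype.card_fin, this, pow_zero]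
    obtain ⟨t, rfl⟩ := Nat.exists_eq_add_of_le hd
    rw [hn, Nat.add_sub_cancel_left]; ring
  let e := Fintype.equivOfCardEq hcard
  refine ⟨_, _, model_reindex h3 e, ?_⟩
  rw [← hord]
  exact orderOf_injective (Matrix.reindexAlgEquiv (ZMod p) (ZMod p) e).toRingEquiv.toRingHom.toMonoidHom
    (Matrix.reindexAlgEquiv (ZMod p) (ZMod p) e).injective A
end Model

lemma epsilon_red {p k : ℕ} [Fact p.Prime] (hk : 1 ≤ k) (hp2 : p ≠ 2) {n : ℕ}
    {B : Matrix (Fin n) (Fin n) (ZMod (p ^ k))} (hdet : IsUnit B.det) :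
    epsilon p B = epsilon p ((redH p k hk).mapMatrix B) := by
  unfold epsilon
  rw [← RingHom.map_det]
  congr 1
  by_cases h : IsSquare B.det
  · rw [if_pos h, if_pos ((redH_square hk hp2 hdet).1 h)]
  · rw [if_neg h, if_neg (fun h' => h ((redH_square hk hp2 hdet).2 h'))]

lemma redH_transpose {p k : ℕ} (hk : 1 ≤ k) {n : ℕ} (X : Matrix (Fin n) (Fin n) (ZMod (p ^ k))) :
    (redH p k hk).mapMatrix Xᵀ = ((redH p k hk).mapMatrix X)ᵀ := by
  ext i j; simp

theorem stmt1 (p q : ℕ) (hp : p.Prime) (hq : q.Prime) (hp2 : p ≠ 2) (hq2 : q ≠ 2)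
    (hpq : p ≠ q) (k : ℕ) (hk : 1 ≤ k) (n : ℕ) (hn : 1 ≤ n)
    (B : Matrix (Fin n) (Fin n) (ZMod (p ^ k))) (hsymm : B.IsSymm) (hdet : IsUnit B.det)
    (s : ℕ) (hs : q ^ s ∣ p ^ (2 * minExp p q) - 1)
    (hs' : ¬ q ^ (s + 1) ∣ p ^ (2 * minExp p q) - 1)
    (r : ℕ) (hr : 1 ≤ r) :
    (∃ A : Matrix (Fin n) (Fin n) (ZMod (p ^ k)), Aᵀ * B * A = B ∧ orderOf A = q ^ r ∧
        ∀ x : Fin n → ZMod (p ^ k), A.mulVec x = x → x = 0) ↔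
      (∃ d : ℕ, q ^ (r - s) ≤ d ∧ n = 2 * minExp p q * d ∧ epsilon p B = eta p q ^ d) := by
  have : Fact p.Prime := ⟨hp⟩
  have : NeZero (p ^ k) := ⟨(pow_pos hp.pos k).ne'⟩
  have hqr : q ^ r = q ^ (r - 1) * q := by rw [← pow_succ, Nat.sub_add_cancel hr]
  have hlt : q ^ (r - 1) < q ^ r := Nat.pow_lt_pow_right hq.one_lt (by omega)
  set ρ := (redH p k hk).mapMatrix (m := Fin n) with hρ
  have hBs : (ρ B).IsSymm := by
    rw [Matrix.IsSymm, hρ, ← redH_transpose, hsymm.eq]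
  have hBd : (ρ B).det ≠ 0 := by
    rw [hρ, ← RingHom.map_det]; exact (redH_unit_iff hk).1 hdet
  rw [epsilon_red hk hp2 hdet]
  constructor
  · rintro ⟨A, hA, hord, hfix⟩
    have hApow : A ^ q ^ r = 1 := by rw [← hord]; exact pow_orderOf_eq_one A
    have hunit : IsUnit (A - 1).det := by
      rw [← Matrix.isUnit_iff_isUnit_det]
      rw [← Matrix.mulVec_surjective_iff_isUnit]
      apply Finite.surjective_of_injective
      intro x y hxy
      have h1 : (A - 1).mulVec (x - y) = 0 := by rw [Matrix.mulVec_sub, sub_eq_zero]; exact hxy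
      rw [Matrix.sub_mulVec, Matrix.one_mulVec, sub_eq_zero] at h1
      exact sub_eq_zero.1 (hfix _ h1)
    refine field_main (A := ρ A) hp hq hp2 hq2 hpq hs hs' hr hBs hBd ?_ ?_ ?_ ?_
    · rw [hρ, ← redH_transpose, ← map_mul, ← map_mul, hA]
    · rw [← map_pow, hApow, map_one]
    · rw [← map_one ρ, ← map_sub, hρ, ← RingHom.map_det]
      exact (redH_unit_iff hk).1 hunit
    · rw [← map_pow]
      apply nilp_red hk hq hpq
      · rw [← pow_mul, ← hqr, hApow]
      · exact pow_ne_one_of_lt_orderOf (pow_pos hq.pos _).ne' (by rw [hord]; exact hlt)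
  · rintro ⟨d, hd, hnd, hε⟩
    obtain ⟨A', B', ⟨hs1, hu1, hi1, hf1⟩, ho1⟩ := full_model hp hq hq2 hpq hs hs' hr hd hnd
    have hA'pow : A' ^ q ^ r = 1 := by rw [← ho1]; exact pow_orderOf_eq_one A'
    have hB'd : B'.det ≠ 0 := ((Matrix.isUnit_iff_isUnit_det _).1 hu1).ne_zero
    have hA'u : IsUnit A' := IsUnit.of_pow_eq_one hA'pow (pow_pos hq.pos r).ne'
    have hnil : (A' ^ q ^ (r - 1) - 1) ^ n ≠ 0 := by
      have hne : A' ^ q ^ (r - 1) ≠ 1 :=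
        pow_ne_one_of_lt_orderOf (pow_pos hq.pos _).ne' (by rw [ho1]; exact hlt)
      intro h0
      have : Nonempty (Fin n) := ⟨⟨0, hn⟩⟩
      have hcp : CharP (Matrix (Fin n) (Fin n) (ZMod p)) p := inferInstance
      have : ExpChar (Matrix (Fin n) (Fin n) (ZMod p)) p := ExpChar.prime hp
      have h1 := sub_pow_expChar_pow_of_commute (p := p) (n := n)
        (Commute.one_right (A' ^ q ^ (r - 1)))
      rw [pow_eq_zero_of_le (Nat.lt_pow_self hp.one_lt).le h0, one_pow] at h1
      have h2 : (A' ^ q ^ (r - 1)) ^ p ^ n = 1 := (sub_eq_zero.1 h1.symm)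
      have h3 : (A' ^ q ^ (r - 1)) ^ q = 1 := by rw [← pow_mul, ← hqr, hA'pow]
      have h4 := Nat.dvd_gcd (orderOf_dvd_of_pow_eq_one h2) (orderOf_dvd_of_pow_eq_one h3)
      rw [Nat.Coprime.gcd_eq_one (((Nat.coprime_primes hp hq).2 hpq).pow_left n),
        Nat.dvd_one, orderOf_eq_one_iff] at h4
      exact hne h4
    obtain ⟨d', -, hnd', hε'⟩ := field_main hp hq hp2 hq2 hpq hs hs' hr hs1 hB'd hi1 hA'pow
      ((Matrix.isUnit_iff_isUnit_det _).1 hf1).ne_zero hnil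
    have hdd : d' = d := by
      have h1 := (minExp_spec hp hq hpq).1
      exact Nat.eq_of_mul_eq_mul_left (by positivity : 0 < 2 * minExp p q) (hnd'.symm.trans hnd)
    subst hdd
    have hchar : ringChar (ZMod p) ≠ 2 := by rwa [ZMod.ringChar_zmod_n]
    have hsq : IsSquare (B'.det * (ρ B).det) := by
      have h1 : n = 2 * (minExp p q * d') := by rw [hnd]; ring
      rw [epsilon_eq hBd h1] at hε
      rw [epsilon_eq hB'd h1] at hε'
      have h2 := hε'.trans hε.symm
      rw [map_mul, map_mul] at h2
      have h3 : quadraticChar (ZMod p) ((-1) ^ (minExp p q * d')) ≠ 0 := by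
        rw [Ne, quadraticChar_eq_zero_iff]; exact pow_ne_zero _ (by simp)
      have h4 := mul_right_cancel₀ h3 h2
      rw [← quadraticChar_one_iff_isSquare (mul_ne_zero hB'd hBd), map_mul, h4, ← sq,
        quadraticChar_sq_one hBd]
    obtain ⟨P, Q, hPQ, hQP, hP⟩ := class_forms hchar hs1 hBs hB'd hBd hsq
    have hconj : ∀ j, (Q * A' * P) ^ j = Q * A' ^ j * P := by
      intro j
      induction j with
      | zero => simp [hQP]
      | succ j ih =>
        rw [pow_succ, ih, pow_succ]
        calc Q * A' ^ j * P * (Q * A' * P) = Q * A' ^ j * (P * Q) * A' * P := by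
              simp only [Matrix.mul_assoc]
          _ = _ := by rw [hPQ, Matrix.mul_one]; simp only [Matrix.mul_assoc]
    have hconj1 : ∀ M : Matrix (Fin n) (Fin n) (ZMod p), P * (Q * M * P) * Q = M := by
      intro M
      calc P * (Q * M * P) * Q = (P * Q) * M * (P * Q) := by simp only [Matrix.mul_assoc]
        _ = M := by rw [hPQ]; simp
    have hPu : IsUnit P := IsUnit.of_mul_eq_one Q hPQ
    have hQu : IsUnit Q := IsUnit.of_mul_eq_one P hQP
    obtain ⟨A, hA, hAred, hApow⟩ := lift_isom_s1 hk hp2 (Q := q ^ r)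
      (((Nat.coprime_primes hp hq).2 hpq).pow_right r) hsymm hdet (A' := Q * A' * P)
      (by
        change _ * ρ B * _ = ρ B
        rw [← hP]
        calc (Q * A' * P)ᵀ * (Pᵀ * B' * P) * (Q * A' * P)
            = Pᵀ * (A'ᵀ * ((P * Q)ᵀ * B' * (P * Q)) * A') * P := by
              simp only [Matrix.transpose_mul, Matrix.mul_assoc]
          _ = _ := by rw [hPQ, Matrix.transpose_one, Matrix.one_mul, Matrix.mul_one, hi1])
      (((Matrix.isUnit_iff_isUnit_det _).1 ((hQu.mul hA'u).mul hPu)).ne_zero)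
      (by rw [hconj, hA'pow, Matrix.mul_one, hQP])
    refine ⟨A, hA, ?_, ?_⟩
    · apply Nat.dvd_antisymm (orderOf_dvd_of_pow_eq_one hApow)
      rw [← ho1]
      apply orderOf_dvd_of_pow_eq_one
      have h1 := congrArg ρ (pow_orderOf_eq_one A)
      rw [map_pow, map_one, hAred, hconj] at h1
      rw [← hconj1 (A' ^ orderOf A), h1, Matrix.mul_one, hPQ]
    · have hu : IsUnit (A - 1) := by
        rw [Matrix.isUnit_iff_isUnit_det, redH_unit_iff hk, RingHom.map_det, map_sub, hAred,
          map_one]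
        have : Q * A' * P - 1 = Q * (A' - 1) * P := by
          rw [Matrix.mul_sub, Matrix.sub_mul, Matrix.mul_one, hQP]
        rw [this]
        exact ((Matrix.isUnit_iff_isUnit_det _).1 ((hQu.mul hf1).mul hPu)).ne_zero
      intro x hx
      apply Matrix.mulVec_injective_of_isUnit hu
      rw [Matrix.mulVec_zero, Matrix.sub_mulVec, Matrix.one_mulVec, hx, sub_self]
end

section
/- Let p ≠ q be odd primes and k ≥ 1. Let B be a p^k-form of rank n and let A be an isometry of B of order exactly q with no non-zero fixed points. Then 2[q|p] divides n. -/
open Matrix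

open Polynomial in
lemma aux_roots_reverse {K : Type*} [Field K] (s : Multiset K) (h : (0 : K) ∉ s) :
    ((s.map (fun a => X - C a)).prod).reverse.roots = s.map (fun a => a⁻¹) := by
  induction s using Multiset.induction with
  | empty =>
    have h1 : (1 : K[X]).reverse = 1 := by rw [← C_1, reverse_C]
    simp [h1]
  | cons a s ih =>
    have ha : a ≠ 0 := fun h0 => h (by simp [h0])
    have hs : (0 : K) ∉ s := fun h0 => h (by simp [h0])
    have h1 : (X - C a : K[X]).reverse = C (-a) * (X - C a⁻¹) := by
      have : (X - C a : K[X]).reverse = 1 - C a * X := by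
        have h2 : (X - C a : K[X]) = C (-a) + X * 1 := by simp; ring
        rw [reverse, natDegree_X_sub_C, reflect_sub, reflect_C, ← pow_one (X : K[X]), reflect_monomial]
        simp
      rw [this]
      have h3 : (C (-a) * C a⁻¹ : K[X]) = -1 := by
        rw [← C_mul]; simp [ha]
      rw [mul_sub, h3]; simp; ring
    have hne : ((s.map (fun a => X - C a)).prod).reverse ≠ 0 := by
      rw [Ne, reverse_eq_zero]
      exact (monic_multisetProd_X_sub_C s).ne_zero
    rw [Multiset.map_cons, Multiset.prod_cons, reverse_mul_of_domain, h1, mul_assoc,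
      roots_C_mul _ (neg_ne_zero.2 ha), roots_mul (mul_ne_zero (X_sub_C_ne_zero _) hne), ih hs]
    simp

lemma aux_sum {G : Type*} [CommGroup G] [Fintype G] (H : Subgroup G) (c : G → ℕ)
    (hc : ∀ h ∈ H, ∀ g, c (g * h) = c g) : Nat.card H ∣ ∑ g, c g := by
  classical
  rw [← Finset.sum_fiberwise Finset.univ (fun g : G => (g : G ⧸ H)) c]
  refine Finset.dvd_sum fun x _ => ?_
  obtain ⟨g, rfl⟩ := QuotientGroup.mk_surjective x
  have : ∑ y ∈ Finset.univ.filter (fun y : G => (y : G ⧸ H) = (g : G ⧸ H)), c y = ∑ h : H, c (g * h) := by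
    symm
    refine Finset.sum_bij (fun h _ => g * h) ?_ ?_ ?_ ?_
    · intro h _; simp
    · intro a _ b _ hab; simpa using hab
    · intro b hb
      simp only [Finset.mem_filter, Finset.mem_univ, true_and] at hb
      exact ⟨⟨g⁻¹ * b, QuotientGroup.eq.1 hb.symm⟩, by simp, by simp⟩
    · simp
  rw [this, Finset.sum_congr rfl (fun (h : H) _ => hc (h : G) h.2 g)]
  simp

lemma aux_exists (p q : ℕ) [Fact q.Prime] (hq2 : q ≠ 2) (u : (ZMod q)ˣ) (hp : 0 < p)
    (hu : (u : ZMod q) = p) :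
    ∃ H : Subgroup (ZMod q)ˣ, Nat.card H = 2 * minExp p q ∧
      ∀ h ∈ H, ∃ i : ℕ, h = u ^ i ∨ h = - u ^ i := by
  classical
  let N : Subgroup (ZMod q)ˣ := Subgroup.zpowers (-1)
  have hN : ∀ x : (ZMod q)ˣ, x ∈ N ↔ x = 1 ∨ x = -1 := by
    intro x
    constructor
    · rintro ⟨i, rfl⟩
      rcases Int.even_or_odd i with h | h
      · left; simp [h.neg_one_zpow]
      · right; simp [h.neg_one_zpow]
    · rintro (rfl | rfl)
      · exact N.one_mem
      · exact Subgroup.mem_zpowers _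
  have hmk : ∀ a : ℕ, ((u : (ZMod q)ˣ ⧸ N)) ^ a = 1 ↔ (q ∣ p ^ a - 1 ∨ q ∣ p ^ a + 1) := by
    intro a
    rw [← QuotientGroup.mk_pow, QuotientGroup.eq_one_iff, hN]
    have h1 : 1 ≤ p ^ a := Nat.one_le_pow _ _ hp
    refine or_congr ?_ ?_
    · rw [← CharP.cast_eq_zero_iff (ZMod q) q, Units.ext_iff]
      push_cast [h1]
      rw [hu, sub_eq_zero]
    · rw [← CharP.cast_eq_zero_iff (ZMod q) q, Units.ext_iff]
      push_cast
      rw [hu, add_eq_zero_iff_eq_neg]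
  have hord : orderOf (u : (ZMod q)ˣ ⧸ N) = minExp p q := by
    apply le_antisymm
    · have hne : {a : ℕ | 0 < a ∧ (q ∣ p ^ a - 1 ∨ q ∣ p ^ a + 1)}.Nonempty :=
        ⟨_, orderOf_pos (u : (ZMod q)ˣ ⧸ N), (hmk _).1 (pow_orderOf_eq_one _)⟩
      have := Nat.sInf_mem hne
      exact orderOf_le_of_pow_eq_one this.1 ((hmk _).2 this.2)
    · exact Nat.sInf_le ⟨orderOf_pos (u : (ZMod q)ˣ ⧸ N), (hmk _).1 (pow_orderOf_eq_one _)⟩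
  have hcN : Nat.card N = 2 := by
    rw [Nat.card_zpowers]
    refine orderOf_eq_prime (by simp) ?_
    intro h
    have : Fact (2 < q) := ⟨lt_of_le_of_ne (Fact.out : q.Prime).two_le hq2.symm⟩
    exact ZMod.neg_one_ne_one (n := q) (by simpa [Units.ext_iff] using h)
  refine ⟨(Subgroup.zpowers (u : (ZMod q)ˣ ⧸ N)).comap (QuotientGroup.mk' N), ?_, ?_⟩
  · rw [← hord, ← hcN, ← Nat.card_zpowers]
    have h1 := Nat.card_congr (QuotientGroup.preimageMkEquivSubgroupProdSet N
      (Subgroup.zpowers (u : (ZMod q)ˣ ⧸ N) : Set ((ZMod q)ˣ ⧸ N)))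
    rw [Nat.card_prod] at h1
    exact h1
  · intro h hh
    rw [Subgroup.mem_comap, ← mem_powers_iff_mem_zpowers] at hh
    obtain ⟨i, hi⟩ := hh
    refine ⟨i, ?_⟩
    simp only [QuotientGroup.mk'_apply] at hi
    rw [← QuotientGroup.mk_pow, QuotientGroup.eq, hN] at hi
    rcases hi with hi | hi
    · left; exact (inv_mul_eq_one.1 hi).symm
    · right; rw [inv_mul_eq_iff_eq_mul] at hi; simpa using hi

open Polynomial in
theorem stmt2 (p q : ℕ) (hp : p.Prime) (hq : q.Prime) (hp2 : p ≠ 2) (hq2 : q ≠ 2)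
    (hpq : p ≠ q) (k : ℕ) (hk : 1 ≤ k) (n : ℕ)
    (B : Matrix (Fin n) (Fin n) (ZMod (p ^ k))) (hsymm : B.IsSymm) (hdet : IsUnit B.det)
    (A : Matrix (Fin n) (Fin n) (ZMod (p ^ k))) (hiso : Aᵀ * B * A = B)
    (hord : orderOf A = q)
    (hfix : ∀ x : Fin n → ZMod (p ^ k), A.mulVec x = x → x = 0) :
    2 * minExp p q ∣ n := by
  classical
  have : Fact p.Prime := ⟨hp⟩
  have : Fact q.Prime := ⟨hq⟩
  have : NeZero (p ^ k) := ⟨pow_ne_zero _ hp.ne_zero⟩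
  let K := AlgebraicClosure (ZMod p)
  let φ : ZMod (p ^ k) →+* K :=
    (algebraMap (ZMod p) K).comp (ZMod.castHom (dvd_pow_self p (by omega)) (ZMod p))
  have hqK : (q : K) ≠ 0 := by
    rw [Ne, CharP.cast_eq_zero_iff K p, Nat.prime_dvd_prime_iff_eq hp hq]
    exact hpq
  have : NeZero (q : K) := ⟨hqK⟩
  -- the matrix `A - 1` is invertible
  have hunit : IsUnit (A - 1).det := by
    have hinj : Function.Injective (A - 1).mulVec := by
      intro x y hxy
      have : (A - 1).mulVec (x - y) = 0 := by rw [Matrix.mulVec_sub, hxy, sub_self]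
      rw [Matrix.sub_mulVec, Matrix.one_mulVec, sub_eq_zero] at this
      exact sub_eq_zero.1 (hfix _ this)
    rw [← Matrix.isUnit_iff_isUnit_det, ← Matrix.mulVec_surjective_iff_isUnit]
    exact Finite.surjective_of_injective hinj
  let A' : Matrix (Fin n) (Fin n) K := φ.mapMatrix A
  let B' : Matrix (Fin n) (Fin n) K := φ.mapMatrix B
  have hA1 : (A' - 1).det ≠ 0 := by
    have := hunit.map φ
    rw [RingHom.map_det, map_sub, map_one] at this
    exact this.ne_zero
  have hB : IsUnit B'.det := by
    have := hdet.map φ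
    rwa [RingHom.map_det] at this
  have hiso' : A'ᵀ * B' * A' = B' := by
    have := congrArg φ.mapMatrix hiso
    rw [map_mul, map_mul] at this
    exact this
  have hpow : A' ^ q = 1 := by
    rw [← map_pow, ← hord, pow_orderOf_eq_one, map_one]
  have hAu : IsUnit A' := IsUnit.of_pow_eq_one hpow hq.ne_zero
  have hAdet : IsUnit A'.det := (Matrix.isUnit_iff_isUnit_det _).1 hAu
  let s : Multiset K := A'.charpoly.roots
  have hsplit : A'.charpoly.Splits := IsAlgClosed.splits _
  have hmonic := A'.charpoly_monic
  have hcard : s.card = n := by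
    rw [(splits_iff_card_roots.1 hsplit), Matrix.charpoly_natDegree_eq_dim, Fintype.card_fin]
  have hmem : ∀ r ∈ s, r ^ q = 1 ∧ r ≠ 1 := by
    intro r hr
    have hr' : (Matrix.scalar (Fin n) r - A').det = 0 := by
      rw [← Matrix.eval_charpoly]
      exact (mem_roots'.1 hr).2
    constructor
    · obtain ⟨v, hv0, hv⟩ := Matrix.exists_mulVec_eq_zero_iff.2 hr'
      have hv1 : A'.mulVec v = r • v := by
        rw [Matrix.sub_mulVec, sub_eq_zero] at hv
        rw [← hv]
        ext i; simp [Matrix.scalar_apply, Matrix.mulVec_diagonal]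
      have hv2 : ∀ m : ℕ, (A' ^ m).mulVec v = r ^ m • v := by
        intro m
        induction m with
        | zero => simp
        | succ m ih => rw [pow_succ, ← Matrix.mulVec_mulVec, hv1, Matrix.mulVec_smul, ih, smul_smul,
            pow_succ, mul_comm]
      have := hv2 q
      rw [hpow, Matrix.one_mulVec] at this
      have h3 : (r ^ q - 1) • v = 0 := by rw [sub_smul, one_smul, ← this, sub_self]
      rcases smul_eq_zero.1 h3 with h | h
      · exact sub_eq_zero.1 h
      · exact absurd h hv0
    · rintro rfl
      apply hA1
      rw [← neg_sub, Matrix.det_neg]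
      rw [map_one] at hr'
      rw [hr', mul_zero]
  have hfrob : s.map (frobenius K p) = s := by
    have h1 : A'.charpoly.map (frobenius K p) = A'.charpoly := by
      have hφ : (frobenius K p).comp φ = φ := Subsingleton.elim _ _
      change (φ.mapMatrix A).charpoly.map _ = (φ.mapMatrix A).charpoly
      simp only [RingHom.mapMatrix_apply]
      rw [Matrix.charpoly_map, Polynomial.map_map, hφ]
    have := hsplit.roots_map (frobenius K p)
    rw [h1] at this
    exact this.symm
  have h0s : (0 : K) ∉ s := by
    intro h
    have := (hmem 0 h).1
    rw [zero_pow hq.ne_zero] at this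
    exact zero_ne_one this
  have hinv : s.map (fun a => a⁻¹) = s := by
    have h1 : A'⁻¹.charpoly = A'.charpoly := by
      have h2 : A'⁻¹ = B'⁻¹ * (A'ᵀ * B') := by
        apply Matrix.inv_eq_left_inv
        rw [mul_assoc, hiso', Matrix.nonsing_inv_mul _ hB]
      rw [h2, Matrix.charpoly_mul_comm, mul_assoc, Matrix.mul_nonsing_inv _ hB, mul_one,
        Matrix.charpoly_transpose]
    have h2 := Matrix.charpoly_inv A' hAu
    rw [h1, ← Matrix.reverse_charpoly] at h2
    have h3 : A'.charpoly = (s.map (fun a => X - C a)).prod := hsplit.eq_prod_roots_of_monic hmonic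
    have h4 := aux_roots_reverse s h0s
    rw [← h3] at h4
    have h5 : ((-1) ^ Fintype.card (Fin n) * C (Ring.inverse A'.det) : K[X]) =
        C ((-1) ^ Fintype.card (Fin n) * Ring.inverse A'.det) := by simp
    rw [h5] at h2
    have h6 := congrArg Polynomial.roots h2
    rw [roots_C_mul, h4] at h6
    · exact h6.symm
    · refine mul_ne_zero (pow_ne_zero _ (by simp)) ?_
      rw [Ring.inverse_eq_inv']
      exact inv_ne_zero hAdet.ne_zero
  have hcf : ∀ r : K, s.count (r ^ p) = s.count r := by
    intro r
    have := Multiset.count_map_eq_count' (frobenius K p) s (frobenius K p).injective r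
    rwa [hfrob, frobenius_def] at this
  have hci : ∀ r : K, s.count (r⁻¹) = s.count r := by
    intro r
    have := Multiset.count_map_eq_count' (fun a : K => a⁻¹) s inv_injective r
    rwa [hinv] at this
  obtain ⟨ζ, hζ⟩ := HasEnoughRootsOfUnity.exists_primitiveRoot K q
  have hval : ∀ (m : ℕ), ζ ^ ((m : ZMod q).val) = ζ ^ m := by
    intro m
    rw [ZMod.val_natCast, hζ.eq_orderOf, pow_mod_orderOf]
  have hpu : IsUnit (p : ZMod q) := by
    rw [isUnit_iff_ne_zero, Ne, CharP.cast_eq_zero_iff (ZMod q) q, Nat.prime_dvd_prime_iff_eq hq hp]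
    exact hpq.symm
  obtain ⟨u, hu⟩ := hpu
  obtain ⟨H, hH, hH'⟩ := aux_exists p q hq2 u hp.pos hu
  let e : (ZMod q)ˣ → K := fun g => ζ ^ (g : ZMod q).val
  have he_u : ∀ g, e (g * u) = (e g) ^ p := by
    intro g
    simp only [e]
    rw [← pow_mul, ← hval ((g : ZMod q).val * p)]
    congr 2
    simp [hu]
  have he_neg : ∀ g, e (-g) = (e g)⁻¹ := by
    intro g
    apply eq_inv_of_mul_eq_one_left
    simp only [e]
    rw [← pow_add, ← hval]
    simp
  have hsum : ∑ g, s.count (e g) = n := by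
    have hinj : Function.Injective e := by
      intro a b hab
      have := hζ.pow_inj (ZMod.val_lt _) (ZMod.val_lt _) hab
      exact Units.ext (ZMod.val_injective q this)
    rw [← hcard, ← Multiset.sum_count_eq_card (s := Finset.univ.image e)]
    · rw [Finset.sum_image (fun a _ b _ h => hinj h)]
    · intro r hr
      obtain ⟨h1, h2⟩ := hmem r hr
      obtain ⟨i, hi, rfl⟩ := hζ.eq_pow_of_pow_eq_one h1
      have hi0 : (i : ZMod q) ≠ 0 := by
        intro h
        apply h2
        rw [← hval, h]; simp
      rw [Finset.mem_image]
      exact ⟨Units.mk0 _ hi0, Finset.mem_univ _, hval i⟩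
  rw [← hH, ← hsum]
  apply aux_sum
  have hup : ∀ (i : ℕ) (g), s.count (e (g * u ^ i)) = s.count (e g) := by
    intro i
    induction i with
    | zero => simp
    | succ i ih => intro g; rw [pow_succ, ← mul_assoc, he_u, hcf, ih]
  intro h hh g
  obtain ⟨i, rfl | rfl⟩ := hH' h hh
  · exact hup i g
  · rw [mul_neg, he_neg, hci, hup]
end
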